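/- Assume in addition that J satisfies the lower bound J(r) ≥ a₁′ exp(−b₁ r^{β₁}) for all r > 1 (with constants a₁′, b₁ > 0, β₁ > 0), and that φ satisfies the upper weak scaling condition φ(R)/φ(r) ≤ a₂ (R/r)^{α₂} for all 0 < r ≤ R ≤ 1, with a₂ > 0 and α₂ ∈ (0,2). Let p be a good heat kernel for L^κ. Then for every T ≥ 1 there is a constant c₁ ≥ 1 such that for all t ∈ (0,T] and x,y ∈ ℝ^d: if |x−y| ≤ 1 then c₁⁻¹ min{φ⁻¹(t)^{−d}, t/(|x−y|^d φ(|x−y|))} ≤ p(t,x,y) ≤ c₁ min{φ⁻¹(t)^{−d}, t/(|x−y|^d φ(|x−y|))}, and if |x−y| > 1 then c₁⁻¹ t exp(−b₁ |x−y|^{β₁}) ≤ p(t,x,y) ≤ c₁ t θ(|x−y|). -/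

import Mathlib

open MeasureTheory Filter Set

attribute [local instance] Classical.propDecidable

noncomputable def Phi (φ : ℝ → ℝ) (r : ℝ) : ℝ :=
  if r ≤ 1 then r ^ 2 / (2 * ∫ s in Set.Ioo (0:ℝ) r, s / φ s)
  else (1 / (2 * ∫ s in Set.Ioo (0:ℝ) 1, s / φ s)) * r ^ 2

noncomputable def theta (d : ℕ) (φ : ℝ → ℝ) (b β : ℝ) (r : ℝ) : ℝ :=
  if r ≤ 1 then 1 / (r ^ d * Phi φ r)
  else if β < 1 then Real.exp (-b * r ^ β)
  else r ^ (-(d : ℝ) - 1) * Real.exp (-(b / 5) * r)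

noncomputable def Gfun (d : ℕ) (φ : ℝ → ℝ) (b β : ℝ) (Φinv : ℝ → ℝ)
    (t : ℝ) (x : EuclideanSpace ℝ (Fin d)) : ℝ :=
  if x = 0 then 1 / (t * Φinv t ^ d)
  else min (1 / (t * Φinv t ^ d)) (theta d φ b β ‖x‖)

noncomputable def Gtil (d : ℕ) (φ : ℝ → ℝ) (Φinv : ℝ → ℝ)
    (t : ℝ) (x : EuclideanSpace ℝ (Fin d)) : ℝ :=
  if x = 0 then 1 / (t * Φinv t ^ d)
  else min (1 / (t * Φinv t ^ d)) (1 / (‖x‖ ^ d * Phi φ ‖x‖))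

noncomputable def Leps (d : ℕ)
    (κ : EuclideanSpace ℝ (Fin d) → EuclideanSpace ℝ (Fin d) → ℝ) (J : ℝ → ℝ)
    (ε : ℝ) (f : EuclideanSpace ℝ (Fin d) → ℝ) (x : EuclideanSpace ℝ (Fin d)) : ℝ :=
  ∫ z in {z : EuclideanSpace ℝ (Fin d) | ε < ‖z‖}, (f (x + z) - f x) * (κ x z * J ‖z‖)

structure PhiInvSpec (φ Φinv : ℝ → ℝ) : Prop where
  pos : ∀ t : ℝ, 0 < t → 0 < Φinv t
  right_inv : ∀ t : ℝ, 0 < t → Phi φ (Φinv t) = t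
  left_inv : ∀ r : ℝ, 0 < r → Φinv (Phi φ r) = r

structure HKAssumptions (d : ℕ) (φ J : ℝ → ℝ) (a₁ α₁ C₀ a b β : ℝ)
    (κ : EuclideanSpace ℝ (Fin d) → EuclideanSpace ℝ (Fin d) → ℝ)
    (κ₀ κ₁ κ₂ δ : ℝ) : Prop where
  hd : 1 ≤ d
  φ_cont : ContinuousOn φ (Set.Icc 0 1)
  φ_mono : StrictMonoOn φ (Set.Icc 0 1)
  φ_zero : φ 0 = 0
  a₁_pos : 0 < a₁
  α₁_pos : 0 < α₁
  α₁_le : α₁ ≤ 2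
  hLS : ∀ r R : ℝ, 0 < r → r ≤ R → R ≤ 1 → a₁ * (R / r) ^ α₁ ≤ φ R / φ r
  hI : MeasureTheory.IntegrableOn (fun s => s / φ s) (Set.Ioo (0:ℝ) 1)
  hC₀ : C₀ = ∫ s in Set.Ioo (0:ℝ) 1, s / φ s
  J_pos : ∀ r : ℝ, 0 < r → 0 < J r
  J_cont : ContinuousOn J (Set.Ioi 0)
  J_anti : AntitoneOn J (Set.Ioi 0)
  J_diff : ∀ r : ℝ, 0 < r → DifferentiableAt ℝ J r
  ha : 1 ≤ a
  hb : 0 < b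
  β_pos : 0 < β
  β_le : β ≤ 1
  hJ1_low : ∀ r : ℝ, 0 < r → r ≤ 1 → a⁻¹ / (r ^ d * φ r) ≤ J r
  hJ1_up : ∀ r : ℝ, 0 < r → r ≤ 1 → J r ≤ a / (r ^ d * φ r)
  hJ1_exp : ∀ r : ℝ, 1 < r → J r ≤ a * Real.exp (-b * r ^ β)
  hJ2 : AntitoneOn (fun r => -(deriv J r) / r) (Set.Ioi 0)
  κ_meas : Measurable (Function.uncurry κ)
  κ₀_pos : 0 < κ₀
  κ₁_pos : 0 < κ₁
  κ₂_pos : 0 < κ₂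
  δ_pos : 0 < δ
  δ_lt : δ < 1
  κ_low : ∀ x z, κ₀ ≤ κ x z
  κ_up : ∀ x z, κ x z ≤ κ₁
  κ_sym : ∀ x z, κ x z = κ x (-z)
  κ_holder : ∀ x y z, |κ x z - κ y z| ≤ κ₂ * ‖x - y‖ ^ δ

structure GoodHeatKernel (d : ℕ) (φ J : ℝ → ℝ) (b β : ℝ) (Φinv : ℝ → ℝ)
    (κ : EuclideanSpace ℝ (Fin d) → EuclideanSpace ℝ (Fin d) → ℝ)
    (p : ℝ → EuclideanSpace ℝ (Fin d) → EuclideanSpace ℝ (Fin d) → ℝ) : Prop where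
  cont : ContinuousOn
      (fun q : ℝ × EuclideanSpace ℝ (Fin d) × EuclideanSpace ℝ (Fin d) => p q.1 q.2.1 q.2.2)
      (Set.Ioi (0:ℝ) ×ˢ (Set.univ : Set (EuclideanSpace ℝ (Fin d) × EuclideanSpace ℝ (Fin d))))
  eqn : ∀ t : ℝ, 0 < t → ∀ x y : EuclideanSpace ℝ (Fin d), x ≠ y →
      ∃ L : ℝ, Filter.Tendsto (fun ε => Leps d κ J ε (fun x' => p t x' y) x)
          (nhdsWithin 0 (Set.Ioi 0)) (nhds L)
        ∧ HasDerivAt (fun s => p s x y) L t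
  upper : ∀ T : ℝ, 1 ≤ T → ∃ c : ℝ, 0 < c ∧ ∀ t : ℝ, 0 < t → t ≤ T →
      ∀ x y, p t x y ≤ c * t * Gfun d φ b β Φinv t (x - y)
  frac : ∀ T : ℝ, 1 ≤ T → ∃ c' : ℝ, 0 < c' ∧ ∀ ε : ℝ, 0 < ε → ε ≤ 1 →
      ∀ t : ℝ, 0 < t → t ≤ T → ∀ x y, x ≠ y →
      |Leps d κ J ε (fun x' => p t x' y) x| ≤ c' * Gtil d φ Φinv t (x - y)
  approx : ∀ f : EuclideanSpace ℝ (Fin d) → ℝ, (∃ M, ∀ x, |f x| ≤ M) →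
      UniformContinuous f → ∀ η : ℝ, 0 < η → ∃ t₀ : ℝ, 0 < t₀ ∧
      ∀ t : ℝ, 0 < t → t < t₀ → ∀ x, |(∫ y, p t x y * f y) - f x| ≤ η

/-- Generalized inverse of φ: φ⁻¹(t) = inf{s ∈ (0,1] : φ(s) ≥ t} for 0 < t ≤ φ(1),
and φ⁻¹(t) = 1 for t > φ(1). -/
noncomputable def phiInvGen (φ : ℝ → ℝ) (t : ℝ) : ℝ :=
  if t ≤ φ 1 then sInf {s : ℝ | s ∈ Set.Ioc (0:ℝ) 1 ∧ t ≤ φ s} else 1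


section Scalars

variable {d : ℕ} {φ J : ℝ → ℝ} {a₁ α₁ C₀ a b β κ₀ κ₁ κ₂ δ a₂ α₂ t r R : ℝ}
  {κ : EuclideanSpace ℝ (Fin d) → EuclideanSpace ℝ (Fin d) → ℝ} {Φinv : ℝ → ℝ}

theorem phi_pos (H : HKAssumptions d φ J a₁ α₁ C₀ a b β κ κ₀ κ₁ κ₂ δ)
    (h0 : 0 < r) (h1 : r ≤ 1) : 0 < φ r := by
  have := H.φ_mono ⟨le_rfl, zero_le_one⟩ ⟨h0.le, h1⟩ h0
  rwa [H.φ_zero] at this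

theorem phi_le_phi (H : HKAssumptions d φ J a₁ α₁ C₀ a b β κ κ₀ κ₁ κ₂ δ)
    (h0 : 0 ≤ r) (h : r ≤ R) (h1 : R ≤ 1) : φ r ≤ φ R :=
  H.φ_mono.monotoneOn ⟨h0, h.trans h1⟩ ⟨h0.trans h, h1⟩ h

theorem phi_lower_scaling (H : HKAssumptions d φ J a₁ α₁ C₀ a b β κ κ₀ κ₁ κ₂ δ)
    (h0 : 0 < r) (h : r ≤ R) (h1 : R ≤ 1) : a₁ * (R / r) ^ α₁ * φ r ≤ φ R := by
  have := H.hLS r R h0 h h1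
  rwa [le_div_iff₀ (phi_pos H h0 (h.trans h1))] at this

theorem phi_upper_scaling (H : HKAssumptions d φ J a₁ α₁ C₀ a b β κ κ₀ κ₁ κ₂ δ)
    (hUS : ∀ r R : ℝ, 0 < r → r ≤ R → R ≤ 1 → φ R / φ r ≤ a₂ * (R / r) ^ α₂)
    (h0 : 0 < r) (h : r ≤ R) (h1 : R ≤ 1) : φ R ≤ a₂ * (R / r) ^ α₂ * φ r := by
  have := hUS r R h0 h h1
  rwa [div_le_iff₀ (phi_pos H h0 (h.trans h1))] at this

theorem phiInvGen_spec (H : HKAssumptions d φ J a₁ α₁ C₀ a b β κ κ₀ κ₁ κ₂ δ) (ht : 0 < t) :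
    0 < phiInvGen φ t ∧ phiInvGen φ t ≤ 1 ∧ φ (phiInvGen φ t) = min t (φ 1) := by
  unfold phiInvGen
  split_ifs with h
  · have hmem : t ∈ Icc (φ 0) (φ 1) := ⟨by rw [H.φ_zero]; exact ht.le, h⟩
    obtain ⟨s, hs, rfl⟩ := intermediate_value_Icc zero_le_one H.φ_cont hmem
    have hs0 : 0 < s := by
      rcases hs.1.eq_or_lt with h' | h'
      · rw [← h', H.φ_zero] at ht; exact absurd ht (lt_irrefl _)
      · exact h'
    have : {u : ℝ | u ∈ Ioc (0:ℝ) 1 ∧ φ s ≤ φ u} = Icc s 1 := by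
      ext u
      constructor
      · rintro ⟨hu, hle⟩
        exact ⟨(H.φ_mono.le_iff_le hs ⟨hu.1.le, hu.2⟩).1 hle, hu.2⟩
      · rintro ⟨hu, hle⟩
        exact ⟨⟨hs0.trans_le hu, hle⟩, phi_le_phi H hs.1 hu hle⟩
    rw [this, csInf_Icc hs.2]
    exact ⟨hs0, hs.2, (min_eq_left h).symm⟩
  · exact ⟨one_pos, le_rfl, (min_eq_right (not_le.1 h).le).symm⟩

theorem phiInvGen_le_of_le (H : HKAssumptions d φ J a₁ α₁ C₀ a b β κ κ₀ κ₁ κ₂ δ) (ht : 0 < t)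
    (h0 : 0 < r) (h1 : r ≤ 1) (h : t ≤ φ r) : phiInvGen φ t ≤ r := by
  obtain ⟨p0, p1, p2⟩ := phiInvGen_spec H ht
  rw [← H.φ_mono.le_iff_le ⟨p0.le, p1⟩ ⟨h0.le, h1⟩, p2]
  exact (min_le_left _ _).trans h

theorem le_phiInvGen_of_le (H : HKAssumptions d φ J a₁ α₁ C₀ a b β κ κ₀ κ₁ κ₂ δ) (ht : 0 < t)
    (h0 : 0 < r) (h1 : r ≤ 1) (h : φ r ≤ t) : r ≤ phiInvGen φ t := by
  obtain ⟨p0, p1, p2⟩ := phiInvGen_spec H ht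
  rw [← H.φ_mono.le_iff_le ⟨h0.le, h1⟩ ⟨p0.le, p1⟩, p2]
  exact le_min h (phi_le_phi H h0.le h1 le_rfl)

theorem phiInvGen_mono (H : HKAssumptions d φ J a₁ α₁ C₀ a b β κ κ₀ κ₁ κ₂ δ) {s : ℝ} (hs : 0 < s)
    (h : s ≤ t) : phiInvGen φ s ≤ phiInvGen φ t := by
  obtain ⟨p0, p1, p2⟩ := phiInvGen_spec H hs
  exact le_phiInvGen_of_le H (hs.trans_le h) p0 p1 (p2 ▸ (min_le_left _ _).trans h)

theorem integrableOn_div_phi (H : HKAssumptions d φ J a₁ α₁ C₀ a b β κ κ₀ κ₁ κ₂ δ) (h1 : r ≤ 1) :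
    IntegrableOn (fun s => s / φ s) (Ioo 0 r) :=
  H.hI.mono_set (Ioo_subset_Ioo_right h1)

theorem integral_div_phi_lower (H : HKAssumptions d φ J a₁ α₁ C₀ a b β κ κ₀ κ₁ κ₂ δ)
    (h0 : 0 < r) (h1 : r ≤ 1) : r ^ 2 / (2 * φ r) ≤ ∫ s in Ioo 0 r, s / φ s := by
  have hφ := phi_pos H h0 h1
  have : ∫ s in Ioo 0 r, s / φ r = r ^ 2 / (2 * φ r) := by
    rw [← integral_Ioc_eq_integral_Ioo, ← intervalIntegral.integral_of_le h0.le,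
      intervalIntegral.integral_div, integral_id]
    field_simp
    ring
  rw [← this]
  refine setIntegral_mono_on ?_ (integrableOn_div_phi H h1) measurableSet_Ioo ?_
  · exact ((continuous_id.div_const _).integrableOn_Icc (a := 0) (b := r)).mono_set Ioo_subset_Icc_self
  · intro s hs
    exact div_le_div_of_nonneg_left hs.1.le (phi_pos H hs.1 (hs.2.le.trans h1))
      (phi_le_phi H hs.1.le hs.2.le h1)

theorem integral_div_phi_upper (H : HKAssumptions d φ J a₁ α₁ C₀ a b β κ κ₀ κ₁ κ₂ δ)
    (hα₂' : α₂ < 2)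
    (hUS : ∀ r R : ℝ, 0 < r → r ≤ R → R ≤ 1 → φ R / φ r ≤ a₂ * (R / r) ^ α₂)
    (h0 : 0 < r) (h1 : r ≤ 1) :
    ∫ s in Ioo 0 r, s / φ s ≤ a₂ / (2 - α₂) * (r ^ 2 / φ r) := by
  have hφ := phi_pos H h0 h1
  have hInt : IntervalIntegrable (fun s : ℝ => s ^ (1 - α₂)) volume 0 r :=
    intervalIntegral.intervalIntegrable_rpow' (by linarith)
  have hI : ∫ s in Ioo 0 r, a₂ * r ^ α₂ / φ r * s ^ (1 - α₂) = a₂ / (2 - α₂) * (r ^ 2 / φ r) := by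
    rw [← integral_Ioc_eq_integral_Ioo, ← intervalIntegral.integral_of_le h0.le,
      intervalIntegral.integral_const_mul, integral_rpow (Or.inl (by linarith))]
    have e1 : 1 - α₂ + 1 = 2 - α₂ := by ring
    rw [e1, Real.zero_rpow (by linarith), Real.rpow_sub h0]
    have : r ^ α₂ ≠ 0 := (Real.rpow_pos_of_pos h0 _).ne'
    have : 2 - α₂ ≠ 0 := by linarith
    rw [Real.rpow_two]
    field_simp
    ring
  rw [← hI]
  refine setIntegral_mono_on (integrableOn_div_phi H h1) ?_ measurableSet_Ioo ?_
  · exact (((intervalIntegrable_iff_integrableOn_Ioc_of_le h0.le).1 hInt).mono_set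
      Ioo_subset_Ioc_self).const_mul _
  · intro s hs
    have hφs := phi_pos H hs.1 (hs.2.le.trans h1)
    have := phi_upper_scaling H hUS hs.1 hs.2.le h1
    rw [div_le_iff₀ hφs, Real.rpow_sub hs.1, Real.rpow_one]
    rw [Real.div_rpow h0.le hs.1.le] at this
    have hsα := Real.rpow_pos_of_pos hs.1 α₂
    have h2 : a₂ * r ^ α₂ / φ r * (s / s ^ α₂) * φ s
        = s * ((a₂ * (r ^ α₂ / s ^ α₂) * φ s) / φ r) := by
      field_simp
    rw [h2]
    have : 1 ≤ (a₂ * (r ^ α₂ / s ^ α₂) * φ s) / φ r := by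
      rw [le_div_iff₀ hφ]; linarith
    nlinarith [hs.1]

theorem Phi_pos (H : HKAssumptions d φ J a₁ α₁ C₀ a b β κ κ₀ κ₁ κ₂ δ) (h0 : 0 < r) :
    0 < Phi φ r := by
  have key : ∀ {q : ℝ}, 0 < q → q ≤ 1 → 0 < ∫ s in Ioo 0 q, s / φ s := fun {q} hq hq1 =>
    lt_of_lt_of_le (by have := phi_pos H hq hq1; positivity) (integral_div_phi_lower H hq hq1)
  unfold Phi
  split_ifs with h
  · have := key h0 h; positivity
  · have := key one_pos le_rfl; positivity

theorem Phi_le_phi (H : HKAssumptions d φ J a₁ α₁ C₀ a b β κ κ₀ κ₁ κ₂ δ)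
    (h0 : 0 < r) (h1 : r ≤ 1) : Phi φ r ≤ φ r := by
  have hφ := phi_pos H h0 h1
  have h := integral_div_phi_lower H h0 h1
  have hI : 0 < ∫ s in Ioo 0 r, s / φ s := lt_of_lt_of_le (by positivity) h
  rw [Phi, if_pos h1, div_le_iff₀ (by positivity)]
  rw [div_le_iff₀ (by positivity)] at h
  linarith

theorem phi_le_Phi (H : HKAssumptions d φ J a₁ α₁ C₀ a b β κ κ₀ κ₁ κ₂ δ)
    (hα₂' : α₂ < 2)
    (hUS : ∀ r R : ℝ, 0 < r → r ≤ R → R ≤ 1 → φ R / φ r ≤ a₂ * (R / r) ^ α₂)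
    (h0 : 0 < r) (h1 : r ≤ 1) : φ r ≤ 2 * a₂ / (2 - α₂) * Phi φ r := by
  have hφ := phi_pos H h0 h1
  have h := integral_div_phi_upper H hα₂' hUS h0 h1
  have hI : 0 < ∫ s in Ioo 0 r, s / φ s :=
    lt_of_lt_of_le (by positivity) (integral_div_phi_lower H h0 h1)
  have h2 : 0 < 2 - α₂ := by linarith
  rw [Phi, if_pos h1, ← mul_div_assoc, le_div_iff₀ (by positivity)]
  have := mul_le_mul_of_nonneg_left h (by positivity : 0 ≤ 2 * φ r)
  calc φ r * (2 * ∫ s in Ioo 0 r, s / φ s) = 2 * φ r * ∫ s in Ioo 0 r, s / φ s := by ring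
    _ ≤ _ := this
    _ = _ := by field_simp

theorem phiInvGen_le_PhiInv (H : HKAssumptions d φ J a₁ α₁ C₀ a b β κ κ₀ κ₁ κ₂ δ)
    (HΦ : PhiInvSpec φ Φinv) (ht : 0 < t) : phiInvGen φ t ≤ Φinv t := by
  rcases le_total (Φinv t) 1 with h | h
  · refine phiInvGen_le_of_le H ht (HΦ.pos t ht) h ?_
    calc t = Phi φ (Φinv t) := (HΦ.right_inv t ht).symm
      _ ≤ _ := Phi_le_phi H (HΦ.pos t ht) h
  · exact (phiInvGen_spec H ht).2.1.trans h

end Scalars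

section LevyDensity

/-- Euclidean space of dimension `d`. -/
abbrev Euc (d : ℕ) : Type := EuclideanSpace ℝ (Fin d)

/-- The integrability properties of the radial jump density `z ↦ J ‖z‖` at the scales of `φ`. -/
structure LevyDensity (d : ℕ) (φ J : ℝ → ℝ) (K : ℝ) : Prop where
  pos_K : 0 < K
  pos_φ : ∀ r, 0 < r → r ≤ 1 → 0 < φ r
  pos_J : ∀ r, 0 < r → 0 < J r
  meas : Measurable fun z : Euc d => J ‖z‖
  integrable : ∀ r, 0 < r → r ≤ 1 →
    Integrable fun z : Euc d => min 1 (‖z‖ ^ 2 / r ^ 2) * J ‖z‖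
  bound : ∀ r, 0 < r → r ≤ 1 → ∫ z : Euc d, min 1 (‖z‖ ^ 2 / r ^ 2) * J ‖z‖ ≤ K / φ r

theorem integrableOn_and_setIntegral_le {X : Type*} [MeasurableSpace X] {μ : Measure X}
    {f g : X → ℝ} {s : Set X} (hs : MeasurableSet s) (hg : IntegrableOn g s μ)
    (hf : AEStronglyMeasurable f (μ.restrict s)) (h0 : ∀ x ∈ s, 0 ≤ f x)
    (h : ∀ x ∈ s, f x ≤ g x) : IntegrableOn f s μ ∧ ∫ x in s, f x ∂μ ≤ ∫ x in s, g x ∂μ := by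
  have hi : IntegrableOn f s μ := by
    refine Integrable.mono' hg hf ?_
    filter_upwards [ae_restrict_mem hs] with x hx
    rw [Real.norm_of_nonneg (h0 x hx)]
    exact h x hx
  exact ⟨hi, setIntegral_mono_on hi hg hs h⟩

variable {d : ℕ} {φ J : ℝ → ℝ} {a₁ α₁ C₀ a b β κ₀ κ₁ κ₂ δ a₂ α₂ : ℝ}
  {κ : Euc d → Euc d → ℝ}

theorem integral_Ioc_rpow_le {r α : ℝ} (h0 : 0 < r) (h1 : r ≤ 1) (hα : 0 < α) :
    IntegrableOn (fun y : ℝ => r ^ α * y ^ (-1 - α)) (Ioc r 1) ∧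
      ∫ y in Ioc r 1, r ^ α * y ^ (-1 - α) ≤ 1 / α := by
  have hn : (0:ℝ) ∉ uIcc r 1 := by rw [uIcc_of_le h1]; exact fun h => absurd h.1 (not_le.2 h0)
  constructor
  · rw [← intervalIntegrable_iff_integrableOn_Ioc_of_le h1]
    exact (intervalIntegral.intervalIntegrable_rpow (Or.inr hn)).const_mul _
  · rw [← intervalIntegral.integral_of_le h1, intervalIntegral.integral_const_mul,
      integral_rpow (Or.inr ⟨by linarith, hn⟩)]
    have e : -1 - α + 1 = -α := by ring
    rw [e, Real.one_rpow, Real.rpow_neg h0.le]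
    have hr := Real.rpow_pos_of_pos h0 α
    have : r ^ α * ((1 - (r ^ α)⁻¹) / -α) = (1 - r ^ α) / α := by field_simp; ring
    rw [this]
    gcongr
    linarith

theorem pow_pred_mul_div {d : ℕ} (hd : 1 ≤ d) {y c f : ℝ} (hy : 0 < y) :
    y ^ (d - 1) * (c / (y ^ d * f)) = c / (y * f) := by
  obtain ⟨n, rfl⟩ : ∃ n, d = n + 1 := ⟨d - 1, by omega⟩
  rw [Nat.add_sub_cancel, pow_succ]
  by_cases hf : f = 0
  · simp [hf]
  · field_simp

theorem exists_radial_levy_bound (H : HKAssumptions d φ J a₁ α₁ C₀ a b β κ κ₀ κ₁ κ₂ δ)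
    (hα₂' : α₂ < 2)
    (hUS : ∀ r R : ℝ, 0 < r → r ≤ R → R ≤ 1 → φ R / φ r ≤ a₂ * (R / r) ^ α₂) :
    ∃ K : ℝ, ∀ r, 0 < r → r ≤ 1 →
      IntegrableOn (fun y : ℝ => y ^ (d - 1) * (min 1 (y ^ 2 / r ^ 2) * J y)) (Ioi 0) ∧
      ∫ y in Ioi (0:ℝ), y ^ (d - 1) * (min 1 (y ^ 2 / r ^ 2) * J y) ≤ K / φ r := by
  set M := ∫ y in Ioi (1:ℝ), a * (y ^ ((d - 1 : ℕ) : ℝ) * Real.exp (-b * y ^ β)) with hM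
  have hMi : IntegrableOn (fun y : ℝ => a * (y ^ ((d - 1 : ℕ) : ℝ) * Real.exp (-b * y ^ β)))
      (Ioi 1) := ((integrableOn_rpow_mul_exp_neg_mul_rpow
        (by have : (0:ℝ) ≤ ((d - 1 : ℕ) : ℝ) := by positivity
            linarith) H.β_pos H.hb).mono_set (Ioi_subset_Ioi zero_le_one)).const_mul _
  have ha := H.ha
  have hM0 : 0 ≤ M := setIntegral_nonneg measurableSet_Ioi fun y hy => by
    have : (0:ℝ) < y := zero_lt_one.trans hy
    positivity
  refine ⟨a * (a₂ / (2 - α₂)) + a / a₁ * (1 / α₁) + M * φ 1, fun r h0 h1 => ?_⟩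
  have hφ := phi_pos H h0 h1
  set F : ℝ → ℝ := fun y => y ^ (d - 1) * (min 1 (y ^ 2 / r ^ 2) * J y) with hF
  have hcont : ContinuousOn F (Ioi 0) := by
    refine (by fun_prop : Continuous fun y : ℝ => y ^ (d - 1)).continuousOn.mul
      (ContinuousOn.mul ?_ H.J_cont)
    exact (by fun_prop : Continuous fun y : ℝ => min 1 (y ^ 2 / r ^ 2)).continuousOn
  have hF0 : ∀ y, 0 < y → 0 ≤ F y := fun y hy => by
    have := H.J_pos y hy
    simp only [hF]; positivity
  have hms : ∀ s ⊆ Ioi (0:ℝ), MeasurableSet s → AEStronglyMeasurable F (volume.restrict s) :=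
    fun s hs hm => (hcont.mono hs).aestronglyMeasurable hm
  have hJ1 : ∀ y, 0 < y → y ≤ 1 → y ^ (d - 1) * J y ≤ a / (y * φ y) := fun y hy hy1 => by
    rw [← pow_pred_mul_div H.hd hy]
    exact mul_le_mul_of_nonneg_left (H.hJ1_up y hy hy1) (by positivity)
  obtain ⟨i1, b1⟩ := integrableOn_and_setIntegral_le (f := F) (g := fun y => a / r ^ 2 * (y / φ y))
    measurableSet_Ioo ((integrableOn_div_phi H h1).const_mul _)
    (hms _ (fun y hy => hy.1) measurableSet_Ioo) (fun y hy => hF0 y hy.1) (fun y hy => by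
      have hφy := phi_pos H hy.1 (hy.2.le.trans h1)
      have hJ := H.J_pos y hy.1
      have hy0 := hy.1
      calc F y ≤ y ^ (d - 1) * (y ^ 2 / r ^ 2 * J y) := by
            simp only [hF]; gcongr; exact min_le_right _ _
        _ = y ^ 2 / r ^ 2 * (y ^ (d - 1) * J y) := by ring
        _ ≤ y ^ 2 / r ^ 2 * (a / (y * φ y)) := by
            gcongr; exact hJ1 y hy.1 (hy.2.le.trans h1)
        _ = _ := by field_simp)
  obtain ⟨i2', b2'⟩ := integral_Ioc_rpow_le h0 h1 H.α₁_pos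
  obtain ⟨i2, b2⟩ := integrableOn_and_setIntegral_le (f := F)
    (g := fun y => a / (a₁ * φ r) * (r ^ α₁ * y ^ (-1 - α₁)))
    measurableSet_Ioc (i2'.const_mul _)
    (hms _ (fun y hy => h0.trans hy.1) measurableSet_Ioc) (fun y hy => hF0 y (h0.trans hy.1))
    (fun y hy => by
      have hy0 := h0.trans hy.1
      have hφy := phi_pos H hy0 hy.2
      have hJ := H.J_pos y hy0
      have ha1 := H.a₁_pos
      have hs := phi_lower_scaling H h0 hy.1.le hy.2
      rw [Real.div_rpow hy0.le h0.le] at hs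
      have hyα := Real.rpow_pos_of_pos hy0 α₁
      have hrα := Real.rpow_pos_of_pos h0 α₁
      calc F y ≤ y ^ (d - 1) * (1 * J y) := by
            simp only [hF]; gcongr; exact min_le_left _ _
        _ ≤ a / (y * φ y) := by rw [one_mul]; exact hJ1 y hy0 hy.2
        _ ≤ a / (y * (a₁ * (y ^ α₁ / r ^ α₁) * φ r)) := by gcongr
        _ = _ := by
          rw [show -1 - α₁ = -(1 + α₁) by ring, Real.rpow_neg hy0.le, Real.rpow_add hy0,
            Real.rpow_one]
          field_simp)
  obtain ⟨i3, b3⟩ := integrableOn_and_setIntegral_le (f := F)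
    measurableSet_Ioi hMi (hms _ (Ioi_subset_Ioi zero_le_one) measurableSet_Ioi)
    (fun y hy => hF0 y (zero_lt_one.trans hy))
    (fun y hy => by
      have hy0 : 0 < y := zero_lt_one.trans hy
      have hJ := H.J_pos y hy0
      calc F y ≤ y ^ (d - 1) * (1 * J y) := by
            simp only [hF]; gcongr; exact min_le_left _ _
        _ ≤ y ^ (d - 1) * (1 * (a * Real.exp (-b * y ^ β))) := by
            gcongr; exact H.hJ1_exp y hy
        _ = _ := by rw [Real.rpow_natCast]; ring)
  have i1' : IntegrableOn F (Ioc 0 r) := by rwa [integrableOn_Ioc_iff_integrableOn_Ioo]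
  have i12 : IntegrableOn F (Ioc 0 1) := by
    rw [← Ioc_union_Ioc_eq_Ioc h0.le h1]; exact i1'.union i2
  have hi : IntegrableOn F (Ioi 0) := by
    rw [← Ioc_union_Ioi_eq_Ioi (zero_le_one' ℝ)]; exact i12.union i3
  refine ⟨hi, ?_⟩
  have e : ∫ y in Ioi (0:ℝ), F y
      = (∫ y in Ioo 0 r, F y) + (∫ y in Ioc r 1, F y) + ∫ y in Ioi 1, F y := by
    rw [← Ioc_union_Ioi_eq_Ioi (zero_le_one' ℝ), setIntegral_union (Ioc_disjoint_Ioi le_rfl)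
      measurableSet_Ioi i12 i3, ← Ioc_union_Ioc_eq_Ioc h0.le h1,
      setIntegral_union (Ioc_disjoint_Ioc_of_le le_rfl) measurableSet_Ioc i1' i2,
      integral_Ioc_eq_integral_Ioo]
  rw [e]
  have hφ1 : φ r ≤ φ 1 := phi_le_phi H h0.le h1 le_rfl
  have c1 : ∫ y in Ioo 0 r, F y ≤ a * (a₂ / (2 - α₂)) / φ r := by
    refine b1.trans ?_
    rw [integral_const_mul]
    calc _ ≤ a / r ^ 2 * (a₂ / (2 - α₂) * (r ^ 2 / φ r)) := by
          gcongr; exact integral_div_phi_upper H hα₂' hUS h0 h1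
      _ = _ := by field_simp
  have c2 : ∫ y in Ioc r 1, F y ≤ a / a₁ * (1 / α₁) / φ r := by
    refine b2.trans ?_
    rw [integral_const_mul]
    have := H.a₁_pos
    calc _ ≤ a / (a₁ * φ r) * (1 / α₁) := by gcongr
      _ = _ := by have := H.α₁_pos; field_simp
  have c3 : ∫ y in Ioi 1, F y ≤ M * φ 1 / φ r := by
    refine b3.trans ?_
    rw [le_div_iff₀ hφ]
    gcongr
  rw [add_div, add_div]
  linarith

theorem measurable_comp_norm_of_continuousOn {f : ℝ → ℝ} (hf : ContinuousOn f (Ioi 0)) :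
    Measurable fun z : Euc d => f ‖z‖ := by
  have h : (fun z : Euc d => f ‖z‖) = ({0}ᶜ : Set (Euc d)).piecewise (fun z => f ‖z‖)
      (fun _ => f 0) := by
    ext z
    by_cases hz : z = 0 <;> simp [hz, Set.piecewise]
  rw [h]
  refine ContinuousOn.measurable_piecewise ?_ continuousOn_const (measurableSet_singleton _).compl
  exact hf.comp continuous_norm.continuousOn fun z hz => norm_pos_iff.2 hz

theorem exists_levyDensity (H : HKAssumptions d φ J a₁ α₁ C₀ a b β κ κ₀ κ₁ κ₂ δ)
    (hα₂' : α₂ < 2)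
    (hUS : ∀ r R : ℝ, 0 < r → r ≤ R → R ≤ 1 → φ R / φ r ≤ a₂ * (R / r) ^ α₂) :
    ∃ K, LevyDensity d φ J K := by
  obtain ⟨K, hK⟩ := exists_radial_levy_bound H hα₂' hUS
  have : Nonempty (Fin d) := ⟨⟨0, H.hd⟩⟩
  set V : ℝ := d * (volume : Measure (Euc d)).real (Metric.ball 0 1) with hV
  refine ⟨max 1 (V * K), lt_max_of_lt_left one_pos, fun r h0 h1 => phi_pos H h0 h1, H.J_pos,
    measurable_comp_norm_of_continuousOn H.J_cont, fun r h0 h1 => ?_, fun r h0 h1 => ?_⟩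
  · have := (integrable_fun_norm_addHaar (volume : Measure (Euc d))
      (f := fun y => min 1 (y ^ 2 / r ^ 2) * J y)).2
    refine this ?_
    simpa using (hK r h0 h1).1
  · have := integral_fun_norm_addHaar (volume : Measure (Euc d))
      (fun y => min 1 (y ^ 2 / r ^ 2) * J y)
    simp only [finrank_euclideanSpace, Fintype.card_fin, smul_eq_mul, nsmul_eq_mul] at this
    rw [this, ← mul_assoc]
    have hφ := phi_pos H h0 h1
    calc _ ≤ V * (K / φ r) := by
          rw [hV]; gcongr; exact (hK r h0 h1).2
      _ = V * K / φ r := by ring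
      _ ≤ _ := by gcongr; exact le_max_right _ _

end LevyDensity

section MaximumPrinciple

/-- A real function on a topological space that attains a negative value, and is almost
nonnegative at infinity, has a global minimum. -/
theorem exists_forall_le_of_neg {X : Type*} [TopologicalSpace X] {f : X → ℝ} (hf : Continuous f)
    (hinf : ∀ η : ℝ, 0 < η → ∀ᶠ x in cocompact X, -η < f x) {x₀ : X} (hx₀ : f x₀ < 0) :
    ∃ x, ∀ y, f x ≤ f y := by
  refine hf.exists_forall_le' x₀ ?_
  filter_upwards [hinf (-f x₀) (by linarith)] with x hx
  linarith

/-- A parabolic minimum principle: a function which is nonnegative initially, almost nonnegative at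
infinity, and strictly increasing in time at each negative spatial minimum, is nonnegative. -/
theorem nonneg_of_deriv_pos_at_min {X : Type*} [TopologicalSpace X] {T : ℝ} {w : ℝ → X → ℝ}
    (hcont : ∀ t ∈ Icc 0 T, Continuous (w t))
    (hinf : ∀ t ∈ Icc 0 T, ∀ η : ℝ, 0 < η → ∀ᶠ x in cocompact X, -η < w t x)
    (htime : ∀ t ∈ Icc 0 T, ∀ η : ℝ, 0 < η →
      ∀ᶠ s in nhdsWithin t (Icc 0 T), ∀ x, |w s x - w t x| ≤ η)
    (h0 : ∀ x, 0 ≤ w 0 x)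
    (hder : ∀ t ∈ Ioc 0 T, ∀ x, w t x < 0 → (∀ y, w t x ≤ w t y) →
      ∃ D : ℝ, 0 < D ∧ HasDerivAt (fun s => w s x) D t) :
    ∀ t ∈ Icc 0 T, ∀ x, 0 ≤ w t x := by
  by_contra! hcon
  obtain ⟨t₁, ht₁, x₁, hx₁⟩ := hcon
  have hbdd : ∀ t ∈ Icc 0 T, BddBelow (range (w t)) := fun t ht => by
    by_cases hneg : ∃ x, w t x < 0
    · obtain ⟨x, hx⟩ := hneg
      obtain ⟨z, hz⟩ := exists_forall_le_of_neg (hcont t ht) (hinf t ht) hx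
      exact ⟨w t z, by rintro _ ⟨y, rfl⟩; exact hz y⟩
    · push Not at hneg
      exact ⟨0, by rintro _ ⟨y, rfl⟩; exact hneg y⟩
  have : Nonempty X := ⟨x₁⟩
  set m : ℝ → ℝ := fun t => ⨅ x, w t x with hm
  have hmcont : ContinuousOn m (Icc 0 T) := by
    intro t ht
    rw [ContinuousWithinAt, Metric.tendsto_nhds]
    intro η hη
    filter_upwards [htime t ht (η / 2) (half_pos hη), self_mem_nhdsWithin] with s hs hsT
    rw [Real.dist_eq]
    have e1 : m s - η / 2 ≤ m t := by
      refine le_ciInf fun x => ?_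
      have := ciInf_le (hbdd s hsT) x
      have h2 := abs_le.1 (hs x)
      simp only [hm] at *; linarith [h2.2]
    have e2 : m t - η / 2 ≤ m s := by
      refine le_ciInf fun x => ?_
      have := ciInf_le (hbdd t ht) x
      have h2 := abs_le.1 (hs x)
      simp only [hm] at *; linarith [h2.1]
    rw [abs_lt]; constructor <;> linarith
  obtain ⟨t₀, ht₀, hmin⟩ := isCompact_Icc.exists_isMinOn ⟨t₁, ht₁⟩ hmcont
  have hle : m t₀ ≤ w t₁ x₁ := (hmin ht₁).trans (ciInf_le (hbdd t₁ ht₁) x₁)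
  obtain ⟨y, hy⟩ : ∃ y, w t₀ y < 0 := exists_lt_of_ciInf_lt (hle.trans_lt hx₁)
  obtain ⟨x₀, hx₀⟩ := exists_forall_le_of_neg (hcont t₀ ht₀) (hinf t₀ ht₀) hy
  have hneg : w t₀ x₀ < 0 := (hx₀ y).trans_lt hy
  have hall : ∀ s ∈ Icc 0 T, w t₀ x₀ ≤ w s x₀ := fun s hs =>
    (le_ciInf hx₀ : w t₀ x₀ ≤ m t₀).trans ((hmin hs).trans (ciInf_le (hbdd s hs) x₀))
  have ht₀' : 0 < t₀ := by
    rcases ht₀.1.eq_or_lt with h | h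
    · exact absurd (h0 x₀) (not_le.2 (by have := hneg; rwa [← h] at this))
    · exact h
  obtain ⟨D, hD, hder'⟩ := hder t₀ ⟨ht₀', ht₀.2⟩ x₀ hneg hx₀
  have hslope := (hasDerivAt_iff_tendsto_slope.1 hder').mono_left
    (nhdsWithin_mono t₀ (fun s (hs : s ∈ Iio t₀) => (ne_of_lt hs : s ≠ t₀)))
  have hev := hslope.eventually (lt_mem_nhds hD)
  have hev2 : ∀ᶠ s in nhdsWithin t₀ (Iio t₀), s ∈ Ioo 0 t₀ := Ioo_mem_nhdsLT ht₀'
  obtain ⟨s, hs1, hs2⟩ := (hev.and hev2).exists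
  rw [slope_def_field] at hs1
  have h1 := hall s ⟨hs2.1.le, hs2.2.le.trans ht₀.2⟩
  have : (w s x₀ - w t₀ x₀) / (s - t₀) ≤ 0 :=
    div_nonpos_of_nonneg_of_nonpos (by linarith) (by linarith [hs2.2])
  linarith

end MaximumPrinciple

section JumpOperator

/-- The properties of the coefficient `κ`. -/
structure JumpCoeff (d : ℕ) (κ : Euc d → Euc d → ℝ) (κ₀ κ₁ κ₂ δ : ℝ) : Prop where
  meas : Measurable (Function.uncurry κ)
  pos₀ : 0 < κ₀
  pos₁ : 0 < κ₁
  pos₂ : 0 < κ₂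
  pos_δ : 0 < δ
  δ_lt : δ < 1
  low : ∀ x z, κ₀ ≤ κ x z
  up : ∀ x z, κ x z ≤ κ₁
  sym : ∀ x z, κ x z = κ x (-z)
  holder : ∀ x y z, |κ x z - κ y z| ≤ κ₂ * ‖x - y‖ ^ δ

theorem HKAssumptions.jumpCoeff {d : ℕ} {φ J : ℝ → ℝ} {a₁ α₁ C₀ a b β κ₀ κ₁ κ₂ δ : ℝ}
    {κ : Euc d → Euc d → ℝ} (H : HKAssumptions d φ J a₁ α₁ C₀ a b β κ κ₀ κ₁ κ₂ δ) :
    JumpCoeff d κ κ₀ κ₁ κ₂ δ :=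
  ⟨H.κ_meas, H.κ₀_pos, H.κ₁_pos, H.κ₂_pos, H.δ_pos, H.δ_lt, H.κ_low, H.κ_up, H.κ_sym, H.κ_holder⟩

variable {d : ℕ} {φ J : ℝ → ℝ} {K κ₀ κ₁ κ₂ δ ε r M : ℝ} {κ : Euc d → Euc d → ℝ}
  {f g : Euc d → ℝ} {x : Euc d}

/-- The symmetric second difference of `f` at `x` in the direction `z`. -/
def secondDiff (f : Euc d → ℝ) (x z : Euc d) : ℝ := f (x + z) + f (x - z) - 2 * f x

/-- The jump operator with coefficient `κ`, in its symmetrized form. -/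
noncomputable def jumpOp (κ : Euc d → Euc d → ℝ) (J : ℝ → ℝ) (f : Euc d → ℝ) (x : Euc d) : ℝ :=
  (1 / 2) * ∫ z, secondDiff f x z * (κ x z * J ‖z‖)

theorem JumpCoeff.nonneg (hκ : JumpCoeff d κ κ₀ κ₁ κ₂ δ) (x z : Euc d) : 0 ≤ κ x z :=
  hκ.pos₀.le.trans (hκ.low x z)

theorem JumpCoeff.measurable_right (hκ : JumpCoeff d κ κ₀ κ₁ κ₂ δ) (x : Euc d) :
    Measurable (κ x) := hκ.meas.comp measurable_prodMk_left

theorem measurableSet_lt_norm (ε : ℝ) : MeasurableSet {z : Euc d | ε < ‖z‖} :=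
  measurableSet_lt measurable_const measurable_norm

theorem LevyDensity.nonneg_ae (hJ : LevyDensity d φ J K) [Nonempty (Fin d)] :
    ∀ᵐ z : Euc d, 0 ≤ J ‖z‖ := by
  have : ∀ᵐ z : Euc d, z ≠ 0 := by simp [ae_iff]
  filter_upwards [this] with z hz
  exact (hJ.pos_J _ (norm_pos_iff.2 hz)).le

theorem LevyDensity.integrableOn (hJ : LevyDensity d φ J K) (hε : 0 < ε) :
    IntegrableOn (fun z : Euc d => J ‖z‖) {z | ε < ‖z‖} := by
  have hm : 0 < min ε 1 := lt_min hε one_pos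
  refine Integrable.mono' (hJ.integrable _ hm (min_le_right _ _)).integrableOn
    hJ.meas.aestronglyMeasurable ?_
  filter_upwards [ae_restrict_mem (measurableSet_lt_norm ε)] with z hz
  have hz' : min ε 1 ≤ ‖z‖ := (min_le_left _ _).trans (le_of_lt hz)
  have : (1:ℝ) ≤ ‖z‖ ^ 2 / (min ε 1) ^ 2 := by
    rw [one_le_div (by positivity)]; gcongr
  rw [min_eq_left this, one_mul, Real.norm_of_nonneg (hJ.pos_J _ (hε.trans hz)).le]

theorem integrableOn_jump (hJ : LevyDensity d φ J K) (hκ : JumpCoeff d κ κ₀ κ₁ κ₂ δ) (hε : 0 < ε)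
    {F : Euc d → ℝ} (hF : Measurable F) (hM : ∀ z, |F z| ≤ M) (x : Euc d) :
    IntegrableOn (fun z => F z * (κ x z * J ‖z‖)) {z | ε < ‖z‖} := by
  have hM0 : 0 ≤ M := (abs_nonneg _).trans (hM 0)
  refine Integrable.mono' ((hJ.integrableOn hε).const_mul (M * κ₁))
    (hF.mul ((hκ.measurable_right x).mul hJ.meas)).aestronglyMeasurable ?_
  filter_upwards [ae_restrict_mem (measurableSet_lt_norm ε)] with z hz
  have h1 := hJ.pos_J _ (hε.trans hz)
  rw [norm_mul, norm_mul, Real.norm_eq_abs, Real.norm_of_nonneg (hκ.nonneg x z),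
    Real.norm_of_nonneg h1.le, mul_assoc]
  have := hκ.nonneg x z
  gcongr
  exacts [hM z, hκ.up x z]

theorem Leps_nonneg_of_min (hJ : LevyDensity d φ J K) (hκ : JumpCoeff d κ κ₀ κ₁ κ₂ δ)
    (hε : 0 < ε) (hmin : ∀ y, f x ≤ f y) : 0 ≤ Leps d κ J ε f x := by
  refine setIntegral_nonneg (measurableSet_lt_norm ε) fun z hz => ?_
  have h1 := hJ.pos_J _ (hε.trans hz)
  have := hκ.nonneg x z
  have := hmin (x + z)
  have : 0 ≤ f (x + z) - f x := by linarith
  positivity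

theorem integrableOn_Leps (hJ : LevyDensity d φ J K) (hκ : JumpCoeff d κ κ₀ κ₁ κ₂ δ)
    (hε : 0 < ε) (hf : Measurable f) (hM : ∀ y, |f y| ≤ M) :
    IntegrableOn (fun z => (f (x + z) - f x) * (κ x z * J ‖z‖)) {z | ε < ‖z‖} :=
  integrableOn_jump (M := 2 * M) hJ hκ hε
    ((hf.comp (measurable_const_add x)).sub measurable_const)
    (F := fun z => f (x + z) - f x) (fun z => by
      have h1 := abs_le.1 (hM (x + z)); have h2 := abs_le.1 (hM x)
      rw [abs_le]; constructor <;> linarith) x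

theorem Leps_add_mul (hJ : LevyDensity d φ J K) (hκ : JumpCoeff d κ κ₀ κ₁ κ₂ δ)
    (hε : 0 < ε) (hf : Measurable f) (hM : ∃ M, ∀ y, |f y| ≤ M) (hg : Measurable g)
    (hN : ∃ N, ∀ y, |g y| ≤ N) (c : ℝ) (x : Euc d) :
    Leps d κ J ε (fun y => f y + c * g y) x = Leps d κ J ε f x + c * Leps d κ J ε g x := by
  obtain ⟨M, hM⟩ := hM
  obtain ⟨N, hN⟩ := hN
  unfold Leps
  rw [← integral_const_mul, ← integral_add (integrableOn_Leps hJ hκ hε hf hM)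
    ((integrableOn_Leps hJ hκ hε hg hN).const_mul c)]
  congr 1
  ext z
  ring

theorem Leps_eq_secondDiff (hJ : LevyDensity d φ J K) (hκ : JumpCoeff d κ κ₀ κ₁ κ₂ δ)
    (hε : 0 < ε) (hf : Measurable f) (hM : ∀ y, |f y| ≤ M) (x : Euc d) :
    Leps d κ J ε f x
      = (1 / 2) * ∫ z in {z | ε < ‖z‖}, secondDiff f x z * (κ x z * J ‖z‖) := by
  have hpre : (fun z : Euc d => -z) ⁻¹' {z | ε < ‖z‖} = {z | ε < ‖z‖} := by
    ext z; simp
  have e : Leps d κ J ε f x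
      = ∫ z in {z | ε < ‖z‖}, (f (x - z) - f x) * (κ x z * J ‖z‖) := by
    have := (Measure.measurePreserving_neg (volume : Measure (Euc d))).setIntegral_preimage_emb
      (MeasurableEquiv.neg (Euc d)).measurableEmbedding
      (fun z => (f (x + z) - f x) * (κ x z * J ‖z‖)) {z | ε < ‖z‖}
    rw [hpre] at this
    rw [Leps, ← this]
    congr 1
    ext z
    rw [norm_neg, ← hκ.sym, sub_eq_add_neg x z]
  have h2 := integrableOn_jump (M := 2 * M) hJ hκ hε
    ((hf.comp (measurable_const.sub measurable_id)).sub measurable_const)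
    (F := fun z => f (x - z) - f x) (fun z => by
      have h1 := abs_le.1 (hM (x - z)); have h2 := abs_le.1 (hM x)
      rw [abs_le]; constructor <;> linarith) x
  have e2 : ∫ z in {z | ε < ‖z‖}, secondDiff f x z * (κ x z * J ‖z‖)
      = Leps d κ J ε f x + ∫ z in {z | ε < ‖z‖}, (f (x - z) - f x) * (κ x z * J ‖z‖) := by
    rw [Leps, ← integral_add (integrableOn_Leps hJ hκ hε hf hM) h2]
    congr 1
    ext z
    unfold secondDiff
    ring
  rw [e2, ← e]
  ring

/-- `f` has second differences bounded by `M` at all scales, and smooth at scales below `r`. -/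
def SecondDiffBound (f : Euc d → ℝ) (M r : ℝ) : Prop :=
  ∀ x z, |secondDiff f x z| ≤ M * min 1 (‖z‖ ^ 2 / r ^ 2)

theorem measurable_secondDiff (hf : Measurable f) (x : Euc d) : Measurable (secondDiff f x) :=
  ((hf.comp (measurable_const_add x)).add (hf.comp (measurable_const.sub measurable_id))).sub
    measurable_const

theorem norm_secondDiff_mul_le (hJ : LevyDensity d φ J K) (hκ : JumpCoeff d κ κ₀ κ₁ κ₂ δ)
    [Nonempty (Fin d)] (hf : SecondDiffBound f M r) (x : Euc d) :
    ∀ᵐ z, ‖secondDiff f x z * (κ x z * J ‖z‖)‖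
      ≤ κ₁ * M * (min 1 (‖z‖ ^ 2 / r ^ 2) * J ‖z‖) := by
  filter_upwards [hJ.nonneg_ae] with z hz
  rw [norm_mul, norm_mul, Real.norm_eq_abs, Real.norm_of_nonneg (hκ.nonneg x z),
    Real.norm_of_nonneg hz]
  have h1 := hκ.nonneg x z
  have h2 := hf x z
  have h3 : 0 ≤ M * min 1 (‖z‖ ^ 2 / r ^ 2) := (abs_nonneg _).trans h2
  calc |secondDiff f x z| * (κ x z * J ‖z‖) ≤ (M * min 1 (‖z‖ ^ 2 / r ^ 2)) * (κ₁ * J ‖z‖) := by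
        gcongr; exact hκ.up x z
    _ = _ := by ring

theorem integrable_secondDiff_mul (hJ : LevyDensity d φ J K) (hκ : JumpCoeff d κ κ₀ κ₁ κ₂ δ)
    [Nonempty (Fin d)] (hfm : Measurable f) (hr : 0 < r) (hr1 : r ≤ 1)
    (hf : SecondDiffBound f M r) (x : Euc d) :
    Integrable fun z => secondDiff f x z * (κ x z * J ‖z‖) :=
  Integrable.mono' ((hJ.integrable r hr hr1).const_mul _)
    ((measurable_secondDiff hfm x).mul ((hκ.measurable_right x).mul hJ.meas)).aestronglyMeasurable
    (norm_secondDiff_mul_le hJ hκ hf x)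

theorem SecondDiffBound.nonneg (hf : SecondDiffBound f M r) (hr : 0 < r) [Nonempty (Fin d)] :
    0 ≤ M := by
  obtain ⟨z, hz⟩ := exists_ne (0 : Euc d)
  have := (abs_nonneg _).trans (hf 0 z)
  have h : 0 < min 1 (‖z‖ ^ 2 / r ^ 2) := lt_min one_pos (by positivity)
  exact nonneg_of_mul_nonneg_left this h

theorem abs_Leps_le (hJ : LevyDensity d φ J K) (hκ : JumpCoeff d κ κ₀ κ₁ κ₂ δ)
    [Nonempty (Fin d)] (hfm : Measurable f) (hb : ∃ N, ∀ y, |f y| ≤ N) (hr : 0 < r) (hr1 : r ≤ 1)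
    (hf : SecondDiffBound f M r) (hε : 0 < ε) (x : Euc d) :
    |Leps d κ J ε f x| ≤ κ₁ * M * (K / φ r) := by
  obtain ⟨N, hN⟩ := hb
  have hM := hf.nonneg hr
  rw [Leps_eq_secondDiff hJ hκ hε hfm hN, abs_mul]
  have h0 : 0 ≤ ∫ z : Euc d, min 1 (‖z‖ ^ 2 / r ^ 2) * J ‖z‖ := integral_nonneg_of_ae (by
    filter_upwards [hJ.nonneg_ae] with z hz
    simp only [Pi.zero_apply]; positivity)
  have hκ1 := hκ.pos₁
  have h1 : |∫ z in {z | ε < ‖z‖}, secondDiff f x z * (κ x z * J ‖z‖)|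
      ≤ κ₁ * M * ∫ z : Euc d, min 1 (‖z‖ ^ 2 / r ^ 2) * J ‖z‖ := by
    rw [← integral_const_mul, ← Real.norm_eq_abs]
    refine (norm_integral_le_of_norm_le ((hJ.integrable r hr hr1).const_mul _).integrableOn
      (ae_restrict_of_ae (norm_secondDiff_mul_le hJ hκ hf x))).trans ?_
    refine setIntegral_le_integral ((hJ.integrable r hr hr1).const_mul _) ?_
    filter_upwards [hJ.nonneg_ae] with z hz
    simp only [Pi.zero_apply]; positivity
  have h2 : κ₁ * M * ∫ z : Euc d, min 1 (‖z‖ ^ 2 / r ^ 2) * J ‖z‖ ≤ κ₁ * M * (K / φ r) := by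
    gcongr; exact hJ.bound r hr hr1
  have h3 : |(1:ℝ) / 2| = 1 / 2 := abs_of_pos (by norm_num)
  rw [h3]
  have := abs_nonneg (∫ z in {z | ε < ‖z‖}, secondDiff f x z * (κ x z * J ‖z‖))
  linarith

theorem tendsto_Leps (hJ : LevyDensity d φ J K) (hκ : JumpCoeff d κ κ₀ κ₁ κ₂ δ)
    [Nonempty (Fin d)] (hfm : Measurable f) (hb : ∃ N, ∀ y, |f y| ≤ N) (hr : 0 < r) (hr1 : r ≤ 1)
    (hf : SecondDiffBound f M r) (x : Euc d) :
    Tendsto (fun ε => Leps d κ J ε f x) (nhdsWithin 0 (Ioi 0)) (nhds (jumpOp κ J f x)) := by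
  obtain ⟨N, hN⟩ := hb
  have hfi := integrable_secondDiff_mul hJ hκ hfm hr hr1 hf x
  have : Tendsto (fun ε => (1 / 2) * ∫ z, ({z : Euc d | ε < ‖z‖}).indicator
      (fun z => secondDiff f x z * (κ x z * J ‖z‖)) z) (nhdsWithin 0 (Ioi 0))
      (nhds (jumpOp κ J f x)) := by
    refine Tendsto.const_mul _ (tendsto_integral_filter_of_dominated_convergence
      (fun z => ‖secondDiff f x z * (κ x z * J ‖z‖)‖) ?_ ?_ hfi.norm ?_)
    · exact Eventually.of_forall fun ε => hfi.aestronglyMeasurable.indicator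
        (measurableSet_lt_norm ε)
    · exact Eventually.of_forall fun ε => Eventually.of_forall fun z => norm_indicator_le_norm_self _ _
    · have : ∀ᵐ z : Euc d, z ≠ 0 := by simp [ae_iff]
      filter_upwards [this] with z hz
      refine tendsto_const_nhds.congr' ?_
      have : ∀ᶠ ε in nhdsWithin (0:ℝ) (Ioi 0), ε < ‖z‖ :=
        nhdsWithin_le_nhds (gt_mem_nhds (norm_pos_iff.2 hz))
      filter_upwards [this] with ε hε
      rw [indicator_of_mem]
      exact hε
  refine this.congr' ?_
  filter_upwards [self_mem_nhdsWithin] with ε hε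
  rw [Leps_eq_secondDiff hJ hκ hε hfm hN, integral_indicator (measurableSet_lt_norm ε)]

theorem jumpOp_bound (hJ : LevyDensity d φ J K) (hκ : JumpCoeff d κ κ₀ κ₁ κ₂ δ)
    [Nonempty (Fin d)] (hfm : Measurable f) (hb : ∃ N, ∀ y, |f y| ≤ N) (hr : 0 < r) (hr1 : r ≤ 1)
    (hf : SecondDiffBound f M r) (x : Euc d) : |jumpOp κ J f x| ≤ κ₁ * M * (K / φ r) :=
  le_of_tendsto (tendsto_Leps hJ hκ hfm hb hr hr1 hf x).abs
    (eventually_nhdsWithin_of_forall fun _ hε => abs_Leps_le hJ hκ hfm hb hr hr1 hf hε x)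

theorem JumpCoeff.continuous_left (hκ : JumpCoeff d κ κ₀ κ₁ κ₂ δ) (z : Euc d) :
    Continuous fun x => κ x z := by
  rw [continuous_iff_continuousAt]
  intro x
  rw [ContinuousAt, tendsto_iff_dist_tendsto_zero]
  have h : Tendsto (fun y : Euc d => κ₂ * ‖y - x‖ ^ δ) (nhds x) (nhds 0) := by
    have : Continuous fun y : Euc d => κ₂ * ‖y - x‖ ^ δ :=
      continuous_const.mul ((continuous_id.sub continuous_const).norm.rpow_const
        fun _ => Or.inr hκ.pos_δ.le)
    simpa [Real.zero_rpow hκ.pos_δ.ne'] using this.tendsto x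
  exact squeeze_zero (fun _ => dist_nonneg) (fun y => by
    rw [Real.dist_eq]; exact hκ.holder y x z) h

instance : (cocompact (Euc d)).IsCountablyGenerated := by
  rw [← Metric.cobounded_eq_cocompact, ← comap_norm_atTop]
  infer_instance

theorem tendsto_comp_add_const_cocompact {F : Euc d → ℝ}
    (hF : Tendsto F (cocompact (Euc d)) (nhds 0)) (z : Euc d) :
    Tendsto (fun x => F (x + z)) (cocompact (Euc d)) (nhds 0) :=
  hF.comp (Homeomorph.addRight z).isClosedEmbedding.tendsto_cocompact

theorem continuous_jumpOp (hJ : LevyDensity d φ J K) (hκ : JumpCoeff d κ κ₀ κ₁ κ₂ δ)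
    [Nonempty (Fin d)] (hfc : Continuous f) (hr : 0 < r) (hr1 : r ≤ 1)
    (hf : SecondDiffBound f M r) : Continuous (jumpOp κ J f) := by
  refine continuous_const.mul (continuous_of_dominated (F := fun x z =>
    secondDiff f x z * (κ x z * J ‖z‖)) (fun x => ?_)
    (fun x => norm_secondDiff_mul_le hJ hκ hf x) ((hJ.integrable r hr hr1).const_mul _) ?_)
  · exact (integrable_secondDiff_mul hJ hκ hfc.measurable hr hr1 hf x).aestronglyMeasurable
  · refine Eventually.of_forall fun z => ?_
    have := hκ.continuous_left z
    unfold secondDiff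
    fun_prop

theorem tendsto_jumpOp_cocompact (hJ : LevyDensity d φ J K) (hκ : JumpCoeff d κ κ₀ κ₁ κ₂ δ)
    [Nonempty (Fin d)] (hfc : Continuous f) (hf0 : Tendsto f (cocompact (Euc d)) (nhds 0))
    (hr : 0 < r) (hr1 : r ≤ 1) (hf : SecondDiffBound f M r) :
    Tendsto (jumpOp κ J f) (cocompact (Euc d)) (nhds 0) := by
  rw [show (0:ℝ) = 1 / 2 * ∫ _ : Euc d, (0:ℝ) by simp]
  refine Tendsto.const_mul _ (tendsto_integral_filter_of_dominated_convergence
    (fun z => κ₁ * M * (min 1 (‖z‖ ^ 2 / r ^ 2) * J ‖z‖)) ?_ ?_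
    ((hJ.integrable r hr hr1).const_mul _) ?_)
  · exact Eventually.of_forall fun x =>
      (integrable_secondDiff_mul hJ hκ hfc.measurable hr hr1 hf x).aestronglyMeasurable
  · exact Eventually.of_forall fun x => norm_secondDiff_mul_le hJ hκ hf x
  · refine Eventually.of_forall fun z => ?_
    have h1 : Tendsto (fun x => secondDiff f x z) (cocompact (Euc d)) (nhds 0) := by
      have := ((tendsto_comp_add_const_cocompact hf0 z).add
        (tendsto_comp_add_const_cocompact hf0 (-z))).sub (hf0.const_mul 2)
      simpa [secondDiff, sub_eq_add_neg] using this
    refine (h1.zero_mul_isBoundedUnder_le ?_)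
    refine isBoundedUnder_of ⟨κ₁ * |J ‖z‖|, fun x => ?_⟩
    simp only [Function.comp, norm_mul, Real.norm_eq_abs]
    gcongr
    rw [abs_of_nonneg (hκ.nonneg x z)]
    exact hκ.up x z

end JumpOperator

section KernelBounds

/-- An integrable majorant for kernels on `d`-dimensional Euclidean space. -/
noncomputable def decay (d : ℕ) (z : Euc d) : ℝ := ((1 + ‖z‖) ^ (d + 2))⁻¹

theorem decay_pos {d : ℕ} (z : Euc d) : 0 < decay d z := by unfold decay; positivity

theorem integrable_decay (d : ℕ) : Integrable (decay d) := by
  have h := integrable_one_add_norm (E := Euc d) (μ := volume) (r := ((d + 2 : ℕ) : ℝ))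
    (by rw [finrank_euclideanSpace, Fintype.card_fin]; push_cast; linarith)
  refine h.congr (Eventually.of_forall fun z => ?_)
  simp only [decay]
  rw [Real.rpow_neg (by positivity), Real.rpow_natCast]

theorem le_mul_decay {d : ℕ} {A B q : ℝ} {z : Euc d} (hA : 0 ≤ A) (hB : 0 ≤ B)
    (h1 : ‖z‖ ≤ 1 → q ≤ A) (h2 : 1 ≤ ‖z‖ → q ≤ B / ‖z‖ ^ (d + 2)) :
    q ≤ 2 ^ (d + 2) * (A + B) * decay d z := by
  unfold decay
  rw [← div_eq_mul_inv, le_div_iff₀ (by positivity)]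
  rcases le_total ‖z‖ 1 with h | h
  · have hq := h1 h
    calc q * (1 + ‖z‖) ^ (d + 2) ≤ A * (1 + ‖z‖) ^ (d + 2) := by gcongr
      _ ≤ A * 2 ^ (d + 2) := by gcongr; linarith
      _ ≤ 2 ^ (d + 2) * (A + B) := by nlinarith [pow_pos (two_pos : (0:ℝ) < 2) (d + 2)]
  · have hz : 0 < ‖z‖ := one_pos.trans_le h
    have hq := h2 h
    calc q * (1 + ‖z‖) ^ (d + 2) ≤ B / ‖z‖ ^ (d + 2) * (1 + ‖z‖) ^ (d + 2) := by gcongr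
      _ ≤ B / ‖z‖ ^ (d + 2) * (2 * ‖z‖) ^ (d + 2) := by gcongr; linarith
      _ = B * 2 ^ (d + 2) := by rw [mul_pow]; field_simp
      _ ≤ 2 ^ (d + 2) * (A + B) := by nlinarith [pow_pos (two_pos : (0:ℝ) < 2) (d + 2)]

variable {d : ℕ} {φ J : ℝ → ℝ} {a₁ α₁ C₀ a b β κ₀ κ₁ κ₂ δ a₂ α₂ : ℝ}
  {κ : Euc d → Euc d → ℝ} {Φinv : ℝ → ℝ} {p : ℝ → Euc d → Euc d → ℝ}

theorem HKAssumptions.C₀_pos (H : HKAssumptions d φ J a₁ α₁ C₀ a b β κ κ₀ κ₁ κ₂ δ) : 0 < C₀ := by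
  rw [H.hC₀]
  refine lt_of_lt_of_le ?_ (integral_div_phi_lower H one_pos le_rfl)
  have := phi_pos H one_pos le_rfl
  positivity

theorem sq_le_Phi (H : HKAssumptions d φ J a₁ α₁ C₀ a b β κ κ₀ κ₁ κ₂ δ) {r : ℝ} (hr : 0 < r) :
    r ^ 2 / (2 * C₀) ≤ Phi φ r := by
  have hC := H.C₀_pos
  unfold Phi
  split_ifs with h
  · have hI : 0 < ∫ s in Ioo 0 r, s / φ s := by
      refine lt_of_lt_of_le ?_ (integral_div_phi_lower H hr h)
      have := phi_pos H hr h
      positivity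
    gcongr
    rw [H.hC₀]
    refine setIntegral_mono_set H.hI ?_ (Ioo_subset_Ioo_right h).eventuallyLE
    filter_upwards [ae_restrict_mem measurableSet_Ioo] with s hs
    have := phi_pos H hs.1 hs.2.le
    have := hs.1
    simp only [Pi.zero_apply]
    positivity
  · rw [← H.hC₀]
    apply le_of_eq
    ring

theorem inv_pow_mul_Phi_le (H : HKAssumptions d φ J a₁ α₁ C₀ a b β κ κ₀ κ₁ κ₂ δ) {r : ℝ}
    (hr : 0 < r) : 1 / (r ^ d * Phi φ r) ≤ 2 * C₀ / r ^ (d + 2) := by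
  have hC := H.C₀_pos
  have h := sq_le_Phi H hr
  calc 1 / (r ^ d * Phi φ r) ≤ 1 / (r ^ d * (r ^ 2 / (2 * C₀))) := by gcongr
    _ = _ := by rw [pow_add]; field_simp

theorem Gtil_le_pow (H : HKAssumptions d φ J a₁ α₁ C₀ a b β κ κ₀ κ₁ κ₂ δ) {t : ℝ} {z : Euc d}
    (hz : z ≠ 0) : Gtil d φ Φinv t z ≤ 2 * C₀ / ‖z‖ ^ (d + 2) := by
  rw [Gtil, if_neg hz]
  exact (min_le_right _ _).trans (inv_pow_mul_Phi_le H (norm_pos_iff.2 hz))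

theorem inv_mul_PhiInv_le (H : HKAssumptions d φ J a₁ α₁ C₀ a b β κ κ₀ κ₁ κ₂ δ)
    (HΦ : PhiInvSpec φ Φinv) {t₁ t : ℝ} (ht₁ : 0 < t₁) (h : t₁ ≤ t) :
    1 / (t * Φinv t ^ d) ≤ 1 / (t₁ * phiInvGen φ t₁ ^ d) := by
  have h1 := (phiInvGen_spec H ht₁).1
  have ht := ht₁.trans_le h
  have h2 := (phiInvGen_mono H ht₁ h).trans (phiInvGen_le_PhiInv H HΦ ht)
  gcongr

theorem Gtil_le_decay (H : HKAssumptions d φ J a₁ α₁ C₀ a b β κ κ₀ κ₁ κ₂ δ)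
    (HΦ : PhiInvSpec φ Φinv) {t₁ t : ℝ} (ht₁ : 0 < t₁) (h : t₁ ≤ t) (z : Euc d) :
    Gtil d φ Φinv t z
      ≤ 2 ^ (d + 2) * (1 / (t₁ * phiInvGen φ t₁ ^ d) + 2 * C₀) * decay d z := by
  have hC := H.C₀_pos
  have h1 := (phiInvGen_spec H ht₁).1
  refine le_mul_decay (by positivity) (by positivity) (fun _ => ?_) (fun hz => ?_)
  · refine le_trans ?_ (inv_mul_PhiInv_le H HΦ ht₁ h)
    unfold Gtil
    split_ifs
    exacts [le_rfl, min_le_left _ _]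
  · exact Gtil_le_pow H (fun h0 => by rw [h0, norm_zero] at hz; linarith)

/-- The time derivative of the kernel off the diagonal, with its bounds. -/
theorem exists_deriv_bounds
    (hp : GoodHeatKernel d φ J b β Φinv κ p) (T : ℝ) (hT : 1 ≤ T) :
    ∃ c, 0 < c ∧ ∀ t, 0 < t → t ≤ T → ∀ x y, x ≠ y →
      (∀ ε, 0 < ε → ε ≤ 1 →
        |Leps d κ J ε (fun x' => p t x' y) x| ≤ c * Gtil d φ Φinv t (x - y)) ∧
      ∃ L, Tendsto (fun ε => Leps d κ J ε (fun x' => p t x' y) x) (nhdsWithin 0 (Ioi 0)) (nhds L) ∧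
        HasDerivAt (fun s => p s x y) L t ∧ |L| ≤ c * Gtil d φ Φinv t (x - y) := by
  obtain ⟨c, hc, hfrac⟩ := hp.frac T hT
  refine ⟨c, hc, fun t ht htT x y hxy => ⟨fun ε h1 h2 => hfrac ε h1 h2 t ht htT x y hxy, ?_⟩⟩
  obtain ⟨L, hL, hd⟩ := hp.eqn t ht x y hxy
  refine ⟨L, hL, hd, le_of_tendsto hL.abs ?_⟩
  have : ∀ᶠ ε in nhdsWithin (0:ℝ) (Ioi 0), ε ∈ Ioc (0:ℝ) 1 := Ioc_mem_nhdsGT one_pos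
  filter_upwards [this] with ε hε
  exact hfrac ε hε.1 hε.2 t ht htT x y hxy

theorem continuous_kernel (hp : GoodHeatKernel d φ J b β Φinv κ p) {t : ℝ} (ht : 0 < t) :
    Continuous fun q : Euc d × Euc d => p t q.1 q.2 := by
  have := hp.cont.comp_continuous (f := fun q : Euc d × Euc d => (t, q)) (by fun_prop)
    (fun q => ⟨ht, mem_univ _⟩)
  exact this

theorem continuous_kernel_right (hp : GoodHeatKernel d φ J b β Φinv κ p) {t : ℝ} (ht : 0 < t)
    (x : Euc d) : Continuous (p t x) :=
  (continuous_kernel hp ht).comp (by fun_prop : Continuous fun y : Euc d => (x, y))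

theorem continuous_kernel_left (hp : GoodHeatKernel d φ J b β Φinv κ p) {t : ℝ} (ht : 0 < t)
    (y : Euc d) : Continuous fun x => p t x y :=
  (continuous_kernel hp ht).comp (by fun_prop : Continuous fun x : Euc d => (x, y))

theorem abs_kernel_sub_le (H : HKAssumptions d φ J a₁ α₁ C₀ a b β κ κ₀ κ₁ κ₂ δ)
    (hp : GoodHeatKernel d φ J b β Φinv κ p) (T : ℝ) (hT : 1 ≤ T) :
    ∃ c, 0 < c ∧ ∀ s t, 0 < s → s ≤ t → t ≤ T → ∀ x y, x ≠ y →
      |p t x y - p s x y| ≤ c * (t - s) / ‖x - y‖ ^ (d + 2) := by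
  obtain ⟨c, hc, hder⟩ := exists_deriv_bounds hp T hT
  have hC := H.C₀_pos
  refine ⟨c * (2 * C₀), by positivity, fun s t hs hst htT x y hxy => ?_⟩
  have hz : x - y ≠ 0 := sub_ne_zero.2 hxy
  choose! L hL using fun u (hu : u ∈ Icc s t) =>
    (hder u (hs.trans_le hu.1) (hu.2.trans htT) x y hxy).2
  have := (convex_Icc s t).norm_image_sub_le_of_norm_hasDerivWithin_le
    (f := fun u => p u x y) (f' := L) (C := c * (2 * C₀ / ‖x - y‖ ^ (d + 2)))
    (fun u hu => (hL u hu).2.1.hasDerivWithinAt)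
    (fun u hu => (hL u hu).2.2.trans (by gcongr; exact Gtil_le_pow H hz))
    (left_mem_Icc.2 hst) (right_mem_Icc.2 hst)
  rw [Real.norm_eq_abs, Real.norm_of_nonneg (sub_nonneg.2 hst)] at this
  refine this.trans (le_of_eq ?_)
  ring

/-- Off the diagonal, the kernel vanishes linearly as time tends to zero. -/
theorem exists_abs_kernel_le (H : HKAssumptions d φ J a₁ α₁ C₀ a b β κ κ₀ κ₁ κ₂ δ)
    (hp : GoodHeatKernel d φ J b β Φinv κ p) (T : ℝ) (hT : 1 ≤ T) :
    ∃ c, 0 < c ∧ ∀ t, 0 < t → t ≤ T → ∀ x y, x ≠ y →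
      |p t x y| ≤ c * t / ‖x - y‖ ^ (d + 2) := by
  obtain ⟨c, hc, hlip⟩ := abs_kernel_sub_le H hp T hT
  refine ⟨c, hc, fun t ht htT x y hxy => ?_⟩
  have key : ∀ σ : ℝ, |σ| = 1 → σ * p t x y ≤ c * t / ‖x - y‖ ^ (d + 2) := by
    intro σ hσ
    by_contra! hcon
    have hxy0 : 0 < ‖x - y‖ := norm_pos_iff.2 (sub_ne_zero.2 hxy)
    set m := (σ * p t x y - c * t / ‖x - y‖ ^ (d + 2)) / 3 with hm
    have hm0 : 0 < m := by rw [hm]; linarith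
    have hlip' : ∀ s u, 0 < s → s ≤ u → u ≤ T → ∀ y', x ≠ y' →
        σ * p u x y' - c * (u - s) / ‖x - y'‖ ^ (d + 2) ≤ σ * p s x y' := fun s u hs hsu hu y' hy' => by
      have h1 := hlip s u hs hsu hu x y' hy'
      have h2 : |σ * (p u x y' - p s x y')| ≤ c * (u - s) / ‖x - y'‖ ^ (d + 2) := by
        rw [abs_mul, hσ, one_mul]; exact h1
      have h3 := (abs_le.1 h2).2
      linarith
    set r := ‖x - y‖ / 2 with hr
    have hr0 : 0 < r := half_pos hxy0
    set s₁ := min t (m / (c / r ^ (d + 2))) with hs₁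
    have hs₁0 : 0 < s₁ := lt_min ht (by positivity)
    have hs₁t : s₁ ≤ t := min_le_left _ _
    have h3m : 3 * m ≤ σ * p s₁ x y := by
      have h1 := hlip' s₁ t hs₁0 hs₁t htT y hxy
      have h2 : c * (t - s₁) / ‖x - y‖ ^ (d + 2) ≤ c * t / ‖x - y‖ ^ (d + 2) := by
        gcongr; linarith
      rw [hm]; linarith
    have hcont : Continuous fun y' => σ * p s₁ x y' :=
      continuous_const.mul (continuous_kernel_right hp hs₁0 x)
    have hev : ∀ᶠ y' in nhds y, 2 * m < σ * p s₁ x y' :=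
      hcont.continuousAt.eventually (lt_mem_nhds (by linarith))
    obtain ⟨r₁, hr₁, hball⟩ := Metric.eventually_nhds_iff_ball.1 hev
    set R := min r₁ r with hR
    have hR0 : 0 < R := lt_min hr₁ hr0
    let f : ContDiffBump y := ⟨R / 2, R, half_pos hR0, half_lt_self hR0⟩
    have hfu : UniformContinuous (f : Euc d → ℝ) :=
      f.continuous.uniformContinuous_of_tendsto_cocompact
        (f.hasCompactSupport.is_zero_at_infty)
    have hfI : 0 < ∫ y', f y' := f.integral_pos
    obtain ⟨t₀, ht₀, happ⟩ := hp.approx f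
      ⟨1, fun z => by rw [abs_of_nonneg f.nonneg]; exact f.le_one⟩ hfu
      (m * (∫ y', f y') / 2) (by positivity)
    set s := min s₁ (t₀ / 2) with hs
    have hs0 : 0 < s := lt_min hs₁0 (half_pos ht₀)
    have hss : s ≤ s₁ := min_le_left _ _
    have h1 := happ s hs0 (lt_of_le_of_lt (min_le_right _ _) (half_lt_self ht₀)) x
    have hfx : f x = 0 := f.zero_of_le_dist (by
      rw [dist_eq_norm]
      calc R ≤ r := min_le_right _ _
        _ ≤ ‖x - y‖ := by rw [hr]; linarith)
    rw [hfx, sub_zero] at h1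
    have hsupp : ∀ y', f y' ≠ 0 → y' ∈ Metric.ball y R := fun y' hy' => by
      have : y' ∈ Function.support f := hy'
      rwa [f.support_eq] at this
    have hlow : ∀ y', m * f y' ≤ σ * (p s x y' * f y') := fun y' => by
      by_cases h0 : f y' = 0
      · simp [h0]
      · have hb := hsupp y' h0
        have hb1 := hball y' (Metric.ball_subset_ball (min_le_left _ _) hb)
        have hd : dist y' y < r := lt_of_lt_of_le hb (min_le_right _ _)
        have hxy' : r ≤ ‖x - y'‖ := by
          have h4 : ‖x - y‖ ≤ ‖x - y'‖ + ‖y' - y‖ := norm_sub_le_norm_sub_add_norm_sub _ _ _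
          rw [dist_eq_norm] at hd
          have : ‖x - y‖ = 2 * r := by rw [hr]; ring
          linarith
        have hne : x ≠ y' := fun h => by
          rw [h, sub_self, norm_zero] at hxy'; linarith
        have h5 := hlip' s s₁ hs0 hss (hs₁t.trans htT) y' hne
        have h6 : c * (s₁ - s) / ‖x - y'‖ ^ (d + 2) ≤ m := by
          calc c * (s₁ - s) / ‖x - y'‖ ^ (d + 2) ≤ c * s₁ / r ^ (d + 2) := by
                gcongr; linarith
            _ = s₁ * (c / r ^ (d + 2)) := by ring
            _ ≤ m / (c / r ^ (d + 2)) * (c / r ^ (d + 2)) := by gcongr; exact min_le_right _ _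
            _ = m := by field_simp
        rw [← mul_assoc]
        exact mul_le_mul_of_nonneg_right (by linarith) f.nonneg
    have hInt : Integrable fun y' => p s x y' * f y' :=
      ((continuous_kernel_right hp hs0 x).mul f.continuous).integrable_of_hasCompactSupport
        f.hasCompactSupport.mul_left
    have h2 : m * ∫ y', f y' ≤ σ * ∫ y', p s x y' * f y' := by
      rw [← integral_const_mul, ← integral_const_mul]
      exact integral_mono (f.integrable.const_mul m) (hInt.const_mul σ) hlow
    have h3 : σ * ∫ y', p s x y' * f y' ≤ |∫ y', p s x y' * f y'| := by
      calc _ ≤ |σ * ∫ y', p s x y' * f y'| := le_abs_self _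
        _ = _ := by rw [abs_mul, hσ, one_mul]
    nlinarith [mul_pos hm0 hfI]
  rw [abs_le]
  constructor
  · have := key (-1) (by simp)
    linarith
  · have := key 1 (by simp)
    linarith

end KernelBounds

section HeatOperator

variable {d : ℕ} {φ J : ℝ → ℝ} {a₁ α₁ C₀ a b β κ₀ κ₁ κ₂ δ K : ℝ}
  {κ : Euc d → Euc d → ℝ} {Φinv : ℝ → ℝ} {p : ℝ → Euc d → Euc d → ℝ} {f : Euc d → ℝ}

/-- The integral operator with kernel `p t`. -/
noncomputable def heatOp (p : ℝ → Euc d → Euc d → ℝ) (t : ℝ) (f : Euc d → ℝ) (x : Euc d) : ℝ :=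
  ∫ y, p t x y * f y

/-- Functions to which the operators `heatOp p t` can be applied. -/
structure HeatAdmissible (p : ℝ → Euc d → Euc d → ℝ) (f : Euc d → ℝ) : Prop where
  cont : Continuous f
  zero : Tendsto f (cocompact (Euc d)) (nhds 0)
  dom : ∀ t₁ T, 0 < t₁ → ∃ m : Euc d → ℝ, Integrable m ∧
    ∀ t ∈ Icc t₁ T, ∀ x z, |p t x (x + z) * f (x + z)| ≤ m z

theorem exists_bound_of_tendsto_zero (hf : Continuous f)
    (h0 : Tendsto f (cocompact (Euc d)) (nhds 0)) : ∃ M, 0 < M ∧ ∀ x, |f x| ≤ M := by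
  let F : ZeroAtInftyContinuousMap (Euc d) ℝ := ⟨⟨f, hf⟩, h0⟩
  refine ⟨‖F‖ + 1, by positivity, fun x => ?_⟩
  have : ‖F.toBCF x‖ ≤ ‖F.toBCF‖ := F.toBCF.norm_coe_le_norm x
  calc |f x| ≤ ‖F‖ := this
    _ ≤ _ := by linarith

theorem HeatAdmissible.bdd (hf : HeatAdmissible p f) : ∃ M, 0 < M ∧ ∀ x, |f x| ≤ M :=
  exists_bound_of_tendsto_zero hf.cont hf.zero

theorem exists_deriv_decay (H : HKAssumptions d φ J a₁ α₁ C₀ a b β κ κ₀ κ₁ κ₂ δ)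
    (HΦ : PhiInvSpec φ Φinv) (hp : GoodHeatKernel d φ J b β Φinv κ p) (T : ℝ) {t₁ : ℝ}
    (ht₁ : 0 < t₁) :
    ∃ C, 0 < C ∧ ∀ t ∈ Icc t₁ T, ∀ x y, x ≠ y →
      (∀ ε, 0 < ε → ε ≤ 1 →
        |Leps d κ J ε (fun x' => p t x' y) x| ≤ C * decay d (x - y)) ∧
      ∃ L, Tendsto (fun ε => Leps d κ J ε (fun x' => p t x' y) x) (nhdsWithin 0 (Ioi 0)) (nhds L) ∧
        HasDerivAt (fun s => p s x y) L t ∧ |L| ≤ C * decay d (x - y) := by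
  obtain ⟨c, hc, h⟩ := exists_deriv_bounds hp (max T 1) (le_max_right _ _)
  have hC := H.C₀_pos
  have h1 := (phiInvGen_spec H ht₁).1
  refine ⟨c * (2 ^ (d + 2) * (1 / (t₁ * phiInvGen φ t₁ ^ d) + 2 * C₀)), by positivity,
    fun t ht x y hxy => ?_⟩
  have hG := mul_le_mul_of_nonneg_left (Gtil_le_decay H HΦ ht₁ ht.1 (x - y)) hc.le
  rw [← mul_assoc] at hG
  obtain ⟨h2, L, hL, hd, hb⟩ := h t (ht₁.trans_le ht.1) (ht.2.trans (le_max_left _ _)) x y hxy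
  exact ⟨fun ε e0 e1 => (h2 ε e0 e1).trans hG, L, hL, hd, hb.trans hG⟩

theorem HeatAdmissible.integrable (hp : GoodHeatKernel d φ J b β Φinv κ p)
    (hf : HeatAdmissible p f) {t : ℝ} (ht : 0 < t) (x : Euc d) :
    Integrable fun y => p t x y * f y := by
  obtain ⟨m, hm, hle⟩ := hf.dom t t ht
  refine Integrable.mono' (hm.comp_sub_right x)
    ((continuous_kernel_right hp ht x).mul hf.cont).aestronglyMeasurable
    (Eventually.of_forall fun y => ?_)
  have := hle t ⟨le_rfl, le_rfl⟩ x (y - x)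
  rwa [add_sub_cancel] at this

theorem heatOp_eq_shift (t : ℝ) (x : Euc d) :
    heatOp p t f x = ∫ z, p t x (x + z) * f (x + z) :=
  (integral_add_left_eq_self (fun y => p t x y * f y) x).symm

theorem HeatAdmissible.continuous_heatOp (hp : GoodHeatKernel d φ J b β Φinv κ p)
    (hf : HeatAdmissible p f) {t : ℝ} (ht : 0 < t) : Continuous (heatOp p t f) := by
  obtain ⟨m, hm, hle⟩ := hf.dom t t ht
  have hk := continuous_kernel hp ht
  have hc := hf.cont
  rw [show heatOp p t f = fun x => ∫ z, p t x (x + z) * f (x + z) from funext (heatOp_eq_shift t)]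
  refine continuous_of_dominated (fun x => ?_)
    (fun x => Eventually.of_forall fun z => hle t ⟨le_rfl, le_rfl⟩ x z) hm
    (Eventually.of_forall fun z => ?_)
  · exact ((hk.comp (by fun_prop : Continuous fun z : Euc d => (x, x + z))).mul
      (hc.comp (by fun_prop))).aestronglyMeasurable
  · exact (hk.comp (by fun_prop : Continuous fun x : Euc d => (x, x + z))).mul
      (hc.comp (by fun_prop))

theorem HeatAdmissible.tendsto_heatOp (H : HKAssumptions d φ J a₁ α₁ C₀ a b β κ κ₀ κ₁ κ₂ δ)
    (hp : GoodHeatKernel d φ J b β Φinv κ p) [Nonempty (Fin d)]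
    (hf : HeatAdmissible p f) {t : ℝ} (ht : 0 < t) :
    Tendsto (heatOp p t f) (cocompact (Euc d)) (nhds 0) := by
  obtain ⟨m, hm, hle⟩ := hf.dom t t ht
  obtain ⟨c, hc, hker⟩ := exists_abs_kernel_le H hp (max t 1) (le_max_right _ _)
  have hk := continuous_kernel hp ht
  have hfc := hf.cont
  rw [show heatOp p t f = fun x => ∫ z, p t x (x + z) * f (x + z) from funext (heatOp_eq_shift t),
    show (0:ℝ) = ∫ _ : Euc d, (0:ℝ) by simp]
  refine tendsto_integral_filter_of_dominated_convergence m
    (Eventually.of_forall fun x => ?_)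
    (Eventually.of_forall fun x => Eventually.of_forall fun z => hle t ⟨le_rfl, le_rfl⟩ x z) hm ?_
  · exact ((hk.comp (by fun_prop : Continuous fun z : Euc d => (x, x + z))).mul
      (hfc.comp (by fun_prop))).aestronglyMeasurable
  · have : ∀ᵐ z : Euc d, z ≠ 0 := by simp [ae_iff]
    filter_upwards [this] with z hz
    have h1 := tendsto_comp_add_const_cocompact hf.zero z
    have h2 : Tendsto (fun x => f (x + z) * p t x (x + z)) (cocompact (Euc d)) (nhds 0) := by
      refine h1.zero_mul_isBoundedUnder_le
        (isBoundedUnder_of ⟨c * t / ‖z‖ ^ (d + 2), fun x => ?_⟩)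
      have := hker t ht (le_max_left _ _) x (x + z) (by simpa using hz)
      simpa using this
    simpa only [mul_comm] using h2

theorem HeatAdmissible.exists_lipschitz (H : HKAssumptions d φ J a₁ α₁ C₀ a b β κ κ₀ κ₁ κ₂ δ)
    (HΦ : PhiInvSpec φ Φinv) (hp : GoodHeatKernel d φ J b β Φinv κ p) [Nonempty (Fin d)]
    (hf : HeatAdmissible p f) (T : ℝ) {t₁ : ℝ} (ht₁ : 0 < t₁) :
    ∃ C, 0 ≤ C ∧ ∀ s ∈ Icc t₁ T, ∀ t ∈ Icc t₁ T, ∀ x,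
      |heatOp p s f x - heatOp p t f x| ≤ C * |s - t| := by
  obtain ⟨C, hC, hder⟩ := exists_deriv_decay H HΦ hp T ht₁
  obtain ⟨M, hM0, hM⟩ := hf.bdd
  refine ⟨C * M * ∫ z, decay d z, mul_nonneg (by positivity)
    (integral_nonneg fun z => (decay_pos z).le), fun s hs t ht x => ?_⟩
  have hi := (((integrable_decay d).comp_sub_left x).const_mul (C * M * |s - t|))
  unfold heatOp
  rw [← integral_sub (hf.integrable hp (ht₁.trans_le hs.1) x)
    (hf.integrable hp (ht₁.trans_le ht.1) x), ← Real.norm_eq_abs]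
  refine (norm_integral_le_of_norm_le hi ?_).trans (le_of_eq ?_)
  · have : ∀ᵐ y : Euc d, y ≠ x := by simp [ae_iff]
    filter_upwards [this] with y hy
    choose! L hL using fun u (hu : u ∈ Icc t₁ T) => (hder u hu x y hy.symm).2
    have := (convex_Icc t₁ T).norm_image_sub_le_of_norm_hasDerivWithin_le
      (f := fun u => p u x y) (f' := L) (C := C * decay d (x - y))
      (fun u hu => (hL u hu).2.1.hasDerivWithinAt) (fun u hu => (hL u hu).2.2) ht hs
    rw [← sub_mul, norm_mul]
    have hd := (decay_pos (x - y)).le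
    calc _ ≤ (C * decay d (x - y) * ‖s - t‖) * M := by
          gcongr; exact hM y
      _ = _ := by rw [Real.norm_eq_abs]; ring
  · rw [integral_const_mul, integral_sub_left_eq_self (decay d) volume x]
    ring

theorem HeatAdmissible.Leps_heatOp (hJ : LevyDensity d φ J K) (hκ : JumpCoeff d κ κ₀ κ₁ κ₂ δ)
    (hp : GoodHeatKernel d φ J b β Φinv κ p)
    (hf : HeatAdmissible p f) {t ε : ℝ} (ht : 0 < t) (hε : 0 < ε) (x : Euc d) :
    Integrable (fun y => Leps d κ J ε (fun x' => p t x' y) x * f y) ∧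
    Leps d κ J ε (heatOp p t f) x = ∫ y, Leps d κ J ε (fun x' => p t x' y) x * f y := by
  obtain ⟨m, hm, hle⟩ := hf.dom t t ht
  set S := {z : Euc d | ε < ‖z‖} with hS
  set F : Euc d × Euc d → ℝ :=
    fun q => (p t (x + q.1) q.2 * f q.2 - p t x q.2 * f q.2) * (κ x q.1 * J ‖q.1‖) with hF
  have hk := continuous_kernel hp ht
  have hfc := hf.cont
  have hmeas : Measurable F := by
    refine Measurable.mul (Continuous.measurable ?_)
      (((hκ.measurable_right x).comp measurable_fst).mul (hJ.meas.comp measurable_fst))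
    exact ((hk.comp (by fun_prop : Continuous fun q : Euc d × Euc d => (x + q.1, q.2))).mul
      (hfc.comp continuous_snd)).sub
      ((hk.comp (by fun_prop : Continuous fun q : Euc d × Euc d => (x, q.2))).mul
      (hfc.comp continuous_snd))
  have hInt : ∀ x', Integrable fun y => p t x' y * f y := fun x' => hf.integrable hp ht x'
  have hL1 : ∀ x', ∫ y, ‖p t x' y * f y‖ ≤ ∫ z, m z := fun x' => by
    rw [← integral_sub_right_eq_self m x']
    refine integral_mono (hInt x').norm (hm.comp_sub_right x') fun y => ?_
    have := hle t ⟨le_rfl, le_rfl⟩ x' (y - x')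
    rwa [add_sub_cancel] at this
  have hFi : Integrable F ((volume.restrict S).prod volume) := by
    rw [integrable_prod_iff hmeas.aestronglyMeasurable]
    constructor
    · exact Eventually.of_forall fun z =>
        ((hInt (x + z)).sub (hInt x)).mul_const (κ x z * J ‖z‖)
    · refine Integrable.mono' ((hJ.integrableOn hε).const_mul (2 * (∫ z, m z) * κ₁))
        hmeas.norm.stronglyMeasurable.integral_prod_right'.aestronglyMeasurable ?_
      filter_upwards [ae_restrict_mem (measurableSet_lt_norm ε)] with z hz
      have hJz := hJ.pos_J _ (hε.trans hz)
      have hκz := hκ.nonneg x z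
      rw [Real.norm_of_nonneg (integral_nonneg fun y => norm_nonneg _)]
      have e : ∀ y, ‖F (z, y)‖
          = ‖p t (x + z) y * f y - p t x y * f y‖ * (κ x z * J ‖z‖) := fun y => by
        simp only [hF]
        rw [norm_mul, Real.norm_of_nonneg (mul_nonneg hκz hJz.le)]
      simp only [e]
      rw [integral_mul_const]
      have h2 : ∫ y, ‖p t (x + z) y * f y - p t x y * f y‖ ≤ 2 * ∫ z, m z := by
        calc _ ≤ ∫ y, (‖p t (x + z) y * f y‖ + ‖p t x y * f y‖) :=
              integral_mono ((hInt _).sub (hInt _)).norm ((hInt _).norm.add (hInt _).norm)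
                fun y => norm_sub_le _ _
          _ = _ := integral_add (hInt _).norm (hInt _).norm
          _ ≤ _ := by have h1 := hL1 (x + z); have h2 := hL1 x; linarith
      have h0 : 0 ≤ ∫ y, ‖p t (x + z) y * f y - p t x y * f y‖ :=
        integral_nonneg fun y => norm_nonneg _
      rw [mul_assoc]
      gcongr
      · exact h0.trans h2
      · exact hκ.up x z
  have e1 : ∀ y, ∫ z in S, F (z, y) = Leps d κ J ε (fun x' => p t x' y) x * f y := fun y => by
    rw [Leps, ← integral_mul_const]
    congr 1
    ext z
    simp only [hF]
    ring
  refine ⟨?_, ?_⟩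
  · have := hFi.integral_prod_right
    simpa only [e1] using this
  · have e2 : Leps d κ J ε (heatOp p t f) x = ∫ z in S, ∫ y, F (z, y) := by
      rw [Leps]
      congr 1
      ext z
      simp only [hF, heatOp]
      rw [integral_mul_const, integral_sub (hInt _) (hInt _)]
    rw [e2, integral_integral_swap (f := fun z y => F (z, y)) hFi]
    simp only [e1]

theorem HeatAdmissible.exists_hasDerivAt (H : HKAssumptions d φ J a₁ α₁ C₀ a b β κ κ₀ κ₁ κ₂ δ)
    (HΦ : PhiInvSpec φ Φinv) (hp : GoodHeatKernel d φ J b β Φinv κ p)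
    (hJ : LevyDensity d φ J K) [Nonempty (Fin d)]
    (hf : HeatAdmissible p f) {t : ℝ} (ht : 0 < t) (x : Euc d) :
    ∃ L, HasDerivAt (fun s => heatOp p s f x) L t ∧
      Tendsto (fun ε => Leps d κ J ε (heatOp p t f) x) (nhdsWithin 0 (Ioi 0)) (nhds L) := by
  have ht2 : 0 < t / 2 := half_pos ht
  obtain ⟨C, hC, hder⟩ := exists_deriv_decay H HΦ hp (2 * t) ht2
  obtain ⟨M, hM0, hM⟩ := hf.bdd
  choose! L hL using fun u (hu : u ∈ Icc (t / 2) (2 * t)) y (hy : x ≠ y) => (hder u hu x y hy).2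
  have htm : t ∈ Icc (t / 2) (2 * t) := ⟨by linarith, by linarith⟩
  have hne : ∀ᵐ y : Euc d, x ≠ y := by
    have : ∀ᵐ y : Euc d, y ≠ x := by simp [ae_iff]
    filter_upwards [this] with y hy using hy.symm
  have hbi : Integrable fun y : Euc d => C * M * decay d (x - y) :=
    ((integrable_decay d).comp_sub_left x).const_mul (C * M)
  have hlim : Tendsto (fun ε => Leps d κ J ε (heatOp p t f) x) (nhdsWithin 0 (Ioi 0))
      (nhds (∫ y, L t y * f y)) := by
    have h1 : Tendsto (fun ε => ∫ y, Leps d κ J ε (fun x' => p t x' y) x * f y)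
        (nhdsWithin 0 (Ioi 0)) (nhds (∫ y, L t y * f y)) := by
      refine tendsto_integral_filter_of_dominated_convergence _ ?_ ?_ hbi ?_
      · filter_upwards [self_mem_nhdsWithin] with ε hε
        exact (hf.Leps_heatOp hJ H.jumpCoeff hp ht hε x).1.aestronglyMeasurable
      · have : ∀ᶠ ε in nhdsWithin (0:ℝ) (Ioi 0), ε ∈ Ioc (0:ℝ) 1 := Ioc_mem_nhdsGT one_pos
        filter_upwards [this] with ε hε
        filter_upwards [hne] with y hy
        rw [norm_mul]
        have := decay_pos (x - y)
        calc _ ≤ C * decay d (x - y) * M := by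
              gcongr
              exacts [(hder t htm x y hy).1 ε hε.1 hε.2, hM y]
          _ = _ := by ring
      · filter_upwards [hne] with y hy
        exact (hL t htm y hy).1.mul_const _
    refine h1.congr' ?_
    filter_upwards [self_mem_nhdsWithin] with ε hε
    exact (hf.Leps_heatOp hJ H.jumpCoeff hp ht hε x).2.symm
  have hmeasL : AEStronglyMeasurable (fun y => L t y * f y) volume := by
    refine aestronglyMeasurable_of_tendsto_ae (nhdsWithin (0:ℝ) (Ioi 0)) (f := fun ε y =>
      Leps d κ J (max ε (indicator (Iic 0) 1 ε)) (fun x' => p t x' y) x * f y) (fun ε => ?_) ?_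
    · refine (hf.Leps_heatOp hJ H.jumpCoeff hp ht ?_ x).1.aestronglyMeasurable
      by_cases hε : 0 < ε
      · exact lt_max_of_lt_left hε
      · exact lt_max_of_lt_right (by
          rw [indicator_of_mem (show ε ∈ Iic (0:ℝ) from not_lt.1 hε)]; exact one_pos)
    · filter_upwards [hne] with y hy
      refine ((hL t htm y hy).1.mul_const _).congr' ?_
      filter_upwards [self_mem_nhdsWithin] with ε hε
      rw [indicator_of_notMem (by simpa using hε), max_eq_left (le_of_lt hε)]
  refine ⟨_, ?_, hlim⟩
  have hnhds : Icc (t / 2) (2 * t) ∈ nhds t := Icc_mem_nhds (by linarith) (by linarith)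
  refine (hasDerivAt_integral_of_dominated_loc_of_deriv_le (F := fun s y => p s x y * f y)
    (F' := fun s y => L s y * f y) (bound := fun y => C * M * decay d (x - y)) hnhds ?_
    (hf.integrable hp ht x) hmeasL ?_ hbi ?_).2
  · filter_upwards [lt_mem_nhds ht] with s hs
    exact (hf.integrable hp hs x).aestronglyMeasurable
  · filter_upwards [hne] with y hy s hs
    rw [norm_mul]
    have := decay_pos (x - y)
    calc _ ≤ C * decay d (x - y) * M := by
          gcongr
          exacts [(hL s hs y hy).2.2, hM y]
      _ = _ := by ring
  · filter_upwards [hne] with y hy s hs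
    exact (hL s hs y hy).2.1.mul_const _

end HeatOperator

section HeatSolution

variable {d : ℕ} {φ J : ℝ → ℝ} {a₁ α₁ C₀ a b β κ₀ κ₁ κ₂ δ K T : ℝ}
  {κ : Euc d → Euc d → ℝ} {Φinv : ℝ → ℝ} {p : ℝ → Euc d → Euc d → ℝ} {f : Euc d → ℝ}
  {u v : ℝ → Euc d → ℝ}

/-- Solutions of the heat equation on `[0, T]` that vanish at infinity. -/
structure IsHeatSol (κ : Euc d → Euc d → ℝ) (J : ℝ → ℝ) (T : ℝ) (u : ℝ → Euc d → ℝ) : Prop where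
  cont : ∀ t ∈ Icc 0 T, Continuous (u t)
  zero : ∀ t ∈ Icc 0 T, Tendsto (u t) (cocompact (Euc d)) (nhds 0)
  time : ∀ t ∈ Icc 0 T, ∀ η : ℝ, 0 < η →
    ∀ᶠ s in nhdsWithin t (Icc 0 T), ∀ x, |u s x - u t x| ≤ η
  eqn : ∀ t ∈ Ioc 0 T, ∀ x, ∃ L, HasDerivAt (fun s => u s x) L t ∧
    Tendsto (fun ε => Leps d κ J ε (u t) x) (nhdsWithin 0 (Ioi 0)) (nhds L)

theorem IsHeatSol.bdd (hu : IsHeatSol κ J T u) {t : ℝ} (ht : t ∈ Icc 0 T) :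
    ∃ M, ∀ x, |u t x| ≤ M :=
  let ⟨M, _, h⟩ := exists_bound_of_tendsto_zero (hu.cont t ht) (hu.zero t ht); ⟨M, h⟩

theorem IsHeatSol.add_mul (hJ : LevyDensity d φ J K) (hκ : JumpCoeff d κ κ₀ κ₁ κ₂ δ)
    (hu : IsHeatSol κ J T u) (hv : IsHeatSol κ J T v) (c : ℝ) :
    IsHeatSol κ J T fun t x => u t x + c * v t x where
  cont t ht := (hu.cont t ht).add (continuous_const.mul (hv.cont t ht))
  zero t ht := by simpa using (hu.zero t ht).add ((hv.zero t ht).const_mul c)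
  time t ht η hη := by
    filter_upwards [hu.time t ht (η / 2) (half_pos hη),
      hv.time t ht (η / (2 * (|c| + 1))) (by positivity)] with s h1 h2 x
    have e : u s x + c * v s x - (u t x + c * v t x) = (u s x - u t x) + c * (v s x - v t x) := by
      ring
    rw [e]
    refine (abs_add_le _ _).trans ?_
    rw [abs_mul]
    have h3 : |c| * |v s x - v t x| ≤ (|c| + 1) * (η / (2 * (|c| + 1))) := by
      gcongr
      · linarith
      · exact h2 x
    have h4 : (|c| + 1) * (η / (2 * (|c| + 1))) = η / 2 := by field_simp
    linarith [h1 x]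
  eqn t ht x := by
    have ht' := Ioc_subset_Icc_self ht
    obtain ⟨L, h1, h2⟩ := hu.eqn t ht x
    obtain ⟨L', h3, h4⟩ := hv.eqn t ht x
    refine ⟨L + c * L', h1.add (h3.const_mul c), (h2.add (h4.const_mul c)).congr' ?_⟩
    filter_upwards [self_mem_nhdsWithin] with ε hε
    exact (Leps_add_mul hJ hκ hε (hu.cont t ht').measurable (hu.bdd ht')
      (hv.cont t ht').measurable (hv.bdd ht') c x).symm

theorem Leps_add_const (c : ℝ) (ε : ℝ) (f : Euc d → ℝ) (x : Euc d) :
    Leps d κ J ε (fun y => f y + c) x = Leps d κ J ε f x := by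
  simp [Leps]

theorem secondDiffBound_zero : SecondDiffBound (fun _ : Euc d => (0:ℝ)) 0 1 := by
  intro x z; simp [secondDiff]

theorem jumpOp_zero (x : Euc d) : jumpOp κ J (fun _ => 0) x = 0 := by
  simp [jumpOp, secondDiff]

/-- Comparison of a solution with an explicit subsolution. -/
theorem IsHeatSol.add_nonneg (hJ : LevyDensity d φ J K) (hκ : JumpCoeff d κ κ₀ κ₁ κ₂ δ)
    [Nonempty (Fin d)] (hu : IsHeatSol κ J T u) {v f : Euc d → ℝ} {c c' : ℝ → ℝ}
    {Mv rv Mf rf : ℝ}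
    (hvc : Continuous v) (hv0 : Tendsto v (cocompact (Euc d)) (nhds 0))
    (hrv : 0 < rv) (hrv1 : rv ≤ 1) (hvb : SecondDiffBound v Mv rv)
    (hfc : Continuous f) (hf0 : Tendsto f (cocompact (Euc d)) (nhds 0))
    (hrf : 0 < rf) (hrf1 : rf ≤ 1) (hfb : SecondDiffBound f Mf rf)
    (hcd : ∀ t, HasDerivAt c (c' t) t) (hc0 : ∀ t ∈ Icc 0 T, 0 ≤ c t)
    (h0 : ∀ x, 0 ≤ u 0 x + v x + c 0)
    (hsub : ∀ t ∈ Ioc 0 T, ∀ x, jumpOp κ J v x + t * jumpOp κ J f x < f x + c' t) :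
    ∀ t ∈ Icc 0 T, ∀ x, 0 ≤ u t x + (v x + t * f x) + c t := by
  obtain ⟨Nv, _, hNv⟩ := exists_bound_of_tendsto_zero hvc hv0
  obtain ⟨Nf, hNf0, hNf⟩ := exists_bound_of_tendsto_zero hfc hf0
  have hvfb : ∀ t : ℝ, ∃ N, ∀ y, |v y + t * f y| ≤ N := fun t => by
    refine ⟨Nv + |t| * Nf, fun y => (abs_add_le _ _).trans ?_⟩
    rw [abs_mul]
    gcongr
    exacts [hNv y, hNf y]
  refine nonneg_of_deriv_pos_at_min (w := fun t x => u t x + (v x + t * f x) + c t)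
    (fun t ht => ?_) (fun t ht η hη => ?_) (fun t ht η hη => ?_) (fun x => by simpa using h0 x)
    (fun t ht x hneg hmin => ?_)
  · exact ((hu.cont t ht).add (hvc.add (continuous_const.mul hfc))).add continuous_const
  · have h := (hu.zero t ht).add (hv0.add (hf0.const_mul t))
    simp only [mul_zero, add_zero] at h
    filter_upwards [h.eventually (lt_mem_nhds (neg_lt_zero.2 hη))] with x hx
    have := hc0 t ht
    linarith
  · have hcc : ∀ᶠ s in nhdsWithin t (Icc 0 T), |c s - c t| < η / 3 := by
      have := (hcd t).continuousAt.tendsto.mono_left (nhdsWithin_le_nhds (s := Icc 0 T))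
      have := Metric.tendsto_nhds.1 this (η / 3) (by positivity)
      simpa [Real.dist_eq] using this
    have hid : ∀ᶠ s in nhdsWithin t (Icc 0 T), |s - t| < η / (3 * Nf) := by
      have := (continuousAt_id (x := t)).tendsto.mono_left (nhdsWithin_le_nhds (s := Icc 0 T))
      have := Metric.tendsto_nhds.1 this (η / (3 * Nf)) (by positivity)
      simpa [Real.dist_eq] using this
    filter_upwards [hcc, hid, hu.time t ht (η / 3) (by positivity)] with s h1 h2 h3 x
    have e : u s x + (v x + s * f x) + c s - (u t x + (v x + t * f x) + c t)
        = (u s x - u t x) + (s - t) * f x + (c s - c t) := by ring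
    rw [e]
    have h4 : |(s - t) * f x| ≤ η / (3 * Nf) * Nf := by
      rw [abs_mul]; gcongr; exact hNf x
    have h5 : η / (3 * Nf) * Nf = η / 3 := by field_simp
    have := abs_add_three (u s x - u t x) ((s - t) * f x) (c s - c t)
    linarith [h3 x]
  · have ht' := Ioc_subset_Icc_self ht
    obtain ⟨L, h1, h2⟩ := hu.eqn t ht x
    have hD : HasDerivAt (fun s => u s x + (v x + s * f x) + c s) (L + f x + c' t) t := by
      have := (h1.fun_add (((hasDerivAt_id t).mul_const (f x)).const_add (v x))).fun_add (hcd t)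
      simpa using this
    refine ⟨_, ?_, hD⟩
    have hlim : Tendsto (fun ε => Leps d κ J ε (fun y => u t y + (v y + t * f y) + c t) x)
        (nhdsWithin 0 (Ioi 0)) (nhds (L + (jumpOp κ J v x + t * jumpOp κ J f x))) := by
      have h3 := tendsto_Leps hJ hκ hvc.measurable ⟨Nv, hNv⟩ hrv hrv1 hvb x
      have h4 := tendsto_Leps hJ hκ hfc.measurable ⟨Nf, hNf⟩ hrf hrf1 hfb x
      refine (h2.add (h3.add (h4.const_mul t))).congr' ?_
      filter_upwards [self_mem_nhdsWithin] with ε hε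
      rw [Leps_add_const, ← Leps_add_mul hJ hκ hε hvc.measurable ⟨Nv, hNv⟩ hfc.measurable
        ⟨Nf, hNf⟩ t x]
      have := Leps_add_mul (g := fun y => v y + t * f y) hJ hκ hε (hu.cont t ht').measurable (hu.bdd ht')
        (hvc.add (continuous_const.mul hfc)).measurable (hvfb t) 1 x
      simpa using this.symm
    have hL0 := ge_of_tendsto hlim
      (eventually_nhdsWithin_of_forall fun ε hε => Leps_nonneg_of_min hJ hκ hε hmin)
    linarith [hsub t ht x]

theorem IsHeatSol.neg (hJ : LevyDensity d φ J K) (hκ : JumpCoeff d κ κ₀ κ₁ κ₂ δ)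
    (hu : IsHeatSol κ J T u) : IsHeatSol κ J T fun t x => -u t x := by
  have := hu.add_mul hJ hκ hu (-2)
  have e : (fun t x => -u t x) = fun t x => u t x + -2 * u t x := by ext t x; ring
  rwa [e]

theorem IsHeatSol.le_of_le_zero (hJ : LevyDensity d φ J K) (hκ : JumpCoeff d κ κ₀ κ₁ κ₂ δ)
    [Nonempty (Fin d)] (hu : IsHeatSol κ J T u) {M : ℝ} (hM : 0 ≤ M) (h0 : ∀ x, -M ≤ u 0 x) :
    ∀ t ∈ Icc 0 T, ∀ x, -M ≤ u t x := by
  intro t ht x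
  refine le_of_forall_pos_le_add fun η hη => ?_
  have hη' : 0 < η / (t + 1) := div_pos hη (by linarith [ht.1])
  have := hu.add_nonneg hJ hκ (c := fun s => M + η / (t + 1) * s) (c' := fun _ => η / (t + 1))
    continuous_const tendsto_const_nhds one_pos le_rfl secondDiffBound_zero
    continuous_const tendsto_const_nhds one_pos le_rfl secondDiffBound_zero
    (fun s => by simpa using ((hasDerivAt_id s).const_mul (η / (t + 1))).const_add M)
    (fun s hs => by have := hs.1; positivity) (fun x => by simp; linarith [h0 x])
    (fun s hs x => by simpa [jumpOp_zero] using hη') t ht x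
  have h2 : η / (t + 1) * t ≤ η := by
    rw [div_mul_eq_mul_div, div_le_iff₀ (by linarith [ht.1])]
    nlinarith [ht.1]
  simp at this
  linarith

/-- The heat flow started from `f`. -/
noncomputable def evol (p : ℝ → Euc d → Euc d → ℝ) (f : Euc d → ℝ) (t : ℝ) : Euc d → ℝ :=
  if t ≤ 0 then f else heatOp p t f

theorem evol_zero : evol p f 0 = f := if_pos le_rfl

theorem evol_of_pos {t : ℝ} (ht : 0 < t) : evol p f t = heatOp p t f := if_neg (not_le.2 ht)

theorem HeatAdmissible.isHeatSol_shift (H : HKAssumptions d φ J a₁ α₁ C₀ a b β κ κ₀ κ₁ κ₂ δ)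
    (HΦ : PhiInvSpec φ Φinv) (hp : GoodHeatKernel d φ J b β Φinv κ p)
    (hJ : LevyDensity d φ J K) [Nonempty (Fin d)] (hf : HeatAdmissible p f) {s : ℝ} (hs : 0 < s)
    (T : ℝ) : IsHeatSol κ J T fun t => heatOp p (s + t) f where
  cont t ht := hf.continuous_heatOp hp (by linarith [ht.1])
  zero t ht := hf.tendsto_heatOp H hp (by linarith [ht.1])
  time t ht η hη := by
    obtain ⟨C, hC, hlip⟩ := hf.exists_lipschitz H HΦ hp (s + T) hs
    have h1 : ∀ᶠ r in nhdsWithin t (Icc 0 T), |r - t| < η / (C + 1) := by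
      have := (continuousAt_id (x := t)).tendsto.mono_left (nhdsWithin_le_nhds (s := Icc 0 T))
      have := Metric.tendsto_nhds.1 this (η / (C + 1)) (by positivity)
      simpa [Real.dist_eq] using this
    filter_upwards [h1, self_mem_nhdsWithin] with r h2 hr x
    refine (hlip (s + r) ⟨by linarith [hr.1], by linarith [hr.2]⟩ (s + t)
      ⟨by linarith [ht.1], by linarith [ht.2]⟩ x).trans ?_
    rw [add_sub_add_left_eq_sub]
    rw [lt_div_iff₀ (by positivity)] at h2
    nlinarith [abs_nonneg (r - t)]
  eqn t ht x := by
    obtain ⟨L, h1, h2⟩ := hf.exists_hasDerivAt H HΦ hp hJ (t := s + t) (by linarith [ht.1]) x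
    exact ⟨L, h1.comp_const_add s t, h2⟩

theorem HeatAdmissible.isHeatSol (H : HKAssumptions d φ J a₁ α₁ C₀ a b β κ κ₀ κ₁ κ₂ δ)
    (HΦ : PhiInvSpec φ Φinv) (hp : GoodHeatKernel d φ J b β Φinv κ p)
    (hJ : LevyDensity d φ J K) [Nonempty (Fin d)] (hf : HeatAdmissible p f) (T : ℝ) :
    IsHeatSol κ J T (evol p f) where
  cont t ht := by
    rcases ht.1.eq_or_lt with h | h
    · rw [← h, evol_zero]; exact hf.cont
    · rw [evol_of_pos h]; exact hf.continuous_heatOp hp h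
  zero t ht := by
    rcases ht.1.eq_or_lt with h | h
    · rw [← h, evol_zero]; exact hf.zero
    · rw [evol_of_pos h]; exact hf.tendsto_heatOp H hp h
  time t ht η hη := by
    rcases ht.1.eq_or_lt with h | h
    · subst h
      obtain ⟨M, _, hM⟩ := hf.bdd
      obtain ⟨t₀, ht₀, happ⟩ := hp.approx f ⟨M, hM⟩
        (hf.cont.uniformContinuous_of_tendsto_cocompact hf.zero) η hη
      have h1 : ∀ᶠ r in nhdsWithin 0 (Icc 0 T), r < t₀ := nhdsWithin_le_nhds (gt_mem_nhds ht₀)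
      filter_upwards [h1, self_mem_nhdsWithin] with r h2 hr x
      rw [evol_zero]
      rcases hr.1.eq_or_lt with h | h
      · rw [← h, evol_zero]; simpa using hη.le
      · rw [evol_of_pos h]; exact happ r h h2 x
    · obtain ⟨C, hC, hlip⟩ := hf.exists_lipschitz H HΦ hp T (half_pos h)
      have h1 : ∀ᶠ r in nhdsWithin t (Icc 0 T), |r - t| < η / (C + 1) := by
        have := (continuousAt_id (x := t)).tendsto.mono_left (nhdsWithin_le_nhds (s := Icc 0 T))
        have := Metric.tendsto_nhds.1 this (η / (C + 1)) (by positivity)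
        simpa [Real.dist_eq] using this
      have h3 : ∀ᶠ r in nhdsWithin t (Icc 0 T), t / 2 < r :=
        nhdsWithin_le_nhds (lt_mem_nhds (half_lt_self h))
      filter_upwards [h1, h3, self_mem_nhdsWithin] with r h2 h4 hr x
      rw [evol_of_pos h, evol_of_pos (by linarith)]
      refine (hlip r ⟨by linarith, hr.2⟩ t ⟨by linarith, ht.2⟩ x).trans ?_
      rw [lt_div_iff₀ (by positivity)] at h2
      nlinarith [abs_nonneg (r - t)]
  eqn t ht x := by
    obtain ⟨L, h1, h2⟩ := hf.exists_hasDerivAt H HΦ hp hJ ht.1 x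
    refine ⟨L, h1.congr_of_eventuallyEq ?_, by rwa [evol_of_pos ht.1]⟩
    filter_upwards [lt_mem_nhds ht.1] with s hs
    rw [evol_of_pos hs]

end HeatSolution

section Semigroup

set_option linter.unusedSectionVars false

/-- The standing assumptions together with the heat kernel. -/
structure HeatSetup (d : ℕ) (φ J : ℝ → ℝ) (a₁ α₁ C₀ a b β : ℝ) (κ : Euc d → Euc d → ℝ)
    (κ₀ κ₁ κ₂ δ : ℝ) (Φinv : ℝ → ℝ) (p : ℝ → Euc d → Euc d → ℝ) (K a₂ α₂ : ℝ) : Prop where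
  hyp : HKAssumptions d φ J a₁ α₁ C₀ a b β κ κ₀ κ₁ κ₂ δ
  inv : PhiInvSpec φ Φinv
  ker : GoodHeatKernel d φ J b β Φinv κ p
  levy : LevyDensity d φ J K
  a₂_pos : 0 < a₂
  α₂_pos : 0 < α₂
  α₂_lt : α₂ < 2
  scal : ∀ r R : ℝ, 0 < r → r ≤ R → R ≤ 1 → φ R / φ r ≤ a₂ * (R / r) ^ α₂

variable {d : ℕ} {φ J : ℝ → ℝ} {a₁ α₁ C₀ a b β κ₀ κ₁ κ₂ δ K a₂ α₂ T : ℝ}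
  {κ : Euc d → Euc d → ℝ} {Φinv : ℝ → ℝ} {p : ℝ → Euc d → Euc d → ℝ} {f : Euc d → ℝ}
  [Nonempty (Fin d)]

theorem nonneg_of_integral_mul_nonneg {D : Euc d → ℝ} (hD : Continuous D)
    (h : ∀ f : Euc d → ℝ, Continuous f → HasCompactSupport f → (∀ y, 0 ≤ f y) →
      0 ≤ ∫ y, D y * f y) (y : Euc d) : 0 ≤ D y := by
  by_contra! hy
  obtain ⟨r, hr, hball⟩ := Metric.isOpen_iff.1 (isOpen_lt hD continuous_const) y hy
  let χ : ContDiffBump y := ⟨r / 2, r, half_pos hr, half_lt_self hr⟩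
  have hpos : 0 < ∫ x, -D x * χ x := by
    refine Continuous.integral_pos_of_hasCompactSupport_nonneg_nonzero (x := y)
      (hD.neg.mul χ.continuous) (χ.hasCompactSupport.mul_left) (fun x => ?_) ?_
    · by_cases hx : x ∈ Metric.ball y r
      · exact mul_nonneg (neg_nonneg.2 (le_of_lt (hball hx))) χ.nonneg
      · have : χ x = 0 := χ.zero_of_le_dist (by simpa using hx)
        simp [this]
    · rw [χ.one_of_mem_closedBall (Metric.mem_closedBall_self χ.rIn_pos.le)]
      simpa using hy.ne
  have := h χ χ.continuous χ.hasCompactSupport (fun x => χ.nonneg)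
  simp only [neg_mul, integral_neg] at hpos
  linarith

theorem eq_of_integral_mul_eq {D D' : Euc d → ℝ} (hD : Continuous D) (hD' : Continuous D')
    (h : ∀ f : Euc d → ℝ, Continuous f → HasCompactSupport f →
      ∫ y, D y * f y = ∫ y, D' y * f y) : D = D' := by
  have key : ∀ {A B : Euc d → ℝ}, Continuous A → Continuous B →
      (∀ f : Euc d → ℝ, Continuous f → HasCompactSupport f →
      ∫ y, A y * f y = ∫ y, B y * f y) → ∀ y, A y ≤ B y := fun {A B} hA hB hAB y => by
    refine sub_nonneg.1 (nonneg_of_integral_mul_nonneg (hB.sub hA) (fun f hf hf' _ => ?_) y)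
    simp only [Pi.sub_apply, sub_mul]
    rw [integral_sub (f := fun y => B y * f y) (g := fun y => A y * f y) ((hB.mul hf).integrable_of_hasCompactSupport hf'.mul_left)
      ((hA.mul hf).integrable_of_hasCompactSupport hf'.mul_left), hAB f hf hf', sub_self]
  exact funext fun y => le_antisymm (key hD hD' h y) (key hD' hD (fun f h1 h2 => (h f h1 h2).symm) y)

theorem HeatSetup.admissible_of_hasCompactSupport
    (S : HeatSetup d φ J a₁ α₁ C₀ a b β κ κ₀ κ₁ κ₂ δ Φinv p K a₂ α₂)
    (hf : Continuous f) (hc : HasCompactSupport f) : HeatAdmissible p f where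
  cont := hf
  zero := hc.is_zero_at_infty
  dom t₁ T ht₁ := by
    obtain ⟨M, hM0, hM⟩ := exists_bound_of_tendsto_zero hf hc.is_zero_at_infty
    obtain ⟨c, hc0, hker⟩ := exists_abs_kernel_le S.hyp S.ker (max T 1) (le_max_right _ _)
    have hcomp : IsCompact (Icc t₁ T ×ˢ (Metric.cthickening 1 (tsupport f) ×ˢ tsupport f)) :=
      isCompact_Icc.prod ((hc.isCompact.cthickening).prod hc.isCompact)
    obtain ⟨A, hA⟩ := hcomp.exists_bound_of_continuousOn
      (S.ker.cont.mono (fun q hq => ⟨ht₁.trans_le hq.1.1, mem_univ _⟩))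
    refine ⟨fun z => 2 ^ (d + 2) * (|A| * M + c * max T 1 * M) * decay d z,
      (integrable_decay d).const_mul _, fun t ht x z => le_mul_decay (by positivity)
        (by positivity) (fun hz => ?_) (fun hz => ?_)⟩
    · by_cases hx : x + z ∈ tsupport f
      · rw [abs_mul]
        refine mul_le_mul ((hA (t, x, x + z) ⟨ht, ?_, hx⟩).trans (le_abs_self _)) (hM _)
          (abs_nonneg _) (abs_nonneg _)
        exact Metric.mem_cthickening_of_dist_le x (x + z) 1 _ hx (by simpa using hz)
      · rw [image_eq_zero_of_notMem_tsupport hx]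
        simp; positivity
    · have hz0 : z ≠ 0 := by rintro rfl; simp at hz; linarith
      have h := hker t (ht₁.trans_le ht.1) (ht.2.trans (le_max_left _ _)) x (x + z)
        (by simpa using hz0)
      simp only [sub_add_cancel_left, norm_neg] at h
      have hn : 0 < ‖z‖ := by linarith
      have ht0 := ht₁.trans_le ht.1
      rw [abs_mul]
      calc _ ≤ (c * t / ‖z‖ ^ (d + 2)) * M := by gcongr; exact hM _
        _ ≤ (c * max T 1 / ‖z‖ ^ (d + 2)) * M := by
          gcongr; exact ht.2.trans (le_max_left _ _)
        _ = _ := by ring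

theorem HeatSetup.kernel_nonneg
    (S : HeatSetup d φ J a₁ α₁ C₀ a b β κ κ₀ κ₁ κ₂ δ Φinv p K a₂ α₂)
    {t : ℝ} (ht : 0 < t) (x y : Euc d) : 0 ≤ p t x y := by
  refine nonneg_of_integral_mul_nonneg (continuous_kernel_right S.ker ht x)
    (fun f hf hf' h0 => ?_) y
  have := ((S.admissible_of_hasCompactSupport hf hf').isHeatSol S.hyp S.inv S.ker S.levy
    t).le_of_le_zero S.levy S.hyp.jumpCoeff le_rfl (by simpa [evol_zero] using h0) t
    ⟨ht.le, le_rfl⟩ x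
  rw [evol_of_pos ht] at this
  simpa [heatOp] using this

theorem HeatSetup.exists_kernel_le
    (S : HeatSetup d φ J a₁ α₁ C₀ a b β κ κ₀ κ₁ κ₂ δ Φinv p K a₂ α₂)
    (T : ℝ) (hT : 1 ≤ T) : ∃ c, 1 ≤ c ∧ ∀ t, 0 < t → t ≤ T → ∀ x y,
      p t x y ≤ c / phiInvGen φ t ^ d ∧
      (x ≠ y → ‖x - y‖ ≤ 1 → p t x y ≤ c * t / (‖x - y‖ ^ d * φ ‖x - y‖)) ∧
      (1 < ‖x - y‖ → p t x y ≤ c * t * theta d φ b β ‖x - y‖) := by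
  obtain ⟨c, hc, h⟩ := S.ker.upper T hT
  have h2 := S.α₂_lt
  have ha := S.a₂_pos
  set D := 2 * a₂ / (2 - α₂) with hD
  have hD0 : 0 < D := div_pos (by positivity) (by linarith)
  refine ⟨max (max c (c * D)) 1, le_max_right _ _, fun t ht htT x y => ?_⟩
  have hψ := phiInvGen_spec S.hyp ht
  have hle : phiInvGen φ t ≤ Φinv t := phiInvGen_le_PhiInv S.hyp S.inv ht
  have hΦ : 0 < Φinv t := S.inv.pos t ht
  have hu := h t ht htT x y
  have hc1 : c ≤ max (max c (c * D)) 1 := (le_max_left _ _).trans (le_max_left _ _)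
  have hc2 : c * D ≤ max (max c (c * D)) 1 := (le_max_right _ _).trans (le_max_left _ _)
  refine ⟨?_, fun hxy h1 => ?_, fun h1 => ?_⟩
  · refine hu.trans ?_
    have hG : Gfun d φ b β Φinv t (x - y) ≤ 1 / (t * Φinv t ^ d) := by
      unfold Gfun; split_ifs
      · exact le_rfl
      · exact min_le_left _ _
    calc c * t * Gfun d φ b β Φinv t (x - y) ≤ c * t * (1 / (t * Φinv t ^ d)) := by gcongr
      _ = c / Φinv t ^ d := by field_simp
      _ ≤ _ := by
        have := hψ.1
        gcongr
  · have hz : x - y ≠ 0 := sub_ne_zero.2 hxy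
    have hn : 0 < ‖x - y‖ := norm_pos_iff.2 hz
    have hP := Phi_pos S.hyp hn
    have hφ := phi_pos S.hyp hn h1
    rw [Gfun, if_neg hz] at hu
    have hG : theta d φ b β ‖x - y‖ ≤ D / (‖x - y‖ ^ d * φ ‖x - y‖) := by
      rw [theta, if_pos h1, div_le_div_iff₀ (by positivity) (by positivity)]
      have := phi_le_Phi S.hyp S.α₂_lt S.scal hn h1
      rw [← hD] at this
      have hp : 0 < ‖x - y‖ ^ d := by positivity
      nlinarith
    calc p t x y ≤ c * t * (D / (‖x - y‖ ^ d * φ ‖x - y‖)) :=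
          hu.trans (by gcongr; exact (min_le_right _ _).trans hG)
      _ = c * D * t / (‖x - y‖ ^ d * φ ‖x - y‖) := by ring
      _ ≤ _ := by gcongr
  · have hz : x - y ≠ 0 := fun h => by rw [h] at h1; simp at h1; linarith
    rw [Gfun, if_neg hz] at hu
    have hth : 0 < theta d φ b β ‖x - y‖ := by
      rw [theta, if_neg (not_le.2 h1)]
      split_ifs
      · positivity
      · have : 0 < ‖x - y‖ := by linarith
        positivity
    calc p t x y ≤ c * t * theta d φ b β ‖x - y‖ :=
          hu.trans (by gcongr; exact min_le_right _ _)
      _ ≤ _ := by gcongr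

theorem HeatSetup.exists_kernel_le_decay
    (S : HeatSetup d φ J a₁ α₁ C₀ a b β κ κ₀ κ₁ κ₂ δ Φinv p K a₂ α₂)
    (T : ℝ) {t₁ : ℝ} (ht₁ : 0 < t₁) : ∃ c, 0 < c ∧ ∀ t ∈ Icc t₁ T, ∀ x y,
      p t x y ≤ c * decay d (y - x) := by
  obtain ⟨c, hc, hker⟩ := exists_abs_kernel_le S.hyp S.ker (max T 1) (le_max_right _ _)
  obtain ⟨c', hc', h'⟩ := S.exists_kernel_le (max T 1) (le_max_right _ _)
  have hψ := (phiInvGen_spec S.hyp ht₁).1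
  refine ⟨2 ^ (d + 2) * (c' / phiInvGen φ t₁ ^ d + c * max T 1), by positivity,
    fun t ht x y => le_mul_decay (by positivity) (by positivity) (fun _ => ?_) (fun hz => ?_)⟩
  · have ht0 := ht₁.trans_le ht.1
    refine (h' t ht0 (ht.2.trans (le_max_left _ _)) x y).1.trans ?_
    have := phiInvGen_mono S.hyp ht₁ ht.1
    gcongr
  · have hz0 : x ≠ y := by rintro rfl; simp at hz; linarith
    have ht0 := ht₁.trans_le ht.1
    refine (le_abs_self _).trans ((hker t ht0 (ht.2.trans (le_max_left _ _)) x y hz0).trans ?_)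
    rw [norm_sub_rev]
    gcongr
    exact ht.2.trans (le_max_left _ _)

theorem HeatSetup.admissible
    (S : HeatSetup d φ J a₁ α₁ C₀ a b β κ κ₀ κ₁ κ₂ δ Φinv p K a₂ α₂)
    (hf : Continuous f) (h0 : Tendsto f (cocompact (Euc d)) (nhds 0)) : HeatAdmissible p f where
  cont := hf
  zero := h0
  dom t₁ T ht₁ := by
    obtain ⟨M, hM0, hM⟩ := exists_bound_of_tendsto_zero hf h0
    obtain ⟨c, hc, h⟩ := S.exists_kernel_le_decay T ht₁
    refine ⟨fun z => c * decay d z * M, ((integrable_decay d).const_mul c).mul_const M,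
      fun t ht x z => ?_⟩
    have := h t ht x (x + z)
    rw [add_sub_cancel_left] at this
    rw [abs_mul, abs_of_nonneg (S.kernel_nonneg (ht₁.trans_le ht.1) _ _)]
    have := decay_pos z
    exact mul_le_mul (by assumption) (hM _) (abs_nonneg _) (by positivity)

theorem HeatSetup.kernel_tendsto_left
    (S : HeatSetup d φ J a₁ α₁ C₀ a b β κ κ₀ κ₁ κ₂ δ Φinv p K a₂ α₂) {t : ℝ} (ht : 0 < t)
    (y : Euc d) : Tendsto (fun x => p t x y) (cocompact (Euc d)) (nhds 0) := by
  obtain ⟨c, hc, hker⟩ := exists_abs_kernel_le S.hyp S.ker (max t 1) (le_max_right _ _)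
  have h1 : Tendsto (fun x : Euc d => ‖x - y‖) (cocompact (Euc d)) atTop := by
    have := tendsto_norm_cocompact_atTop (E := Euc d)
    exact this.comp (Homeomorph.subRight y).isClosedEmbedding.tendsto_cocompact
  have h2 : Tendsto (fun x : Euc d => c * t / ‖x - y‖ ^ (d + 2)) (cocompact (Euc d)) (nhds 0) :=
    ((tendsto_pow_atTop (by omega)).comp h1).const_div_atTop _
  refine squeeze_zero_norm' ?_ h2
  filter_upwards [h1.eventually (eventually_gt_atTop 0)] with x hx
  exact hker t ht (le_max_left _ _) x y (sub_ne_zero.1 (norm_pos_iff.1 hx))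

theorem HeatSetup.heatOp_nonneg
    (S : HeatSetup d φ J a₁ α₁ C₀ a b β κ κ₀ κ₁ κ₂ δ Φinv p K a₂ α₂) {t : ℝ} (ht : 0 < t)
    (hf : ∀ y, 0 ≤ f y) (x : Euc d) : 0 ≤ heatOp p t f x :=
  integral_nonneg fun y => mul_nonneg (S.kernel_nonneg ht x y) (hf y)

theorem HeatSetup.abs_heatOp_le
    (S : HeatSetup d φ J a₁ α₁ C₀ a b β κ κ₀ κ₁ κ₂ δ Φinv p K a₂ α₂) {t : ℝ} (ht : 0 < t)
    (hf : Continuous f) (h0 : Tendsto f (cocompact (Euc d)) (nhds 0)) {M : ℝ}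
    (hM : ∀ y, |f y| ≤ M) (x : Euc d) : |heatOp p t f x| ≤ M := by
  have hsol := (S.admissible hf h0).isHeatSol S.hyp S.inv S.ker S.levy t
  have hM0 : 0 ≤ M := (abs_nonneg _).trans (hM 0)
  have h1 := hsol.le_of_le_zero S.levy S.hyp.jumpCoeff hM0
    (fun y => by rw [evol_zero]; exact (abs_le.1 (hM y)).1) t ⟨ht.le, le_rfl⟩ x
  have h2 := (hsol.neg S.levy S.hyp.jumpCoeff).le_of_le_zero S.levy S.hyp.jumpCoeff hM0
    (fun y => by rw [evol_zero]; linarith [(abs_le.1 (hM y)).2]) t ⟨ht.le, le_rfl⟩ x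
  rw [evol_of_pos ht] at h1 h2
  exact abs_le.2 ⟨h1, by linarith⟩

theorem HeatSetup.heatOp_add
    (S : HeatSetup d φ J a₁ α₁ C₀ a b β κ κ₀ κ₁ κ₂ δ Φinv p K a₂ α₂) {s t : ℝ} (hs : 0 < s)
    (ht : 0 < t) (hf : Continuous f) (h0 : Tendsto f (cocompact (Euc d)) (nhds 0)) :
    heatOp p (s + t) f = heatOp p t (heatOp p s f) := by
  have hA := S.admissible hf h0
  have hA' := S.admissible (hA.continuous_heatOp S.ker hs) (hA.tendsto_heatOp S.hyp S.ker hs)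
  have h1 := hA.isHeatSol_shift S.hyp S.inv S.ker S.levy hs t
  have h2 := hA'.isHeatSol S.hyp S.inv S.ker S.levy t
  have e1 := (h1.add_mul S.levy S.hyp.jumpCoeff h2 (-1)).le_of_le_zero S.levy S.hyp.jumpCoeff le_rfl
    (by intro x; simp [evol_zero]) t ⟨ht.le, le_rfl⟩
  have e2 := (h2.add_mul S.levy S.hyp.jumpCoeff h1 (-1)).le_of_le_zero S.levy S.hyp.jumpCoeff le_rfl
    (by intro x; simp [evol_zero]) t ⟨ht.le, le_rfl⟩
  simp only [evol_of_pos ht] at e1 e2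
  ext x
  linarith [e1 x, e2 x]

theorem HeatSetup.integrable_kernel_right
    (S : HeatSetup d φ J a₁ α₁ C₀ a b β κ κ₀ κ₁ κ₂ δ Φinv p K a₂ α₂) {t : ℝ} (ht : 0 < t)
    (x : Euc d) : Integrable (p t x) := by
  obtain ⟨c, hc, h⟩ := S.exists_kernel_le_decay t ht
  refine Integrable.mono' (((integrable_decay d).comp_sub_right x).const_mul c)
    (continuous_kernel_right S.ker ht x).aestronglyMeasurable (Eventually.of_forall fun y => ?_)
  rw [Real.norm_of_nonneg (S.kernel_nonneg ht x y)]
  exact h t ⟨le_rfl, le_rfl⟩ x y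

/-- The Chapman–Kolmogorov identity. -/
theorem HeatSetup.heatOp_kernel
    (S : HeatSetup d φ J a₁ α₁ C₀ a b β κ κ₀ κ₁ κ₂ δ Φinv p K a₂ α₂) {s t : ℝ} (hs : 0 < s)
    (ht : 0 < t) (x y : Euc d) : heatOp p t (fun z => p s z y) x = p (s + t) x y := by
  obtain ⟨c, hc, hb⟩ := S.exists_kernel_le (max s 1) (le_max_right _ _)
  have hψ := (phiInvGen_spec S.hyp hs).1
  have hks := continuous_kernel S.ker hs
  have hkt := continuous_kernel_right S.ker ht x
  have hbd : ∀ z y, |p s z y| ≤ c / phiInvGen φ s ^ d := fun z y => by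
    rw [abs_of_nonneg (S.kernel_nonneg hs z y)]
    exact (hb s hs (le_max_left _ _) z y).1
  have hcont : Continuous fun y => heatOp p t (fun z => p s z y) x := by
    refine continuous_of_dominated (bound := fun z => |p t x z| * (c / phiInvGen φ s ^ d))
      (fun y => ?_) (fun y => Eventually.of_forall fun z => ?_)
      ((S.integrable_kernel_right ht x).abs.mul_const _) (Eventually.of_forall fun z => ?_)
    · exact (hkt.mul (continuous_kernel_left S.ker hs y)).aestronglyMeasurable
    · rw [norm_mul, Real.norm_eq_abs, Real.norm_eq_abs]
      gcongr
      exact hbd z y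
    · exact continuous_const.mul (continuous_kernel_right S.ker hs z)
  refine congrFun (eq_of_integral_mul_eq hcont
    (continuous_kernel_right S.ker (add_pos hs ht) x) fun f hf hf' => ?_) y
  have h1 := congrFun (S.heatOp_add hs ht hf hf'.is_zero_at_infty) x
  rw [show ∫ y, p (s + t) x y * f y = heatOp p (s + t) f x from rfl, h1]
  have hfi := hf.integrable_of_hasCompactSupport hf' (μ := volume)
  have hFi : Integrable (fun q : Euc d × Euc d => p t x q.1 * (p s q.1 q.2 * f q.2))
      (volume.prod volume) := by
    have : Integrable (fun q : Euc d × Euc d => p s q.1 q.2 * (p t x q.1 * f q.2))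
        (volume.prod volume) :=
      ((S.integrable_kernel_right ht x).mul_prod hfi).bdd_mul (c := c / phiInvGen φ s ^ d)
        hks.aestronglyMeasurable (Eventually.of_forall fun q => hbd q.1 q.2)
    refine this.congr (Eventually.of_forall fun q => ?_)
    ring
  have e1 : ∀ y, heatOp p t (fun z => p s z y) x * f y
      = ∫ z, p t x z * (p s z y * f y) := fun y => by
    rw [heatOp, ← integral_mul_const]
    simp only [mul_assoc]
  have e2 : ∀ z, p t x z * heatOp p s f z = ∫ y, p t x z * (p s z y * f y) := fun z => by
    rw [heatOp, ← integral_const_mul]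
  simp only [e1]
  rw [heatOp]
  simp only [e2]
  exact (integral_integral_swap (f := fun z y => p t x z * (p s z y * f y)) hFi).symm

end Semigroup

section DualMass

set_option linter.unusedSectionVars false

variable {d : ℕ} {φ J : ℝ → ℝ} {a₁ α₁ C₀ a b β κ₀ κ₁ κ₂ δ K a₂ α₂ T : ℝ}
  {κ : Euc d → Euc d → ℝ} {Φinv : ℝ → ℝ} {p : ℝ → Euc d → Euc d → ℝ} {f : Euc d → ℝ}
  [Nonempty (Fin d)]

/-- An `L¹` bound for a parameter integral. -/
theorem integrable_integral_and_le {X Y : Type*} [MeasurableSpace X] [MeasurableSpace Y]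
    {μ : Measure X} {ν : Measure Y} [SFinite μ] [SFinite ν] {F : X × Y → ℝ} {B : Y → ℝ}
    (hF : AEStronglyMeasurable F (μ.prod ν)) (hi : ∀ᵐ y ∂ν, Integrable (fun x => F (x, y)) μ)
    (hB : Integrable B ν) (hle : ∀ᵐ y ∂ν, ∫ x, |F (x, y)| ∂μ ≤ B y) :
    Integrable F (μ.prod ν) ∧ Integrable (fun x => ∫ y, F (x, y) ∂ν) μ ∧
      ∫ x, |∫ y, F (x, y) ∂ν| ∂μ ≤ ∫ y, B y ∂ν := by
  have hFi : Integrable F (μ.prod ν) := by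
    rw [integrable_prod_iff' hF]
    refine ⟨hi, Integrable.mono' hB ?_ ?_⟩
    · exact hF.norm.prod_swap.integral_prod_right'
    · filter_upwards [hle] with y hy
      rw [Real.norm_of_nonneg (integral_nonneg fun x => norm_nonneg _)]
      exact hy
  refine ⟨hFi, hFi.integral_prod_left, ?_⟩
  calc ∫ x, |∫ y, F (x, y) ∂ν| ∂μ ≤ ∫ x, ∫ y, |F (x, y)| ∂ν ∂μ :=
        integral_mono hFi.integral_prod_left.abs hFi.abs.integral_prod_left
          fun x => abs_integral_le_integral_abs
    _ = ∫ y, ∫ x, |F (x, y)| ∂μ ∂ν :=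
        integral_integral_swap (f := fun x y => |F (x, y)|) hFi.abs
    _ ≤ _ := integral_mono_ae hFi.abs.integral_prod_right hB hle

theorem HeatSetup.exists_dual_mass
    (S : HeatSetup d φ J a₁ α₁ C₀ a b β κ κ₀ κ₁ κ₂ δ Φinv p K a₂ α₂) (T : ℝ) (hT : 1 ≤ T) :
    ∃ C, 0 < C ∧ ∀ t, 0 < t → t ≤ T → ∀ y,
      Integrable (fun x => p t x y) ∧ ∫ x, p t x y ≤ C := by
  obtain ⟨c, hc, hker⟩ := exists_abs_kernel_le S.hyp S.ker T hT
  obtain ⟨c', hc', h'⟩ := S.exists_kernel_le T hT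
  set V : ℝ := (volume : Measure (Euc d)).real (Metric.ball 0 1) with hV
  have hφ1 := phi_pos S.hyp one_pos le_rfl
  have ha := S.hyp.ha
  have hK := S.levy.pos_K
  have hI0 : 0 ≤ ∫ z : Euc d, decay d z := integral_nonneg fun z => (decay_pos z).le
  refine ⟨c' * V + c' * a * (K * max 1 (T / φ 1)) + c * T * 2 ^ (d + 2) * (∫ z, decay d z) + 1,
    by positivity, fun t ht htT y => ?_⟩
  obtain ⟨h0, h1, hφψ⟩ := phiInvGen_spec S.hyp ht
  set ψ := phiInvGen φ t with hψ
  set m : Euc d → ℝ := fun z => (Metric.closedBall (0 : Euc d) ψ).indicator (fun _ => c' / ψ ^ d) z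
    + c' * a * t * (min 1 (‖z‖ ^ 2 / ψ ^ 2) * J ‖z‖) + c * T * 2 ^ (d + 2) * decay d z with hm
  have i1 : Integrable ((Metric.closedBall (0 : Euc d) ψ).indicator (fun _ => c' / ψ ^ d)) :=
    (integrable_indicator_iff Metric.isClosed_closedBall.measurableSet).2
      (integrableOn_const (isCompact_closedBall _ _).measure_lt_top.ne)
  have i2 := (S.levy.integrable ψ h0 h1).const_mul (c' * a * t)
  have i3 := (integrable_decay d).const_mul (c * T * 2 ^ (d + 2))
  have hmi : Integrable m := (i1.add i2).add i3
  have hle : ∀ᵐ x : Euc d, p t x y ≤ m (x - y) := by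
    have : ∀ᵐ x : Euc d, x ≠ y := by simp [ae_iff]
    filter_upwards [this] with x hxy
    have hz : x - y ≠ 0 := sub_ne_zero.2 hxy
    have hn : 0 < ‖x - y‖ := norm_pos_iff.2 hz
    have hJ := S.levy.pos_J _ hn
    have hdec := decay_pos (x - y)
    have hi0 : 0 ≤ (Metric.closedBall (0 : Euc d) ψ).indicator (fun _ => c' / ψ ^ d) (x - y) :=
      indicator_nonneg (fun _ _ => by positivity) _
    have hm2 : 0 ≤ c' * a * t * (min 1 (‖x - y‖ ^ 2 / ψ ^ 2) * J ‖x - y‖) := by positivity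
    have hm3 : 0 ≤ c * T * 2 ^ (d + 2) * decay d (x - y) := by positivity
    simp only [hm]
    rcases le_or_gt ‖x - y‖ ψ with hcase | hcase
    · have e : (Metric.closedBall (0 : Euc d) ψ).indicator (fun _ => c' / ψ ^ d) (x - y)
          = c' / ψ ^ d := indicator_of_mem (by simpa using hcase) _
      have := (h' t ht htT x y).1
      linarith
    rcases le_or_gt ‖x - y‖ 1 with hcase1 | hcase1
    · have e : min 1 (‖x - y‖ ^ 2 / ψ ^ 2) = 1 := by
        refine min_eq_left ?_
        rw [le_div_iff₀ (by positivity), one_mul]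
        gcongr
      have h2 := (h' t ht htT x y).2.1 hxy hcase1
      have h3 := S.hyp.hJ1_low _ hn hcase1
      have hφ := phi_pos S.hyp hn hcase1
      have h4 : c' * t / (‖x - y‖ ^ d * φ ‖x - y‖) ≤ c' * a * t * J ‖x - y‖ := by
        calc _ = c' * a * t * (a⁻¹ / (‖x - y‖ ^ d * φ ‖x - y‖)) := by field_simp
          _ ≤ _ := by gcongr
      rw [e, one_mul]
      linarith
    · have h2 := (le_abs_self _).trans (hker t ht htT x y hxy)
      have h3 : c * t / ‖x - y‖ ^ (d + 2) ≤ c * T * 2 ^ (d + 2) * decay d (x - y) := by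
        have := le_mul_decay (z := x - y) (q := c * t / ‖x - y‖ ^ (d + 2)) (A := 0) (B := c * T)
          le_rfl (by positivity) (fun h => absurd h (not_le.2 hcase1)) (fun _ => by gcongr)
        linarith
      linarith
  have hi : Integrable fun x => p t x y := by
    refine Integrable.mono' (hmi.comp_sub_right y)
      (continuous_kernel_left S.ker ht y).aestronglyMeasurable ?_
    filter_upwards [hle] with x hx
    rwa [Real.norm_of_nonneg (S.kernel_nonneg ht x y)]
  refine ⟨hi, (integral_mono_ae hi (hmi.comp_sub_right y) hle).trans ?_⟩
  have i12 : Integrable fun z => (Metric.closedBall (0 : Euc d) ψ).indicator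
      (fun _ => c' / ψ ^ d) z + c' * a * t * (min 1 (‖z‖ ^ 2 / ψ ^ 2) * J ‖z‖) := i1.add i2
  rw [integral_sub_right_eq_self m y, integral_add i12 i3, integral_add i1 i2,
    integral_const_mul, integral_const_mul,
    integral_indicator Metric.isClosed_closedBall.measurableSet, setIntegral_const, smul_eq_mul]
  have hvol : (volume : Measure (Euc d)).real (Metric.closedBall 0 ψ) = ψ ^ d * V := by
    have := Measure.addHaar_real_closedBall (volume : Measure (Euc d)) 0 h0.le
    simpa using this
  have e1 : (volume : Measure (Euc d)).real (Metric.closedBall 0 ψ) * (c' / ψ ^ d) = c' * V := by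
    rw [hvol]; field_simp
  have e2 : c' * a * t * ∫ z : Euc d, min 1 (‖z‖ ^ 2 / ψ ^ 2) * J ‖z‖
      ≤ c' * a * (K * max 1 (T / φ 1)) := by
    calc _ ≤ c' * a * t * (K / φ ψ) := by gcongr; exact S.levy.bound ψ h0 h1
      _ = c' * a * (K * (t / min t (φ 1))) := by rw [hφψ]; ring
      _ ≤ _ := by
        gcongr
        rcases le_total t (φ 1) with h | h
        · rw [min_eq_left h, div_self ht.ne']; exact le_max_left _ _
        · rw [min_eq_right h]; exact le_max_of_le_right (by gcongr)
  rw [e1]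
  linarith

/-- The operators `heatOp p t` are bounded on `L¹`. -/
theorem HeatSetup.exists_L1_bound
    (S : HeatSetup d φ J a₁ α₁ C₀ a b β κ κ₀ κ₁ κ₂ δ Φinv p K a₂ α₂) (T : ℝ) (hT : 1 ≤ T) :
    ∃ C, 0 < C ∧ ∀ t, 0 < t → t ≤ T → ∀ f : Euc d → ℝ, Integrable f →
      Integrable (heatOp p t f) ∧ ∫ x, |heatOp p t f x| ≤ C * ∫ x, |f x| := by
  obtain ⟨C, hC, h⟩ := S.exists_dual_mass T hT
  refine ⟨C, hC, fun t ht htT f hf => ?_⟩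
  have := integrable_integral_and_le (μ := volume) (ν := volume)
    (F := fun q : Euc d × Euc d => p t q.1 q.2 * f q.2) (B := fun y => C * |f y|)
    ((continuous_kernel S.ker ht).aestronglyMeasurable.mul hf.1.comp_snd)
    (Eventually.of_forall fun y => (h t ht htT y).1.mul_const (f y)) (hf.abs.const_mul C)
    (Eventually.of_forall fun y => by
      simp only [abs_mul, abs_of_nonneg (S.kernel_nonneg ht _ _)]
      rw [integral_mul_const]
      gcongr
      exact (h t ht htT y).2)
  rw [integral_const_mul] at this
  exact this.2

end DualMass

section ConvolutionOperator

variable {d : ℕ}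

/-- Continuous functions on `ℝ^d` vanishing at infinity. -/
def CZero (d : ℕ) : Type := ZeroAtInftyContinuousMap (Euc d) ℝ

noncomputable instance : NormedAddCommGroup (CZero d) :=
  inferInstanceAs (NormedAddCommGroup (ZeroAtInftyContinuousMap (Euc d) ℝ))

noncomputable instance : NormedSpace ℝ (CZero d) :=
  inferInstanceAs (NormedSpace ℝ (ZeroAtInftyContinuousMap (Euc d) ℝ))

instance : CompleteSpace (CZero d) :=
  inferInstanceAs (CompleteSpace (ZeroAtInftyContinuousMap (Euc d) ℝ))

instance : FunLike (CZero d) (Euc d) ℝ :=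
  inferInstanceAs (FunLike (ZeroAtInftyContinuousMap (Euc d) ℝ) (Euc d) ℝ)

@[ext] theorem CZero.ext {f g : CZero d} (h : ∀ x, f x = g x) : f = g := DFunLike.ext _ _ h

@[simp] theorem CZero.add_apply (f g : CZero d) (x : Euc d) : (f + g) x = f x + g x := rfl

@[simp] theorem CZero.sub_apply (f g : CZero d) (x : Euc d) : (f - g) x = f x - g x := rfl

@[simp] theorem CZero.neg_apply (f : CZero d) (x : Euc d) : (-f) x = -f x := rfl

@[simp] theorem CZero.smul_apply (c : ℝ) (f : CZero d) (x : Euc d) : (c • f) x = c * f x := rfl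

@[simp] theorem CZero.zero_apply (x : Euc d) : (0 : CZero d) x = 0 := rfl

theorem CZero.abs_apply_le (f : CZero d) (x : Euc d) : |f x| ≤ ‖f‖ :=
  (ZeroAtInftyContinuousMap.toBCF f).norm_coe_le_norm x

theorem CZero.norm_le {f : CZero d} {C : ℝ} (hC : 0 ≤ C) : ‖f‖ ≤ C ↔ ∀ x, |f x| ≤ C :=
  BoundedContinuousFunction.norm_le (f := ZeroAtInftyContinuousMap.toBCF f) hC

theorem CZero.continuous (f : CZero d) : Continuous f :=
  (ZeroAtInftyContinuousMap.toContinuousMap f).continuous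

theorem CZero.zero (f : CZero d) : Tendsto f (cocompact (Euc d)) (nhds 0) :=
  ZeroAtInftyContinuousMap.zero_at_infty' f

/-- Bundle a continuous function vanishing at infinity. -/
def CZero.mk (f : Euc d → ℝ) (hf : Continuous f) (h0 : Tendsto f (cocompact (Euc d)) (nhds 0)) :
    CZero d := ZeroAtInftyContinuousMap.mk ⟨f, hf⟩ h0

@[simp] theorem CZero.mk_apply {f : Euc d → ℝ} (hf : Continuous f)
    (h0 : Tendsto f (cocompact (Euc d)) (nhds 0)) (x : Euc d) : CZero.mk f hf h0 x = f x := rfl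

theorem CZero.integrable_mul (f : CZero d) {g : Euc d → ℝ} (hg : Integrable g) :
    Integrable fun x => f x * g x :=
  hg.bdd_mul f.continuous.aestronglyMeasurable (c := ‖f‖)
    (Eventually.of_forall fun x => CZero.abs_apply_le f x)

theorem CZero.abs_integral_mul_le (f : CZero d) {g : Euc d → ℝ} (hg : Integrable g) :
    |∫ x, f x * g x| ≤ ‖f‖ * ∫ x, |g x| := by
  rw [← integral_const_mul]
  refine abs_integral_le_integral_abs.trans (integral_mono (f.integrable_mul hg).abs
    (hg.abs.const_mul _) fun x => ?_)
  simp only [abs_mul]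
  gcongr
  exact f.abs_apply_le x

/-- Translation on `C₀`. -/
noncomputable def shiftOp (h : Euc d) : CZero d →L[ℝ] CZero d :=
  LinearMap.mkContinuous
    { toFun := fun f => CZero.mk (fun x => f (x + h)) (f.continuous.comp (continuous_add_const h))
        (tendsto_comp_add_const_cocompact f.zero h)
      map_add' := fun f g => by ext x; simp
      map_smul' := fun c f => by ext x; simp } 1
    fun f => (CZero.norm_le (by positivity)).2 fun x => by
      simpa using f.abs_apply_le (x + h)

@[simp] theorem shiftOp_apply (h : Euc d) (f : CZero d) (x : Euc d) :
    shiftOp h f x = f (x + h) := rfl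

/-- The second difference in direction `z` as an operator on `C₀`. -/
noncomputable def diffOp (z : Euc d) : CZero d →L[ℝ] CZero d :=
  shiftOp z + shiftOp (-z) - (2 : ℝ) • 1

theorem diffOp_apply (z : Euc d) (f : CZero d) (x : Euc d) :
    diffOp z f x = secondDiff f x z := by
  simp [diffOp, secondDiff, sub_eq_add_neg]

/-- Convolution with an integrable density. -/
noncomputable def convOp (n : Euc d → ℝ) (hn : Integrable n) : CZero d →L[ℝ] CZero d :=
  LinearMap.mkContinuous
    { toFun := fun f => CZero.mk (fun x => ∫ z, f (x + z) * n z)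
        (continuous_of_dominated (bound := fun z => ‖f‖ * |n z|)
          (fun x => ((f.continuous.comp (continuous_const_add x)).aestronglyMeasurable.mul hn.1))
          (fun x => Eventually.of_forall fun z => by
            rw [norm_mul]
            exact mul_le_mul_of_nonneg_right (f.abs_apply_le _) (abs_nonneg _))
          (hn.abs.const_mul _)
          (Eventually.of_forall fun z => (f.continuous.comp (continuous_add_const z)).mul
            continuous_const))
        (by
          rw [show (0:ℝ) = ∫ _ : Euc d, (0:ℝ) by simp]
          refine tendsto_integral_filter_of_dominated_convergence (fun z => ‖f‖ * |n z|)
            (Eventually.of_forall fun x =>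
              ((f.continuous.comp (continuous_const_add x)).aestronglyMeasurable.mul hn.1))
            (Eventually.of_forall fun x => Eventually.of_forall fun z => ?_)
            (hn.abs.const_mul _) (Eventually.of_forall fun z => ?_)
          · rw [norm_mul]
            exact mul_le_mul_of_nonneg_right (f.abs_apply_le _) (abs_nonneg _)
          · simpa using (tendsto_comp_add_const_cocompact f.zero z).mul_const (n z))
      map_add' := fun f g => by
        ext x
        simp only [CZero.mk_apply, CZero.add_apply, add_mul]
        exact integral_add (((shiftOp x f).integrable_mul hn).congr
            (Eventually.of_forall fun z => by simp [add_comm]))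
          (((shiftOp x g).integrable_mul hn).congr
            (Eventually.of_forall fun z => by simp [add_comm]))
      map_smul' := fun c f => by
        ext x
        simp [mul_assoc, integral_const_mul] } (∫ z, |n z|)
    fun f => (CZero.norm_le (by positivity)).2 fun x => by
      have := (shiftOp x f).abs_integral_mul_le hn
      simp only [shiftOp_apply] at this
      simp only [LinearMap.coe_mk, AddHom.coe_mk, CZero.mk_apply, add_comm x]
      refine this.trans ?_
      rw [mul_comm]
      gcongr
      exact (CZero.norm_le (norm_nonneg _)).2 fun y => f.abs_apply_le _

@[simp] theorem convOp_apply (n : Euc d → ℝ) (hn : Integrable n) (f : CZero d) (x : Euc d) :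
    convOp n hn f x = ∫ z, f (x + z) * n z := rfl

theorem CZero.integrable_shift_mul (f : CZero d) {n : Euc d → ℝ} (hn : Integrable n) (x : Euc d) :
    Integrable fun z => f (x + z) * n z :=
  ((shiftOp x f).integrable_mul hn).congr (Eventually.of_forall fun z => by simp [add_comm])

theorem norm_convOp_le (n : Euc d → ℝ) (hn : Integrable n) : ‖convOp n hn‖ ≤ ∫ z, |n z| :=
  LinearMap.mkContinuous_norm_le _ (by positivity) _

theorem commute_convOp_shiftOp {n : Euc d → ℝ} (hn : Integrable n) (h : Euc d) :
    Commute (convOp n hn) (shiftOp h) := by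
  ext f x
  simp [add_right_comm]

theorem commute_convOp {n m : Euc d → ℝ} (hn : Integrable n) (hm : Integrable m) :
    Commute (convOp n hn) (convOp m hm) := by
  ext f x
  simp only [mul_apply_eq_comp, convOp_apply, ← integral_mul_const]
  have hi : Integrable (fun q : Euc d × Euc d => f (x + q.1 + q.2) * m q.2 * n q.1) := by
    have h1 : Integrable (fun q : Euc d × Euc d => n q.1 * m q.2) := hn.mul_prod hm
    refine (h1.bdd_mul (f := fun q : Euc d × Euc d => f (x + q.1 + q.2)) (c := ‖f‖)
      (f.continuous.comp (by fun_prop)).aestronglyMeasurable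
      (Eventually.of_forall fun q => CZero.abs_apply_le f _)).congr
      (Eventually.of_forall fun q => by ring)
  rw [integral_integral_swap hi]
  congr 1; ext w; congr 1; ext z
  rw [add_right_comm]; ring

/-- The generator of a compound Poisson semigroup with jump density `n`. -/
noncomputable def genOp (n : Euc d → ℝ) (hn : Integrable n) : CZero d →L[ℝ] CZero d :=
  convOp n hn - (∫ z, n z) • 1

theorem genOp_apply {n : Euc d → ℝ} (hn : Integrable n) (f : CZero d) (x : Euc d) :
    genOp n hn f x = (∫ z, f (x + z) * n z) - (∫ z, n z) * f x := by
  simp [genOp]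

theorem genOp_apply_eq_secondDiff {n : Euc d → ℝ} (hn : Integrable n) (he : ∀ z, n (-z) = n z)
    (f : CZero d) (x : Euc d) :
    genOp n hn f x = (1 / 2) * ∫ z, secondDiff f x z * n z := by
  have h1 := f.integrable_shift_mul hn x
  have h2 : Integrable fun z => f (x - z) * n z := by
    simpa [he, sub_eq_add_neg] using h1.comp_neg
  have e : ∫ z, f (x - z) * n z = ∫ z, f (x + z) * n z := by
    rw [← integral_neg_eq_self (fun z => f (x + z) * n z)]
    simp [he, sub_eq_add_neg]
  have h3 : Integrable fun z => f (x + z) * n z + f (x - z) * n z := h1.add h2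
  rw [genOp_apply]
  simp only [secondDiff, sub_mul, add_mul]
  rw [integral_sub h3 (hn.const_mul _), integral_add h1 h2, e, integral_const_mul]
  ring

theorem genOp_add {n m : Euc d → ℝ} (hn : Integrable n) (hm : Integrable m) :
    genOp (fun z => n z + m z) (hn.add hm) = genOp n hn + genOp m hm := by
  ext f x
  simp only [genOp_apply, add_apply, CZero.add_apply, mul_add]
  rw [integral_add (f.integrable_shift_mul hn x) (f.integrable_shift_mul hm x),
    integral_add hn hm]
  ring

theorem genOp_const_mul {n : Euc d → ℝ} (hn : Integrable n) (c : ℝ) :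
    genOp (fun z => c * n z) (hn.const_mul c) = c • genOp n hn := by
  ext f x
  simp only [genOp_apply, smul_apply, CZero.smul_apply, mul_left_comm _ c, integral_const_mul]
  ring

theorem Commute.sub_smul_one {A : Type*} [Ring A] [Algebra ℝ A] {x y : A} (h : Commute x y)
    (c : ℝ) : Commute x (y - c • (1 : A)) :=
  h.sub_right ((Commute.one_right x).smul_right c)

theorem commute_genOp {n m : Euc d → ℝ} (hn : Integrable n) (hm : Integrable m) :
    Commute (genOp n hn) (genOp m hm) :=
  (((commute_convOp hn hm).sub_smul_one _).symm.sub_smul_one _).symm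

theorem commute_convOp_diffOp {n : Euc d → ℝ} (hn : Integrable n) (z : Euc d) :
    Commute (convOp n hn) (diffOp z) :=
  ((commute_convOp_shiftOp hn z).add_right (commute_convOp_shiftOp hn (-z))).sub_smul_one 2

theorem commute_genOp_diffOp {n : Euc d → ℝ} (hn : Integrable n) (z : Euc d) :
    Commute (genOp n hn) (diffOp z) :=
  ((commute_convOp_diffOp hn z).symm.sub_smul_one _).symm

end ConvolutionOperator

section SymmetricMarkov

open NormedSpace

variable {d : ℕ} {A B : CZero d →L[ℝ] CZero d} {f g : CZero d}

theorem hasSum_exp_apply (B : CZero d →L[ℝ] CZero d) (f : CZero d) :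
    HasSum (fun n : ℕ => ((n.factorial : ℝ)⁻¹) • (B ^ n) f) (exp B f) := by
  have := (exp_series_hasSum_exp' (𝕂 := ℝ) B).mapL (ContinuousLinearMap.apply ℝ (CZero d) f)
  simpa using this

/-- Point evaluation on `C₀`. -/
noncomputable def CZero.evalCLM (x : Euc d) : CZero d →L[ℝ] ℝ :=
  LinearMap.mkContinuous ⟨⟨fun f => f x, fun _ _ => rfl⟩, fun _ _ => rfl⟩ 1
    fun f => by rw [one_mul]; exact f.abs_apply_le x

@[simp] theorem CZero.evalCLM_apply (x : Euc d) (f : CZero d) : CZero.evalCLM x f = f x := rfl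

/-- Integration against an integrable function, as a functional on `C₀`. -/
noncomputable def CZero.integralCLM {m : Euc d → ℝ} (hm : Integrable m) : CZero d →L[ℝ] ℝ :=
  LinearMap.mkContinuous
    { toFun := fun f => ∫ x, f x * m x
      map_add' := fun f g => by
        simp only [CZero.add_apply, add_mul]
        exact integral_add (f.integrable_mul hm) (g.integrable_mul hm)
      map_smul' := fun c f => by simp [mul_assoc, integral_const_mul] }
    (∫ x, |m x|) fun f => by
      rw [mul_comm]
      exact f.abs_integral_mul_le hm

@[simp] theorem CZero.integralCLM_apply {m : Euc d → ℝ} (hm : Integrable m) (f : CZero d) :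
    CZero.integralCLM hm f = ∫ x, f x * m x := rfl

theorem norm_pow_apply_le (B : CZero d →L[ℝ] CZero d) (f : CZero d) (n : ℕ) :
    ‖(B ^ n) f‖ ≤ ‖B‖ ^ n * ‖f‖ := by
  induction n with
  | zero => simp
  | succ n ih =>
    rw [pow_succ', mul_apply_eq_comp, pow_succ', mul_assoc]
    exact (B.le_opNorm _).trans (by gcongr)

theorem norm_exp_apply_le (B : CZero d →L[ℝ] CZero d) (f : CZero d) :
    ‖exp B f‖ ≤ Real.exp ‖B‖ * ‖f‖ := by
  have h : HasSum (fun n : ℕ => (‖B‖ ^ n / n.factorial) * ‖f‖) (Real.exp ‖B‖ * ‖f‖) := by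
    rw [Real.exp_eq_exp_ℝ]
    exact (expSeries_div_hasSum_exp ‖B‖).mul_right ‖f‖
  refine (hasSum_exp_apply B f).norm_le_of_bounded h fun n => ?_
  rw [norm_smul, norm_inv, RCLike.norm_natCast, div_mul_eq_mul_div, inv_mul_eq_div]
  gcongr
  exact norm_pow_apply_le B f n

/-- Operators preserving nonnegativity. -/
def IsPosOp (B : CZero d →L[ℝ] CZero d) : Prop :=
  ∀ f : CZero d, (∀ x, 0 ≤ f x) → ∀ x, 0 ≤ B f x

theorem isPosOp_exp (hB : IsPosOp B) : IsPosOp (exp B) := by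
  intro f hf x
  have h := (hasSum_exp_apply B f).mapL (CZero.evalCLM x)
  refine h.nonneg fun n => ?_
  have : ∀ n : ℕ, ∀ x, 0 ≤ (B ^ n) f x := by
    intro n
    induction n with
    | zero => simpa using hf
    | succ n ih => intro x; rw [pow_succ', mul_apply_eq_comp]; exact hB _ ih x
  have := this n x
  simp only [CZero.evalCLM_apply, CZero.smul_apply]
  positivity

/-- Operators preserving integrability and symmetric for the `L²` pairing. -/
def IsSymOp (B : CZero d →L[ℝ] CZero d) : Prop :=
  ∀ f : CZero d, Integrable f → Integrable (B f) ∧ ∀ g : CZero d, ∫ x, g x * B f x = ∫ x, B g x * f x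

theorem IsSymOp.one : IsSymOp (1 : CZero d →L[ℝ] CZero d) := fun f hf => ⟨hf, fun _ => rfl⟩

theorem IsSymOp.mul (hA : IsSymOp A) (hB : IsSymOp B) (hAB : Commute A B) : IsSymOp (A * B) := by
  intro f hf
  have h1 := hB f hf
  have h2 := hA _ h1.1
  refine ⟨h2.1, fun g => ?_⟩
  have e : (A * B) g = B (A g) := by rw [hAB.eq]; rfl
  rw [e]
  exact (h2.2 g).trans (h1.2 _)

theorem IsSymOp.pow (hB : IsSymOp B) (n : ℕ) : IsSymOp (B ^ n) := by
  induction n with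
  | zero => exact .one
  | succ n ih => rw [pow_succ]; exact ih.mul hB (Commute.pow_self B n)

theorem isSymOp_convOp {n : Euc d → ℝ} (hn : Integrable n) (he : ∀ z, n (-z) = n z) :
    IsSymOp (convOp n hn) := by
  intro f hf
  have hmeas : AEStronglyMeasurable (fun q : Euc d × Euc d => f (q.1 + q.2) * n q.2)
      (volume.prod volume) :=
    (f.continuous.comp continuous_add).aestronglyMeasurable.mul hn.1.comp_snd
  have hb := integrable_integral_and_le (μ := volume) (ν := volume)
    (F := fun q : Euc d × Euc d => f (q.1 + q.2) * n q.2) (B := fun z => (∫ x, |f x|) * |n z|)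
    hmeas (Eventually.of_forall fun z => (hf.comp_add_right z).mul_const (n z))
    (hn.abs.const_mul _) (Eventually.of_forall fun z => by
      simp only [abs_mul]
      rw [integral_mul_const, integral_add_right_eq_self (fun x => |f x|) z])
  refine ⟨hb.2.1, fun g => ?_⟩
  have hi : Integrable (fun q : Euc d × Euc d => g q.1 * (f (q.1 + q.2) * n q.2))
      (volume.prod volume) :=
    hb.1.bdd_mul (f := fun q : Euc d × Euc d => g q.1) (c := ‖g‖)
      (g.continuous.comp continuous_fst).aestronglyMeasurable
      (Eventually.of_forall fun q => g.abs_apply_le _)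
  simp only [convOp_apply, ← integral_const_mul, ← integral_mul_const]
  rw [integral_integral_swap hi]
  have hi' : Integrable (fun q : Euc d × Euc d => g (q.1 + q.2) * n q.2 * f q.1)
      (volume.prod volume) := by
    have h1 : Integrable (fun q : Euc d × Euc d => f q.1 * n q.2) (volume.prod volume) :=
      hf.mul_prod hn
    exact (h1.bdd_mul (f := fun q : Euc d × Euc d => g (q.1 + q.2)) (c := ‖g‖)
      (g.continuous.comp continuous_add).aestronglyMeasurable
      (Eventually.of_forall fun q => g.abs_apply_le _)).congr
      (Eventually.of_forall fun q => by ring)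
  have e2 : ∫ x, ∫ z, g (x + z) * n z * f x = ∫ z, ∫ x, g (x + z) * n z * f x :=
    integral_integral_swap hi'
  rw [e2, ← integral_neg_eq_self]
  congr 1; ext z
  rw [← integral_add_right_eq_self _ z]
  congr 1; ext x
  rw [he, add_neg_cancel_right]
  ring

theorem integrable_mul_abs_of_dual {F : Euc d → ℝ} (hF : Continuous F) {W : Euc d → ℝ}
    (hW : Continuous W) (hW0 : ∀ x, 0 ≤ W x) {C : ℝ}
    (h : ∀ g : Euc d → ℝ, Continuous g → HasCompactSupport g → (∀ x, |g x| ≤ W x) →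
      ∫ x, g x * F x ≤ C) :
    Integrable (fun x => W x * |F x|) ∧ ∫ x, W x * |F x| ≤ C := by
  have hc : AECover (volume : Measure (Euc d)) atTop
      fun i : ℕ => Metric.closedBall (0 : Euc d) ((i : ℝ) + 1) :=
    aecover_closedBall (tendsto_atTop_add_const_right _ _ tendsto_natCast_atTop_atTop)
  have hcont : Continuous fun x => W x * |F x| := hW.mul hF.abs
  have hInt : ∀ i : ℕ, IntegrableOn (fun x => W x * |F x|)
      (Metric.closedBall (0 : Euc d) ((i : ℝ) + 1)) :=
    fun i => hcont.continuousOn.integrableOn_compact (isCompact_closedBall _ _)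
  have hle : ∀ i : ℕ, ∫ x in Metric.closedBall (0 : Euc d) ((i : ℝ) + 1), W x * |F x| ≤ C := by
    intro i
    let χ : ContDiffBump (0 : Euc d) := ⟨(i : ℝ) + 1, (i : ℝ) + 2, by positivity, by linarith⟩
    have hχc : Continuous χ := χ.continuous
    have hi1 : Integrable fun x => χ x * (W x * |F x|) :=
      (hχc.mul hcont).integrable_of_hasCompactSupport χ.hasCompactSupport.mul_right
    have hi2 : Integrable fun x => χ x * W x :=
      (hχc.mul hW).integrable_of_hasCompactSupport χ.hasCompactSupport.mul_right
    have h1 : ∫ x in Metric.closedBall (0 : Euc d) ((i : ℝ) + 1), W x * |F x|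
        ≤ ∫ x, χ x * (W x * |F x|) := by
      rw [← integral_indicator Metric.isClosed_closedBall.measurableSet]
      refine integral_mono ((integrable_indicator_iff
        Metric.isClosed_closedBall.measurableSet).2 (hInt i)) hi1 fun x => ?_
      by_cases hx : x ∈ Metric.closedBall (0 : Euc d) ((i : ℝ) + 1)
      · simp [indicator_of_mem hx, χ.one_of_mem_closedBall hx]
      · rw [indicator_of_notMem hx]
        have := hW0 x
        have := χ.nonneg (x := x)
        positivity
    refine h1.trans (le_of_forall_pos_le_add fun η hη => ?_)
    have hI0 : 0 ≤ ∫ x, χ x * W x := integral_nonneg fun x => mul_nonneg χ.nonneg (hW0 x)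
    set N : ℝ := ((∫ x, χ x * W x) + 1) / η with hN
    have hNpos : 0 < N := by positivity
    set g : Euc d → ℝ := fun x => χ x * (W x * max (-1) (min 1 (N * F x))) with hg
    have hgc : Continuous g := hχc.mul (hW.mul (continuous_const.max
      (continuous_const.min (continuous_const.mul hF))))
    have hgs : HasCompactSupport g := χ.hasCompactSupport.mul_right
    have h2 := h g hgc hgs fun x => by
      have a1 : |max (-1) (min 1 (N * F x))| ≤ 1 :=
        abs_le.2 ⟨le_max_left _ _, max_le (by norm_num) (min_le_left _ _)⟩
      rw [hg, abs_mul, abs_mul, abs_of_nonneg χ.nonneg, abs_of_nonneg (hW0 x)]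
      calc χ x * (W x * |max (-1) (min 1 (N * F x))|) ≤ 1 * (W x * 1) := by
            have := hW0 x
            gcongr
            exact χ.le_one
        _ = W x := by ring
    have h3 : ∀ x, χ x * (W x * |F x|) ≤ g x * F x + χ x * W x * (1 / N) := by
      intro x
      have : |F x| ≤ max (-1) (min 1 (N * F x)) * F x + 1 / N := by
        have hN' : N * (1 / N) = 1 := by field_simp
        have hN0 : 0 < 1 / N := by positivity
        rcases le_total (N * F x) 1 with h5 | h5
        · rcases le_total (-1) (N * F x) with h6 | h6
          · rw [min_eq_right h5, max_eq_right h6, abs_le]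
            have h7 : 0 ≤ N * F x * F x := by nlinarith [sq_nonneg (F x)]
            constructor <;> nlinarith
          · rw [min_eq_right h5, max_eq_left h6, abs_of_nonpos (by nlinarith)]
            linarith
        · rw [min_eq_left h5, max_eq_right (by norm_num), abs_of_nonneg (by nlinarith)]
          linarith
      have hx := mul_le_mul_of_nonneg_left this (mul_nonneg (χ.nonneg (x := x)) (hW0 x))
      rw [hg]
      linarith
    have hi3 : Integrable fun x => g x * F x :=
      (hgc.mul hF).integrable_of_hasCompactSupport hgs.mul_right
    calc ∫ x, χ x * (W x * |F x|) ≤ ∫ x, (g x * F x + χ x * W x * (1 / N)) :=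
          integral_mono hi1 (hi3.add (hi2.mul_const _)) h3
      _ = (∫ x, g x * F x) + (∫ x, χ x * W x) * (1 / N) := by
          rw [integral_add hi3 (hi2.mul_const _), integral_mul_const]
      _ ≤ C + η := by
          have : (∫ x, χ x * W x) * (1 / N) ≤ η := by
            rw [hN, one_div_div, mul_div_assoc', div_le_iff₀ (by positivity)]
            nlinarith
          linarith
  have hI : Integrable fun x => W x * |F x| :=
    hc.integrable_of_integral_norm_bounded C hInt (Eventually.of_forall fun i => by
      refine le_trans (le_of_eq ?_) (hle i)
      congr 1; ext x
      exact Real.norm_of_nonneg (mul_nonneg (hW0 x) (abs_nonneg _)))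
  exact ⟨hI, le_of_tendsto (hc.integral_tendsto_of_countably_generated hI)
    (Eventually.of_forall hle)⟩

/-- Bundle a compactly supported continuous function. -/
def CZero.ofCompact (g : Euc d → ℝ) (hg : Continuous g) (hs : HasCompactSupport g) : CZero d :=
  CZero.mk g hg hs.is_zero_at_infty

@[simp] theorem CZero.ofCompact_apply {g : Euc d → ℝ} (hg : Continuous g)
    (hs : HasCompactSupport g) (x : Euc d) : CZero.ofCompact g hg hs x = g x := rfl

theorem isSymOp_exp (hB : IsSymOp B) : IsSymOp (exp B) := by
  intro f hf
  have key : ∀ g : CZero d, Integrable g → ∫ x, g x * exp B f x = ∫ x, exp B g x * f x := by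
    intro g hg
    have h1 := (hasSum_exp_apply B f).mapL (CZero.integralCLM hg)
    have h2 := (hasSum_exp_apply B g).mapL (CZero.integralCLM hf)
    have h3 : (fun n : ℕ => CZero.integralCLM hg (((n.factorial : ℝ)⁻¹) • (B ^ n) f))
        = fun n : ℕ => CZero.integralCLM hf (((n.factorial : ℝ)⁻¹) • (B ^ n) g) := by
      ext n
      have := (hB.pow n f hf).2 g
      simp only [map_smul, CZero.integralCLM_apply, mul_comm _ (g _)]
      rw [this]
    rw [h3] at h1
    have := h1.unique h2
    simpa only [CZero.integralCLM_apply, mul_comm _ (g _)] using this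
  have hI : Integrable (exp B f) := by
    have := (integrable_mul_abs_of_dual (exp B f).continuous continuous_const
      (fun _ => zero_le_one) (C := Real.exp ‖B‖ * ∫ x, |f x|) (fun g hg hs h1 => ?_)).1
    · refine (integrable_norm_iff (exp B f).continuous.aestronglyMeasurable).1 ?_
      simpa using this
    · have hgi : Integrable g := hg.integrable_of_hasCompactSupport hs
      rw [show ∫ x, g x * exp B f x = ∫ x, exp B (CZero.ofCompact g hg hs) x * f x from
        key (CZero.ofCompact g hg hs) hgi]
      refine (le_abs_self _).trans ((CZero.abs_integral_mul_le _ hf).trans ?_)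
      have : ‖CZero.ofCompact g hg hs‖ ≤ 1 := (CZero.norm_le zero_le_one).2 h1
      gcongr
      calc _ ≤ Real.exp ‖B‖ * ‖CZero.ofCompact g hg hs‖ := norm_exp_apply_le B _
        _ ≤ Real.exp ‖B‖ * 1 := by gcongr
        _ = _ := mul_one _
  refine ⟨hI, fun g => ?_⟩
  set χ : ℕ → ContDiffBump (0 : Euc d) :=
    fun i => ⟨(i : ℝ) + 1, (i : ℝ) + 2, by positivity, by linarith⟩ with hχ
  set G : ℕ → CZero d := fun i => CZero.ofCompact (fun x => χ i x * g x)
    ((χ i).continuous.mul g.continuous) (χ i).hasCompactSupport.mul_right with hG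
  have hlim : Tendsto G atTop (nhds g) := by
    rw [tendsto_iff_norm_sub_tendsto_zero, Metric.tendsto_atTop]
    intro η hη
    have := (Metric.tendsto_nhds.1 g.zero (η / 2) (half_pos hη))
    obtain ⟨s, hs, hs'⟩ := mem_cocompact.1 this
    obtain ⟨R, hR⟩ := hs.isBounded.subset_closedBall (0 : Euc d)
    refine ⟨⌈R⌉₊, fun n hn => ?_⟩
    simp only [dist_zero_right, norm_norm]
    refine lt_of_le_of_lt ((CZero.norm_le (half_pos hη).le).2 fun x => ?_) (half_lt_self hη)
    have e : (G n - g) x = -((1 - χ n x) * g x) := by simp [hG]; ring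
    rw [e, abs_neg, abs_mul, abs_of_nonneg (sub_nonneg.2 (χ n).le_one)]
    have hx0 := (χ n).nonneg (x := x)
    have hx1 := (χ n).le_one (x := x)
    by_cases hx : x ∈ s
    · have : χ n x = 1 := (χ n).one_of_mem_closedBall (Metric.closedBall_subset_closedBall (by
        have := Nat.ceil_le.1 hn
        simp only [hχ]; linarith) (hR hx))
      rw [this]; simp; positivity
    · have := hs' hx
      simp only [mem_ofPred_eq, dist_zero_right, Real.norm_eq_abs] at this
      calc _ ≤ 1 * |g x| := by gcongr; linarith
        _ ≤ η / 2 := by linarith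
  have l1 : Tendsto (fun i => ∫ x, G i x * exp B f x) atTop (nhds (∫ x, g x * exp B f x)) :=
    ((CZero.integralCLM hI).continuous.tendsto g).comp hlim
  have l2 : Tendsto (fun i => ∫ x, exp B (G i) x * f x) atTop (nhds (∫ x, exp B g x * f x)) :=
    (((CZero.integralCLM hf).comp (exp B)).continuous.tendsto g).comp hlim
  refine tendsto_nhds_unique l1 (l2.congr fun i => (key (G i) ?_).symm)
  exact (G i).continuous.integrable_of_hasCompactSupport (χ i).hasCompactSupport.mul_right

end SymmetricMarkov

section SymMarkovOperators

open NormedSpace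

variable {d : ℕ} {A B : CZero d →L[ℝ] CZero d}

/-- Positive contractions of `C₀` that are symmetric for the `L²` pairing. -/
structure SymMarkov (B : CZero d →L[ℝ] CZero d) : Prop where
  pos : IsPosOp B
  contr : ∀ f, ‖B f‖ ≤ ‖f‖
  sym : IsSymOp B

theorem IsPosOp.smul {c : ℝ} (hc : 0 ≤ c) (hB : IsPosOp B) : IsPosOp (c • B) :=
  fun f hf x => mul_nonneg hc (hB f hf x)

theorem IsSymOp.smul (c : ℝ) (hB : IsSymOp B) : IsSymOp (c • B) := by
  intro f hf
  obtain ⟨h1, h2⟩ := hB f hf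
  refine ⟨h1.const_mul c, fun g => ?_⟩
  have := congrArg (c * ·) (h2 g)
  simp only [← integral_const_mul] at this
  simpa [mul_assoc, mul_left_comm] using this

theorem exp_smul_add {X Y : CZero d →L[ℝ] CZero d} (h : Commute X Y) :
    exp (X + Y) = exp X * exp Y := by
  let : NormedAlgebra ℚ (CZero d →L[ℝ] CZero d) := .restrictScalars ℚ ℝ _
  exact exp_add_of_commute h

theorem exp_smul_genOp_eq {n : Euc d → ℝ} (hn : Integrable n) (s : ℝ) :
    exp (s • genOp n hn) = Real.exp (-(s * ∫ z, n z)) • exp (s • convOp n hn) := by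
  have e : s • genOp n hn = s • convOp n hn +
      algebraMap ℝ (CZero d →L[ℝ] CZero d) (-(s * ∫ z, n z)) := by
    rw [genOp, smul_sub, smul_smul, Algebra.algebraMap_eq_smul_one, neg_smul, sub_eq_add_neg]
  rw [e, exp_smul_add (Algebra.commutes _ _).symm, ← algebraMap_exp_comm,
    ← Real.exp_eq_exp_ℝ, Algebra.algebraMap_eq_smul_one, mul_smul_comm, mul_one]

theorem isPosOp_convOp {n : Euc d → ℝ} (hn : Integrable n) (h0 : ∀ z, 0 ≤ n z) :
    IsPosOp (convOp n hn) :=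
  fun f hf x => integral_nonneg fun z => mul_nonneg (hf _) (h0 z)

theorem symMarkov_exp_genOp {n : Euc d → ℝ} (hn : Integrable n) (h0 : ∀ z, 0 ≤ n z)
    (he : ∀ z, n (-z) = n z) {s : ℝ} (hs : 0 ≤ s) : SymMarkov (exp (s • genOp n hn)) := by
  rw [exp_smul_genOp_eq]
  refine ⟨.smul (Real.exp_pos _).le (isPosOp_exp (.smul hs (isPosOp_convOp hn h0))), fun f => ?_,
    .smul _ (isSymOp_exp (.smul s (isSymOp_convOp hn he)))⟩
  have h1 : ‖s • convOp n hn‖ ≤ s * ∫ z, n z := by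
    rw [norm_smul, Real.norm_of_nonneg hs]
    gcongr
    simpa only [abs_of_nonneg (h0 _)] using norm_convOp_le n hn
  rw [smul_apply, norm_smul, Real.norm_of_nonneg (Real.exp_pos _).le]
  calc _ ≤ Real.exp (-(s * ∫ z, n z)) * (Real.exp (s * ∫ z, n z) * ‖f‖) := by
        gcongr
        exact (norm_exp_apply_le _ f).trans (by gcongr)
    _ = ‖f‖ := by rw [← mul_assoc, ← Real.exp_add]; simp

theorem SymMarkov.abs_apply_le (hB : SymMarkov B) {f g : CZero d} (h : ∀ x, |f x| ≤ g x)
    (x : Euc d) : |B f x| ≤ B g x := by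
  have h1 := hB.pos (g - f) (fun x => by have := abs_le.1 (h x); simp; linarith) x
  have h2 := hB.pos (g + f) (fun x => by have := abs_le.1 (h x); simp; linarith) x
  rw [map_sub, CZero.sub_apply] at h1
  rw [map_add, CZero.add_apply] at h2
  exact abs_le.2 ⟨by linarith, by linarith⟩

theorem SymMarkov.weighted (hB : SymMarkov B) {χ : CZero d} (hχs : HasCompactSupport χ)
    (hχ0 : ∀ x, 0 ≤ χ x) (hχ1 : ∀ x, χ x ≤ 1) {τ : ℝ} (hτ : ‖B χ - χ‖ ≤ τ) {f : CZero d}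
    (hf : Integrable f) :
    ∫ x, (1 - χ x) * |B f x| ≤ ∫ x, (1 - χ x + τ) * |f x| := by
  have hW : Continuous fun x => 1 - χ x := continuous_const.sub χ.continuous
  have hWi : Integrable fun x => (1 - χ x + τ) * |f x| :=
    hf.abs.bdd_mul (c := 1 + |τ|) (hW.add continuous_const).aestronglyMeasurable
      (Eventually.of_forall fun x => by
        rw [Real.norm_eq_abs]
        refine (abs_add_le _ _).trans ?_
        gcongr
        exact abs_le.2 ⟨by linarith [hχ1 x], by linarith [hχ0 x]⟩)
  refine (integrable_mul_abs_of_dual (B f).continuous hW (fun x => by linarith [hχ1 x])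
    fun g hg hgs hgW => ?_).2
  obtain ⟨R, hR⟩ := (hgs.isCompact.union hχs.isCompact).isBounded.subset_closedBall (0 : Euc d)
  let b : ContDiffBump (0 : Euc d) := ⟨|R| + 1, |R| + 2, by positivity, by linarith⟩
  set X : CZero d := CZero.ofCompact b b.continuous b.hasCompactSupport
  set G : CZero d := CZero.ofCompact g hg hgs
  have hGX : ∀ x, |G x| ≤ (X - χ) x := by
    intro x
    simp only [CZero.sub_apply, G, X, CZero.ofCompact_apply]
    by_cases hx : x ∈ tsupport g ∪ tsupport χ
    · rw [b.one_of_mem_closedBall (Metric.closedBall_subset_closedBall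
        ((le_abs_self R).trans (by simp [b])) (hR hx))]
      exact hgW x
    · rw [mem_union, not_or] at hx
      rw [image_eq_zero_of_notMem_tsupport hx.1, image_eq_zero_of_notMem_tsupport hx.2]
      simpa using b.nonneg
  have hBG : ∀ x, |B G x| ≤ 1 - χ x + τ := by
    intro x
    refine (hB.abs_apply_le hGX x).trans ?_
    have h1 : B X x ≤ 1 := (le_abs_self _).trans (((B X).abs_apply_le x).trans
      ((hB.contr X).trans ((CZero.norm_le zero_le_one).2 fun x => by
        simp only [X, CZero.ofCompact_apply]
        rw [abs_of_nonneg b.nonneg]; exact b.le_one)))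
    have h2 := (abs_le.1 (((B χ - χ).abs_apply_le x).trans hτ)).1
    rw [CZero.sub_apply] at h2
    rw [map_sub, CZero.sub_apply]
    linarith
  calc ∫ x, g x * B f x = ∫ x, B G x * f x := (hB.sym f hf).2 G
    _ ≤ ∫ x, (1 - χ x + τ) * |f x| := integral_mono ((B G).integrable_mul hf) hWi fun x => by
        refine (le_abs_self _).trans ?_
        simp only [abs_mul]
        gcongr
        exact hBG x

theorem norm_exp_smul_sub_le {c : ℝ} (hA : ∀ s, 0 ≤ s → s ≤ c → ∀ f, ‖exp (s • A) f‖ ≤ ‖f‖)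
    (hc : 0 ≤ c) (χ : CZero d) : ‖exp (c • A) χ - χ‖ ≤ c * ‖A χ‖ := by
  have hd : ∀ s : ℝ, HasDerivAt (fun s : ℝ => exp (s • A) χ) (exp (s • A) (A χ)) s := by
    intro s
    have := (hasDerivAt_exp_smul_const A s).clm_apply (hasDerivAt_const s χ)
    simpa using this
  have := norm_image_sub_le_of_norm_deriv_le_segment' (f := fun s : ℝ => exp (s • A) χ)
    (f' := fun s => exp (s • A) (A χ)) (C := ‖A χ‖) (a := 0) (b := c)
    (fun s _ => (hd s).hasDerivWithinAt) (fun s hs => hA s hs.1 hs.2.le _) c ⟨hc, le_rfl⟩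
  simpa [mul_comm] using this

theorem exp_genOp_weighted {η : Euc d → ℝ} (hη : Integrable η) (h0 : ∀ z, 0 ≤ η z)
    (he : ∀ z, η (-z) = η z) (h1 : ∫ z, η z = 1) {c : ℝ} (hc : 0 ≤ c) {χ : CZero d}
    (hχs : HasCompactSupport χ) (hχ0 : ∀ x, 0 ≤ χ x) (hχ1 : ∀ x, χ x ≤ 1) {τ : ℝ}
    (hτ : c * ‖genOp η hη χ‖ ≤ τ) {f : CZero d} (hf : Integrable f) :
    ∫ x, (1 - χ x) * |exp (c • genOp η hη) f x| ≤
      Real.exp (-c) * (∫ x, (1 - χ x) * |f x|) +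
        ∫ x, (1 - χ x + τ) * |convOp η hη f x| := by
  have hW : Continuous fun x => 1 - χ x := continuous_const.sub χ.continuous
  have hT := (isSymOp_convOp hη he f hf).1
  have hSM : ∀ s : ℝ, 0 ≤ s → SymMarkov (exp (s • genOp η hη)) :=
    fun s hs => symMarkov_exp_genOp hη h0 he hs
  set N : ℝ := ∫ x, (1 - χ x + τ) * |convOp η hη f x|
  have hN : ∀ s : ℝ, 0 ≤ s → s ≤ c →
      ∫ x, (1 - χ x) * |exp (s • genOp η hη) (convOp η hη f) x| ≤ N := fun s hs hsc =>
    (hSM s hs).weighted hχs hχ0 hχ1 ((norm_exp_smul_sub_le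
      (fun u hu _ => (hSM u hu).contr) hs χ).trans (le_trans (by gcongr) hτ)) hT
  have hWint : ∀ {F : CZero d}, Integrable F → Integrable fun x => (1 - χ x) * |F x| :=
    fun {F} hF => hF.abs.bdd_mul (c := 1) hW.aestronglyMeasurable
      (Eventually.of_forall fun x => by
        rw [Real.norm_eq_abs]
        exact abs_le.2 ⟨by linarith [hχ1 x], by linarith [hχ0 x]⟩)
  refine (integrable_mul_abs_of_dual (CZero.continuous _) hW (fun x => by linarith [hχ1 x])
    fun g hg hgs hgW => ?_).2
  have hgi : Integrable g := hg.integrable_of_hasCompactSupport hgs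
  have hpair : ∀ F : CZero d, Integrable F →
      CZero.integralCLM hgi F ≤ ∫ x, (1 - χ x) * |F x| := fun F hF =>
    integral_mono (F.integrable_mul hgi) (hWint hF) fun x => by
      refine (le_abs_self _).trans ?_
      simp only [abs_mul, mul_comm |F x|]
      gcongr
      exact hgW x
  set h : ℝ → ℝ := fun s =>
    Real.exp s * CZero.integralCLM hgi (exp (s • genOp η hη) f) - Real.exp s * N with hh
  have hgen : genOp η hη f = convOp η hη f - f := by
    ext x
    simp [genOp_apply, h1]
  have hd : ∀ s : ℝ, HasDerivAt h (Real.exp s *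
      (CZero.integralCLM hgi (exp (s • genOp η hη) (convOp η hη f)) - N)) s := by
    intro s
    have a1 : HasDerivAt (fun s : ℝ => exp (s • genOp η hη) f)
        (exp (s • genOp η hη) (genOp η hη f)) s := by
      simpa using (hasDerivAt_exp_smul_const (genOp η hη) s).clm_apply (hasDerivAt_const s f)
    have a2 := (CZero.integralCLM hgi).hasFDerivAt.comp_hasDerivAt s a1
    have a3 := ((Real.hasDerivAt_exp s).mul a2).sub ((Real.hasDerivAt_exp s).mul_const N)
    refine a3.congr_deriv ?_
    simp only [hgen, map_sub, Function.comp_apply]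
    ring
  have hanti : AntitoneOn h (Icc 0 c) := by
    refine antitoneOn_of_deriv_nonpos (convex_Icc _ _)
      (fun s _ => (hd s).continuousAt.continuousWithinAt)
      (fun s _ => (hd s).differentiableAt.differentiableWithinAt) fun s hs => ?_
    rw [interior_Icc] at hs
    rw [(hd s).deriv]
    refine mul_nonpos_of_nonneg_of_nonpos (Real.exp_pos _).le (sub_nonpos.2 ?_)
    exact (hpair _ ((hSM s hs.1.le).sym _ hT).1).trans (hN s hs.1.le hs.2.le)
  have hfin := hanti ⟨le_rfl, hc⟩ ⟨hc, le_rfl⟩ hc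
  have h2 := hpair f hf
  have hN0 : 0 ≤ N := (integral_nonneg fun x =>
    mul_nonneg (by linarith [hχ1 x]) (abs_nonneg _)).trans (hN 0 le_rfl hc)
  simp only [hh, zero_smul, exp_zero, Real.exp_zero, one_mul, one_apply_eq_self] at hfin
  have e : ∫ x, g x * exp (c • genOp η hη) f x
      = CZero.integralCLM hgi (exp (c • genOp η hη) f) := by
    simp only [CZero.integralCLM_apply, mul_comm]
  rw [e]
  have h3 : CZero.integralCLM hgi (exp (c • genOp η hη) f)
      = Real.exp (-c) * (Real.exp c * CZero.integralCLM hgi (exp (c • genOp η hη) f)) := by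
    rw [← mul_assoc, ← Real.exp_add]; simp
  have h4 : Real.exp (-c) * Real.exp c = 1 := by rw [← Real.exp_add]; simp
  have h5 := mul_le_mul_of_nonneg_left (show Real.exp c *
    CZero.integralCLM hgi (exp (c • genOp η hη) f) ≤ (∫ x, (1 - χ x) * |f x|) + Real.exp c * N
    by linarith) (Real.exp_pos (-c)).le
  rw [h3]
  refine h5.trans (le_of_eq ?_)
  rw [mul_add, ← mul_assoc, h4, one_mul]

end SymMarkovOperators

section SplitGenerator

open NormedSpace

variable {d : ℕ}

theorem CZero.integrable_one_sub_mul {χ : CZero d} (hχ0 : ∀ x, 0 ≤ χ x) (hχ1 : ∀ x, χ x ≤ 1)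
    {f : Euc d → ℝ} (hf : Integrable f) : Integrable fun x => (1 - χ x) * |f x| :=
  hf.abs.bdd_mul (c := 1) (continuous_const.sub χ.continuous).aestronglyMeasurable
    (Eventually.of_forall fun x => by
      rw [Real.norm_eq_abs]
      exact abs_le.2 ⟨by linarith [hχ1 x], by linarith [hχ0 x]⟩)

theorem SymMarkov.integral_abs_le {B : CZero d →L[ℝ] CZero d} (hB : SymMarkov B) {f : CZero d}
    (hf : Integrable f) : ∫ x, |B f x| ≤ ∫ x, |f x| := by
  have := hB.weighted (χ := 0) HasCompactSupport.zero (by simp) (by simp) (τ := 0) (by simp) hf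
  simpa using this

theorem exp_genOp_add_weighted {n η : Euc d → ℝ} (hn : Integrable n) (hn0 : ∀ z, 0 ≤ n z)
    (hne : ∀ z, n (-z) = n z) (hη : Integrable η) (h0 : ∀ z, 0 ≤ η z)
    (he : ∀ z, η (-z) = η z) (h1 : ∫ z, η z = 1) {s lam : ℝ} (hs : 0 ≤ s) (hlam : 0 ≤ lam)
    {χ : CZero d} (hχs : HasCompactSupport χ) (hχ0 : ∀ x, 0 ≤ χ x) (hχ1 : ∀ x, χ x ≤ 1) {τ : ℝ}
    (hτn : s * ‖genOp n hn χ‖ ≤ τ) (hτη : s * lam * ‖genOp η hη χ‖ ≤ τ) {f : CZero d}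
    (hf : Integrable f) (hfχ : ∀ x, f x ≠ 0 → χ x = 1)
    (hTχ : ∀ x, convOp η hη f x ≠ 0 → χ x = 1) :
    ∫ x, |exp (s • (genOp n hn + lam • genOp η hη)) f x| ≤
        Real.exp (-(s * lam)) * (∫ x, |f x|) + ∫ x, |convOp η hη f x| ∧
      ∫ x, (1 - χ x) * |exp (s • (genOp n hn + lam • genOp η hη)) f x| ≤
        2 * τ * (Real.exp (-(s * lam)) * (∫ x, |f x|) + ∫ x, |convOp η hη f x|) := by
  have hB := symMarkov_exp_genOp hn hn0 hne hs
  have hE := symMarkov_exp_genOp hη h0 he (mul_nonneg hs hlam)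
  have hfac : exp (s • (genOp n hn + lam • genOp η hη)) f
      = exp (s • genOp n hn) (exp ((s * lam) • genOp η hη) f) := by
    rw [smul_add, smul_smul,
      exp_smul_add (((commute_genOp hn hη).smul_left s).smul_right (s * lam))]
    rfl
  have hEf := (hE.sym f hf).1
  have hT := (isSymOp_convOp hη he f hf).1
  have z1 := exp_genOp_weighted hη h0 he h1 (mul_nonneg hs hlam) (χ := 0) HasCompactSupport.zero
    (by simp) (by simp) (τ := 0) (by simp) hf
  simp only [CZero.zero_apply, sub_zero, one_mul, add_zero] at z1
  have z2 := exp_genOp_weighted hη h0 he h1 (mul_nonneg hs hlam) hχs hχ0 hχ1 hτη hf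
  have v1 : ∀ {F : CZero d}, (∀ x, F x ≠ 0 → χ x = 1) → ∀ x, (1 - χ x) * |F x| = 0 := by
    intro F hF x
    by_cases hx : F x = 0
    · simp [hx]
    · simp [hF x hx]
  simp only [add_mul, v1 hfχ, v1 hTχ, integral_zero, mul_zero, zero_add, integral_const_mul] at z2
  have z3 := hB.weighted hχs hχ0 hχ1 ((norm_exp_smul_sub_le
    (fun u hu _ => (symMarkov_exp_genOp hn hn0 hne hu).contr) hs χ).trans hτn) hEf
  simp only [add_mul] at z3
  rw [integral_add (CZero.integrable_one_sub_mul hχ0 hχ1 hEf) (hEf.abs.const_mul τ),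
    integral_const_mul] at z3
  have hτ0 : 0 ≤ τ := le_trans (by positivity) hτn
  rw [hfac]
  refine ⟨(hB.integral_abs_le hEf).trans z1, z3.trans ?_⟩
  have i1 : 0 ≤ Real.exp (-(s * lam)) * ∫ x, |f x| :=
    mul_nonneg (Real.exp_pos _).le (integral_nonneg fun x => abs_nonneg _)
  nlinarith [mul_le_mul_of_nonneg_left z1 hτ0]

end SplitGenerator

section Mollifiers

variable {d : ℕ}

theorem abs_sub_sub_le_of_lipschitz_fderiv {E : Type*} [NormedAddCommGroup E] [NormedSpace ℝ E]
    {h : E → ℝ} (hd : Differentiable ℝ h) {L : NNReal} (hL : LipschitzWith L (fderiv ℝ h))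
    (x z : E) : |h (x + z) - h x - fderiv ℝ h x z| ≤ L * ‖z‖ ^ 2 := by
  have := (convex_closedBall x ‖z‖).norm_image_sub_le_of_norm_fderiv_le' (𝕜 := ℝ) (f := h)
    (φ := fderiv ℝ h x) (C := L * ‖z‖) (fun y _ => hd y) (fun y hy => by
      refine (hL.norm_sub_le y x).trans ?_
      gcongr
      simpa [dist_eq_norm] using hy) (Metric.mem_closedBall_self (norm_nonneg z))
    (show x + z ∈ Metric.closedBall x ‖z‖ by simp)
  simpa [pow_two, mul_assoc] using this

theorem exists_abs_secondDiff_le {h : Euc d → ℝ} (hh : ContDiff ℝ 2 h)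
    (hs : HasCompactSupport h) : ∃ M : ℝ, 0 < M ∧ (∀ x, |h x| ≤ M) ∧
      SecondDiffBound h M 1 := by
  obtain ⟨L, hL⟩ := (hh.fderiv_right (m := 1) (by norm_num)).lipschitzWith_of_hasCompactSupport
    (hs.fderiv (𝕜 := ℝ)) one_ne_zero
  obtain ⟨N, hN0, hN⟩ := exists_bound_of_tendsto_zero hh.continuous hs.is_zero_at_infty
  have hd := hh.differentiable (by norm_num)
  have hL0 := L.2
  refine ⟨4 * N + 2 * L, by positivity, fun x => (hN x).trans (by linarith [show (0:ℝ) ≤ L from hL0]),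
    fun x z => ?_⟩
  have h1 := abs_le.1 (abs_sub_sub_le_of_lipschitz_fderiv hd hL x z)
  have h2 := abs_le.1 (abs_sub_sub_le_of_lipschitz_fderiv hd hL x (-z))
  rw [map_neg, norm_neg, ← sub_eq_add_neg] at h2
  have e : |secondDiff h x z| ≤ 2 * L * ‖z‖ ^ 2 := abs_le.2 ⟨by
    unfold secondDiff; linarith, by unfold secondDiff; linarith⟩
  have e' : |secondDiff h x z| ≤ 4 * N := by
    have a1 := abs_le.1 (hN (x + z))
    have a2 := abs_le.1 (hN (x - z))
    have a3 := abs_le.1 (hN x)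
    exact abs_le.2 ⟨by unfold secondDiff; linarith, by unfold secondDiff; linarith⟩
  have hz := sq_nonneg ‖z‖
  have hL0' : (0:ℝ) ≤ L := hL0
  rw [one_pow, div_one]
  rcases min_cases (1:ℝ) (‖z‖ ^ 2) with ⟨h3, _⟩ | ⟨h3, _⟩ <;> rw [h3] <;> nlinarith

/-- The reference smooth bump, equal to `1` on `B(0, 1/2)` and supported in `B(0, 1)`. -/
noncomputable def refBump (d : ℕ) : ContDiffBump (0 : Euc d) := ⟨1 / 2, 1, by norm_num, by norm_num⟩

/-- The cutoff at scale `ℓ` around `y`. -/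
noncomputable def cutoff (ℓ : ℝ) (y x : Euc d) : ℝ := refBump d (ℓ⁻¹ • (x - y))

theorem cutoff_nonneg (ℓ : ℝ) (y x : Euc d) : 0 ≤ cutoff ℓ y x := (refBump d).nonneg

theorem cutoff_le_one (ℓ : ℝ) (y x : Euc d) : cutoff ℓ y x ≤ 1 := (refBump d).le_one

theorem continuous_cutoff (ℓ : ℝ) (y : Euc d) : Continuous (cutoff ℓ y) :=
  (refBump d).continuous.comp (by fun_prop)

theorem cutoff_eq_one {ℓ : ℝ} (hℓ : 0 < ℓ) {x y : Euc d} (h : ‖x - y‖ ≤ ℓ / 2) :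
    cutoff ℓ y x = 1 := by
  refine (refBump d).one_of_mem_closedBall ?_
  rw [mem_closedBall_zero_iff, norm_smul, norm_inv, Real.norm_of_nonneg hℓ.le,
    inv_mul_le_iff₀ hℓ]
  simpa [refBump, div_eq_mul_inv] using h

theorem cutoff_eq_zero {ℓ : ℝ} (hℓ : 0 < ℓ) {x y : Euc d} (h : ℓ ≤ ‖x - y‖) :
    cutoff ℓ y x = 0 := by
  refine (refBump d).zero_of_le_dist ?_
  rw [dist_zero_right, norm_smul, norm_inv, Real.norm_of_nonneg hℓ.le, le_inv_mul_iff₀ hℓ]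
  simpa [refBump] using h

theorem hasCompactSupport_cutoff {ℓ : ℝ} (hℓ : 0 < ℓ) (y : Euc d) :
    HasCompactSupport (cutoff ℓ y) :=
  HasCompactSupport.intro (isCompact_closedBall y ℓ) fun x hx =>
    cutoff_eq_zero hℓ (by
      rw [Metric.mem_closedBall, dist_eq_norm, not_le] at hx
      exact hx.le)

theorem secondDiff_comp_smul_sub (h : Euc d → ℝ) (c : ℝ) (y x z : Euc d) :
    secondDiff (fun x => h (c • (x - y))) x z = secondDiff h (c • (x - y)) (c • z) := by
  simp only [secondDiff, ← smul_add, ← smul_sub, add_sub_right_comm, sub_right_comm]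

theorem exists_cutoff_secondDiffBound (d : ℕ) : ∃ M : ℝ, 0 < M ∧
    ∀ ℓ : ℝ, 0 < ℓ → ∀ y : Euc d, SecondDiffBound (cutoff ℓ y) M ℓ := by
  obtain ⟨M, hM0, -, hM⟩ := exists_abs_secondDiff_le (refBump d).contDiff
    (refBump d).hasCompactSupport
  refine ⟨M, hM0, fun ℓ hℓ y x z => ?_⟩
  have := hM (ℓ⁻¹ • (x - y)) (ℓ⁻¹ • z)
  rw [← secondDiff_comp_smul_sub, norm_smul, norm_inv, Real.norm_of_nonneg hℓ.le] at this
  refine this.trans (le_of_eq ?_)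
  congr 2
  field_simp

/-- Even probability densities `η r` on annuli of size comparable to `r`, with uniform
smoothness bounds. -/
structure IsMollifier (η : ℝ → Euc d → ℝ) (C : ℝ) : Prop where
  one_le : 1 ≤ C
  cont : ∀ {r}, 0 < r → Continuous (η r)
  compact : ∀ {r}, 0 < r → HasCompactSupport (η r)
  nonneg : ∀ {r}, 0 < r → ∀ z, 0 ≤ η r z
  even : ∀ {r}, 0 < r → ∀ z, η r (-z) = η r z
  mass : ∀ {r}, 0 < r → ∫ z, η r z = 1
  supp : ∀ {r}, 0 < r → ∀ z, η r z ≠ 0 → r / 4 ≤ ‖z‖ ∧ ‖z‖ ≤ r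
  le : ∀ {r}, 0 < r → ∀ z, η r z ≤ C / r ^ d
  diff : ∀ {r}, 0 < r → ∀ z, ∫ x, |secondDiff (η r) x z| ≤ C * (‖z‖ ^ 2 / r ^ 2)
  smooth : ∀ {r}, 0 < r → ContDiff ℝ 2 (η r)

theorem IsMollifier.integrable {η : ℝ → Euc d → ℝ} {C : ℝ} (h : IsMollifier η C) {r : ℝ}
    (hr : 0 < r) : Integrable (η r) :=
  (h.cont hr).integrable_of_hasCompactSupport (h.compact hr)

theorem integral_abs_secondDiff_le {f : Euc d → ℝ} (hf : Integrable f) (z : Euc d) :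
    Integrable (fun x => secondDiff f x z) ∧
      ∫ x, |secondDiff f x z| ≤ 4 * ∫ x, |f x| := by
  have h1 := hf.comp_add_right z
  have h2 := hf.comp_sub_right z
  have h12 : Integrable fun x => f (x + z) + f (x - z) := h1.add h2
  refine ⟨h12.sub (hf.const_mul 2), ?_⟩
  have hb : Integrable fun x => |f (x + z)| + |f (x - z)| := h1.abs.add h2.abs
  calc ∫ x, |secondDiff f x z| ≤ ∫ x, (|f (x + z)| + |f (x - z)| + 2 * |f x|) :=
        integral_mono (h12.sub (hf.const_mul 2)).abs (hb.add (hf.abs.const_mul 2)) fun x => by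
          simp only [secondDiff]
          refine (abs_sub _ _).trans ?_
          rw [abs_mul, abs_two]
          gcongr
          exact abs_add_le _ _
    _ = 4 * ∫ x, |f x| := by
        rw [integral_add hb (hf.abs.const_mul 2), integral_add h1.abs h2.abs,
          integral_add_right_eq_self (fun x => |f x|) z,
          integral_sub_right_eq_self (fun x => |f x|) z, integral_const_mul]
        ring

theorem exists_isMollifier (d : ℕ) [Nonempty (Fin d)] :
    ∃ (η : ℝ → Euc d → ℝ) (C : ℝ), IsMollifier η C := by
  let b' : ContDiffBump (0 : Euc d) := ⟨1 / 4, 1 / 2, by norm_num, by norm_num⟩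
  set h : Euc d → ℝ := fun x => refBump d x - b' x with hh
  have hb'0 : ∀ x : Euc d, 1 / 2 ≤ ‖x‖ → b' x = 0 := fun x hx => b'.zero_of_le_dist (by
    rwa [dist_zero_right])
  have hb'1 : ∀ x : Euc d, ‖x‖ ≤ 1 / 4 → b' x = 1 := fun x hx => b'.one_of_mem_closedBall (by
    rwa [mem_closedBall_zero_iff])
  have hb0 : ∀ x : Euc d, 1 ≤ ‖x‖ → refBump d x = 0 := fun x hx =>
    (refBump d).zero_of_le_dist (by rwa [dist_zero_right])
  have hb1 : ∀ x : Euc d, ‖x‖ ≤ 1 / 2 → refBump d x = 1 := fun x hx =>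
    (refBump d).one_of_mem_closedBall (by rwa [mem_closedBall_zero_iff])
  have hh2 : ContDiff ℝ 2 h := (refBump d).contDiff.sub b'.contDiff
  have hhs : HasCompactSupport h := (refBump d).hasCompactSupport.sub b'.hasCompactSupport
  have hh0 : ∀ x, 0 ≤ h x := by
    intro x
    rcases le_total ‖x‖ (1 / 2) with hx | hx
    · simp only [hh, hb1 x hx, sub_nonneg]; exact b'.le_one
    · simp only [hh, hb'0 x hx, sub_zero]; exact (refBump d).nonneg
  have hhe : ∀ x, h (-x) = h x := fun x => by simp only [hh, ContDiffBump.neg]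
  have hhsupp : ∀ x, h x ≠ 0 → 1 / 4 ≤ ‖x‖ ∧ ‖x‖ ≤ 1 := by
    intro x hx
    refine ⟨?_, ?_⟩ <;> by_contra! hc
    · exact hx (by simp only [hh, hb'1 x hc.le, hb1 x (by linarith), sub_self])
    · exact hx (by simp only [hh, hb'0 x (by linarith), hb0 x hc.le, sub_self])
  have hhi : Integrable h := hh2.continuous.integrable_of_hasCompactSupport hhs
  obtain ⟨M, hM0, hM, hMS⟩ := exists_abs_secondDiff_le hh2 hhs
  set m : ℝ := ∫ x, h x with hm
  have hmpos : 0 < m := by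
    obtain ⟨e, he⟩ := exists_norm_eq (Euc d) (c := 1 / 2) (by norm_num)
    refine hh2.continuous.integral_pos_of_hasCompactSupport_nonneg_nonzero hhs hh0 (x := e) ?_
    simp only [hh, hb1 e he.le, hb'0 e he.ge]
    norm_num
  set V : ℝ := volume.real (Metric.closedBall (0 : Euc d) 2) with hV
  have hV0 : 0 ≤ V := measureReal_nonneg
  have hdiff : ∀ z, ∫ x, |secondDiff h x z| ≤ (4 * m + M * V) * ‖z‖ ^ 2 := by
    intro z
    obtain ⟨hi, hle⟩ := integral_abs_secondDiff_le hhi z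
    simp only [abs_of_nonneg (hh0 _)] at hle
    rcases le_total 1 ‖z‖ with hz | hz
    · have : (1:ℝ) ≤ ‖z‖ ^ 2 := one_le_pow₀ hz
      have hMV : 0 ≤ M * V := by positivity
      nlinarith
    · have hz0 : ∀ x, x ∉ Metric.closedBall (0 : Euc d) 2 → |secondDiff h x z| = 0 := by
        intro x hx
        rw [mem_closedBall_zero_iff, not_le] at hx
        have e : ∀ w : Euc d, 1 < ‖w‖ → h w = 0 := fun w hw => by
          by_contra hne; exact absurd (hhsupp w hne).2 (not_le.2 hw)
        have n1 : ‖x‖ - ‖z‖ ≤ ‖x + z‖ := by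
          have := norm_sub_norm_le x (-z); rwa [norm_neg, sub_neg_eq_add] at this
        have n2 := norm_sub_norm_le x z
        simp [secondDiff, e (x + z) (by linarith), e (x - z) (by linarith), e x (by linarith)]
      rw [← setIntegral_eq_integral_of_forall_compl_eq_zero hz0]
      calc ∫ x in Metric.closedBall (0 : Euc d) 2, |secondDiff h x z|
          ≤ ∫ x in Metric.closedBall (0 : Euc d) 2, M * ‖z‖ ^ 2 := by
            refine setIntegral_mono hi.abs.integrableOn
              (integrableOn_const (measure_closedBall_lt_top.ne)) fun x => ?_
            refine (hMS x z).trans ?_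
            gcongr
            simp
        _ = V * (M * ‖z‖ ^ 2) := by rw [setIntegral_const]; rfl
        _ ≤ _ := by nlinarith [sq_nonneg ‖z‖]
  refine ⟨fun r x => (r ^ d)⁻¹ * (m⁻¹ * h (r⁻¹ • x)), 1 + m⁻¹ * (M + (4 * m + M * V)), ?_⟩
  have hscale : ∀ (F : Euc d → ℝ) {r : ℝ}, 0 < r →
      ∫ x, F (r⁻¹ • x) = r ^ d * ∫ x, F x := by
    intro F r hr
    rw [Measure.integral_comp_smul_of_nonneg _ _ _ (hR := (inv_pos.2 hr).le)]
    simp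
  refine ⟨?_, ?_, ?_, ?_, ?_, ?_, ?_, ?_, ?_, fun {r} hr => by fun_prop⟩
  · have : 0 ≤ m⁻¹ * (M + (4 * m + M * V)) := by positivity
    linarith
  · intro r hr
    have := hh2.continuous
    fun_prop
  · intro r hr
    refine HasCompactSupport.intro (isCompact_closedBall (0 : Euc d) r) fun x hx => ?_
    rw [mem_closedBall_zero_iff, not_le] at hx
    have : h (r⁻¹ • x) = 0 := by
      by_contra hne
      have := (hhsupp _ hne).2
      rw [norm_smul, norm_inv, Real.norm_of_nonneg hr.le, inv_mul_le_iff₀ hr] at this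
      linarith
    simp [this]
  · intro r hr z
    have := hh0 (r⁻¹ • z)
    positivity
  · intro r hr z
    simp only [smul_neg, hhe]
  · intro r hr
    rw [integral_const_mul, integral_const_mul, hscale h hr]
    field_simp
    exact hm.symm
  · intro r hr z hz
    have hz' : h (r⁻¹ • z) ≠ 0 := by
      intro h0; simp [h0] at hz
    have := hhsupp _ hz'
    rw [norm_smul, norm_inv, Real.norm_of_nonneg hr.le, inv_mul_le_iff₀ hr,
      le_inv_mul_iff₀ hr] at this
    constructor <;> linarith
  · intro r hr z
    have h1 : h (r⁻¹ • z) ≤ M := (le_abs_self _).trans (hM _)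
    rw [div_eq_inv_mul]
    gcongr
    have : 0 ≤ m⁻¹ * (4 * m + M * V) := by positivity
    calc m⁻¹ * h (r⁻¹ • z) ≤ m⁻¹ * M := by gcongr
      _ ≤ _ := by rw [mul_add]; linarith
  · intro r hr z
    have e : ∀ x, |secondDiff (fun x => (r ^ d)⁻¹ * (m⁻¹ * h (r⁻¹ • x))) x z|
        = (r ^ d)⁻¹ * (m⁻¹ * |secondDiff h (r⁻¹ • x) (r⁻¹ • z)|) := by
      intro x
      rw [← abs_of_pos (inv_pos.2 hmpos), ← abs_mul, ← abs_of_pos (inv_pos.2 (pow_pos hr d)),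
        ← abs_mul]
      congr 1
      simp only [secondDiff, smul_add, smul_sub]
      rw [abs_of_pos (inv_pos.2 hmpos), abs_of_pos (inv_pos.2 (pow_pos hr d))]
      ring
    simp only [e]
    rw [integral_const_mul, integral_const_mul,
      hscale (fun x => |secondDiff h x (r⁻¹ • z)|) hr]
    have h1 := hdiff (r⁻¹ • z)
    rw [norm_smul, norm_inv, Real.norm_of_nonneg hr.le] at h1
    have h2 : (r⁻¹ * ‖z‖) ^ 2 = ‖z‖ ^ 2 / r ^ 2 := by field_simp
    rw [h2] at h1
    have hq : 0 ≤ ‖z‖ ^ 2 / r ^ 2 := by positivity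
    calc _ = m⁻¹ * ∫ x, |secondDiff h x (r⁻¹ • z)| := by field_simp
      _ ≤ m⁻¹ * ((4 * m + M * V) * (‖z‖ ^ 2 / r ^ 2)) := by gcongr
      _ ≤ _ := by
        rw [← mul_assoc]
        gcongr
        have : 0 ≤ m⁻¹ * M := by positivity
        rw [mul_add]
        linarith

end Mollifiers

section Generator

set_option linter.unusedSectionVars false

variable {d : ℕ} {φ J : ℝ → ℝ} {a₁ α₁ C₀ a b β κ₀ κ₁ κ₂ δ K a₂ α₂ T : ℝ}
  {κ : Euc d → Euc d → ℝ} {Φinv : ℝ → ℝ} {p : ℝ → Euc d → Euc d → ℝ} {f : Euc d → ℝ}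

theorem diffOp_convOp {m : Euc d → ℝ} (hm : Integrable m) (z : Euc d) (f : CZero d) :
    diffOp z (convOp m hm f) =
      convOp (fun w => secondDiff m w z) (integral_abs_secondDiff_le hm z).1 f := by
  ext x
  rw [diffOp_apply]
  have i1 : Integrable fun w => f (x + w) * m (w + z) := f.integrable_shift_mul (hm.comp_add_right z) x
  have i2 : Integrable fun w => f (x + w) * m (w - z) := f.integrable_shift_mul (hm.comp_sub_right z) x
  have i3 := f.integrable_shift_mul hm x
  have e1 : ∫ w, f (x + z + w) * m w = ∫ w, f (x + w) * m (w - z) := by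
    rw [← integral_sub_right_eq_self _ z]
    congr 1; ext w; congr 2; abel
  have e2 : ∫ w, f (x - z + w) * m w = ∫ w, f (x + w) * m (w + z) := by
    rw [← integral_add_right_eq_self _ z]
    congr 1; ext w; congr 2; abel
  have i12 : Integrable fun w => f (x + w) * m (w + z) + f (x + w) * m (w - z) := i1.add i2
  simp only [secondDiff, convOp_apply, e1, e2]
  rw [show (fun w => f (x + w) * (m (w + z) + m (w - z) - 2 * m w)) = fun w =>
    f (x + w) * m (w + z) + f (x + w) * m (w - z) - 2 * (f (x + w) * m w) by ext w; ring,
    integral_sub i12 (i3.const_mul 2), integral_add i1 i2, integral_const_mul]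
  ring

theorem integral_abs_convOp_le {m : Euc d → ℝ} (hm : Integrable m) {f : CZero d}
    (hf : Integrable f) : Integrable (convOp m hm f) ∧
      ∫ x, |convOp m hm f x| ≤ (∫ z, |m z|) * ∫ x, |f x| := by
  have hmeas : AEStronglyMeasurable (fun q : Euc d × Euc d => f (q.1 + q.2) * m q.2)
      (volume.prod volume) :=
    (f.continuous.comp continuous_add).aestronglyMeasurable.mul hm.1.comp_snd
  have hb := integrable_integral_and_le (μ := volume) (ν := volume)
    (F := fun q : Euc d × Euc d => f (q.1 + q.2) * m q.2) (B := fun z => (∫ x, |f x|) * |m z|)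
    hmeas (Eventually.of_forall fun z => (hf.comp_add_right z).mul_const (m z))
    (hm.abs.const_mul _) (Eventually.of_forall fun z => by
      simp only [abs_mul]
      rw [integral_mul_const, integral_add_right_eq_self (fun x => |f x|) z])
  rw [integral_const_mul, mul_comm] at hb
  exact hb.2

theorem IsMollifier.secondDiffBound_convOp {η : ℝ → Euc d → ℝ} {C : ℝ} (h : IsMollifier η C)
    {r : ℝ} (hr : 0 < r) (f : CZero d) :
    SecondDiffBound (convOp (η r) (h.integrable hr) f) (‖f‖ * (4 + C)) r := by
  intro x z
  have hC := h.one_le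
  rw [← diffOp_apply, diffOp_convOp]
  obtain ⟨hi, hle⟩ := integral_abs_secondDiff_le (h.integrable hr) z
  simp only [abs_of_nonneg (h.nonneg hr _), h.mass hr] at hle
  have hle2 := h.diff hr z
  have h1 := (shiftOp x f).abs_integral_mul_le hi
  simp only [shiftOp_apply] at h1
  rw [convOp_apply]
  simp only [add_comm x]
  refine h1.trans ?_
  have h2 : ‖shiftOp x f‖ ≤ ‖f‖ := (CZero.norm_le (norm_nonneg _)).2 fun y => f.abs_apply_le _
  have hq : 0 ≤ ‖z‖ ^ 2 / r ^ 2 := by positivity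
  rw [mul_assoc]
  have h3 : ∫ w, |secondDiff (η r) w z| ≤ (4 + C) * min 1 (‖z‖ ^ 2 / r ^ 2) := by
    rcases min_cases (1:ℝ) (‖z‖ ^ 2 / r ^ 2) with ⟨h3, _⟩ | ⟨h3, _⟩ <;> rw [h3] <;> nlinarith
  exact mul_le_mul h2 h3 (integral_nonneg fun _ => abs_nonneg _) (norm_nonneg _)

theorem IsMollifier.exists_norm_convOp_sub_le {η : ℝ → Euc d → ℝ} {C : ℝ} (h : IsMollifier η C)
    (f : CZero d) {ε : ℝ} (hε : 0 < ε) :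
    ∃ r, ∃ hr : 0 < r, r ≤ 1 ∧ ‖convOp (η r) (h.integrable hr) f - f‖ ≤ ε := by
  have huc : UniformContinuous f := ZeroAtInftyContinuousMap.uniformContinuous
    (F := ZeroAtInftyContinuousMap (Euc d) ℝ) f
  obtain ⟨ρ, hρ, hρf⟩ := Metric.uniformContinuous_iff.1 huc ε hε
  refine ⟨min 1 (ρ / 2), by positivity, min_le_left _ _, ?_⟩
  set r := min 1 (ρ / 2) with hr'
  have hr : 0 < r := by positivity
  refine (CZero.norm_le hε.le).2 fun x => ?_
  have hi := h.integrable hr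
  have e : (convOp (η r) hi f - f) x = ∫ z, (f (x + z) - f x) * η r z := by
    simp only [sub_mul]
    rw [integral_sub (f.integrable_shift_mul hi x) (hi.const_mul _), integral_const_mul,
      h.mass hr, CZero.sub_apply, convOp_apply, mul_one]
  rw [e]
  calc |∫ z, (f (x + z) - f x) * η r z| ≤ ∫ z, ε * η r z := by
        rw [← Real.norm_eq_abs]
        refine norm_integral_le_of_norm_le (hi.const_mul ε) (Eventually.of_forall fun z => ?_)
        rw [norm_mul, Real.norm_of_nonneg (h.nonneg hr z)]
        by_cases hz : η r z = 0
        · simp [hz]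
        · refine mul_le_mul_of_nonneg_right ?_ (h.nonneg hr z)
          have := (h.supp hr z hz).2
          have h2 : dist (x + z) x < ρ := by
            rw [dist_eq_norm, add_sub_cancel_left]
            have := min_le_right 1 (ρ / 2)
            linarith
          exact (hρf h2).le
    _ = ε := by rw [integral_const_mul, h.mass hr, mul_one]

theorem secondDiff_neg_fun (f : Euc d → ℝ) (x z : Euc d) :
    secondDiff (fun x => -f x) x z = -secondDiff f x z := by
  simp only [secondDiff]; ring

theorem jumpOp_neg (x : Euc d) : jumpOp κ J (fun x => -f x) x = -jumpOp κ J f x := by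
  simp only [jumpOp, secondDiff_neg_fun, neg_mul, integral_neg, mul_neg]

theorem SecondDiffBound.neg {M r : ℝ} (h : SecondDiffBound f M r) :
    SecondDiffBound (fun x => -f x) M r := fun x z => by
  rw [secondDiff_neg_fun, abs_neg]; exact h x z

theorem heatOp_neg (t : ℝ) (x : Euc d) : heatOp p t (fun x => -f x) x = -heatOp p t f x := by
  simp only [heatOp, mul_neg, integral_neg]

variable [Nonempty (Fin d)]

theorem HeatSetup.exists_heatOp_le
    (S : HeatSetup d φ J a₁ α₁ C₀ a b β κ κ₀ κ₁ κ₂ δ Φinv p K a₂ α₂) (hf : Continuous f)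
    (h0 : Tendsto f (cocompact (Euc d)) (nhds 0)) {M r : ℝ} (hr : 0 < r) (hr1 : r ≤ 1)
    (hM : SecondDiffBound f M r) {ε : ℝ} (hε : 0 < ε) :
    ∃ τ₀, 0 < τ₀ ∧ ∀ τ ∈ Ioc 0 τ₀, ∀ x,
      heatOp p τ f x ≤ f x + τ * jumpOp κ J f x + ε * τ := by
  obtain ⟨η, C, hη⟩ := exists_isMollifier d
  have hκ := S.hyp.jumpCoeff
  set g : CZero d := CZero.mk (jumpOp κ J f) (continuous_jumpOp S.levy hκ hf hr hr1 hM)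
    (tendsto_jumpOp_cocompact S.levy hκ hf h0 hr hr1 hM)
  obtain ⟨r', hr', hr'1, hgr⟩ := hη.exists_norm_convOp_sub_le g (ε := ε / 4) (by positivity)
  set h := convOp (η r') (hη.integrable hr') g
  have hhS := hη.secondDiffBound_convOp hr' g
  obtain ⟨N, hN0, hN⟩ : ∃ N : ℝ, 0 < N ∧ ∀ x, |jumpOp κ J h x| ≤ N := by
    refine ⟨|κ₁ * (‖g‖ * (4 + C)) * (K / φ r')| + 1, by positivity, fun x => ?_⟩
    exact (jumpOp_bound S.levy hκ h.continuous.measurable ⟨_, h.abs_apply_le⟩ hr' hr'1 hhS x).trans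
      ((le_abs_self _).trans (by linarith))
  have hgh : ∀ x, |h x - jumpOp κ J f x| ≤ ε / 4 := fun x => ((h - g).abs_apply_le x).trans hgr
  refine ⟨ε / (4 * N), by positivity, fun τ hτ x => ?_⟩
  have hsol := ((S.admissible hf h0).isHeatSol S.hyp S.inv S.ker S.levy τ).neg S.levy hκ
  have := hsol.add_nonneg S.levy hκ (c := fun t => ε / 2 * t + N * t ^ 2)
    (c' := fun t => ε / 2 + N * (2 * t)) hf h0 hr hr1 hM h.continuous h.zero hr' hr'1 hhS
    (fun t => by
      have := ((hasDerivAt_id t).const_mul (ε / 2)).add ((hasDerivAt_pow 2 t).const_mul N)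
      exact this.congr_deriv (by simp))
    (fun t ht => by have := ht.1; positivity) (fun x => by simp [evol_zero])
    (fun t ht x => by
      have h1 := abs_le.1 (hgh x)
      have h2 := mul_le_mul_of_nonneg_left (abs_le.1 (hN x)).2 ht.1.le
      nlinarith [ht.1]) τ ⟨hτ.1.le, le_rfl⟩ x
  rw [evol_of_pos hτ.1] at this
  have h1 := mul_le_mul_of_nonneg_left (abs_le.1 (hgh x)).2 hτ.1.le
  have h2 : N * τ ≤ ε / 4 := by
    have := hτ.2
    rw [le_div_iff₀ (by positivity)] at this
    linarith
  nlinarith [hτ.1]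

/-- Functions with bounded second differences are in the domain of the generator of the heat
flow, which acts on them as `jumpOp`. -/
theorem HeatSetup.exists_abs_heatOp_sub_le
    (S : HeatSetup d φ J a₁ α₁ C₀ a b β κ κ₀ κ₁ κ₂ δ Φinv p K a₂ α₂) (hf : Continuous f)
    (h0 : Tendsto f (cocompact (Euc d)) (nhds 0)) {M r : ℝ} (hr : 0 < r) (hr1 : r ≤ 1)
    (hM : SecondDiffBound f M r) {ε : ℝ} (hε : 0 < ε) :
    ∃ τ₀, 0 < τ₀ ∧ ∀ τ ∈ Ioc 0 τ₀, ∀ x,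
      |heatOp p τ f x - f x - τ * jumpOp κ J f x| ≤ ε * τ := by
  obtain ⟨τ₁, hτ₁, h1⟩ := S.exists_heatOp_le hf h0 hr hr1 hM hε
  obtain ⟨τ₂, hτ₂, h2⟩ := S.exists_heatOp_le (f := fun x => -f x) hf.neg (by simpa using h0.neg) hr hr1 hM.neg hε
  refine ⟨min τ₁ τ₂, by positivity, fun τ hτ x => ?_⟩
  have h1 := h1 τ ⟨hτ.1, hτ.2.trans (min_le_left _ _)⟩ x
  have h2 := h2 τ ⟨hτ.1, hτ.2.trans (min_le_right _ _)⟩ x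
  rw [heatOp_neg, jumpOp_neg] at h2
  exact abs_le.2 ⟨by linarith, by linarith⟩

end Generator

section FractionalMoment

variable {d : ℕ} {φ J : ℝ → ℝ} {a₁ α₁ C₀ a b β κ₀ κ₁ κ₂ δ K a₂ α₂ q : ℝ}
  {κ : Euc d → Euc d → ℝ}

theorem integral_Ioo_rpow_eq {r α : ℝ} (h0 : 0 < r) (hα : 0 < α) :
    IntegrableOn (fun y : ℝ => y ^ (α - 1)) (Ioo 0 r) ∧
      ∫ y in Ioo 0 r, y ^ (α - 1) = r ^ α / α := by
  constructor
  · exact (intervalIntegral.integrableOn_Ioo_rpow_iff h0).2 (by linarith)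
  · rw [← integral_Ioc_eq_integral_Ioo, ← intervalIntegral.integral_of_le h0.le,
      integral_rpow (Or.inl (by linarith))]
    rw [sub_add_cancel, Real.zero_rpow hα.ne', sub_zero]

theorem exists_inner_levy_bound (H : HKAssumptions d φ J a₁ α₁ C₀ a b β κ κ₀ κ₁ κ₂ δ)
    (ha₂ : 0 < a₂) (hq : α₂ < q)
    (hUS : ∀ r R : ℝ, 0 < r → r ≤ R → R ≤ 1 → φ R / φ r ≤ a₂ * (R / r) ^ α₂)
    {r : ℝ} (h0 : 0 < r) (h1 : r ≤ 1) :
    IntegrableOn (fun y : ℝ => y ^ (d - 1) * (Iio r).indicator (fun y => (y / r) ^ q * J y) y)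
        (Ioi 0) ∧
      ∫ y in Ioi (0:ℝ), y ^ (d - 1) * (Iio r).indicator (fun y => (y / r) ^ q * J y) y
        ≤ a * a₂ / (q - α₂) / φ r := by
  have ha := H.ha
  have hφ := phi_pos H h0 h1
  set F : ℝ → ℝ := fun y => y ^ (d - 1) * ((y / r) ^ q * J y) with hF
  have e : (fun y : ℝ => y ^ (d - 1) * (Iio r).indicator (fun y => (y / r) ^ q * J y) y) =
      (Iio r).indicator F := by
    ext y
    by_cases hy : y ∈ Iio r <;> simp [hy, hF]
  have hcont : ContinuousOn F (Ioo 0 r) := by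
    refine (by fun_prop : Continuous fun y : ℝ => y ^ (d - 1)).continuousOn.mul
      (ContinuousOn.mul ?_ (H.J_cont.mono fun y hy => hy.1))
    refine ContinuousOn.rpow_const (by fun_prop) fun y hy => Or.inl ?_
    have := hy.1
    positivity
  obtain ⟨j1, j2⟩ := integral_Ioo_rpow_eq h0 (sub_pos.2 hq)
  obtain ⟨i1, b1⟩ := integrableOn_and_setIntegral_le (f := F)
    (g := fun y => a * a₂ / φ r / r ^ (q - α₂) * y ^ (q - α₂ - 1))
    measurableSet_Ioo (j1.const_mul _) (hcont.aestronglyMeasurable measurableSet_Ioo)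
    (fun y hy => by
      have := H.J_pos y hy.1
      have := hy.1
      simp only [hF]; positivity)
    (fun y hy => by
      have hy0 := hy.1
      have hφy := phi_pos H hy.1 (hy.2.le.trans h1)
      have hJ := H.J_pos y hy.1
      have hs := phi_upper_scaling H hUS hy.1 hy.2.le h1
      have hJ1 : y ^ (d - 1) * J y ≤ a / (y * φ y) := by
        rw [← pow_pred_mul_div H.hd hy0]
        exact mul_le_mul_of_nonneg_left (H.hJ1_up y hy0 (hy.2.le.trans h1)) (by positivity)
      have hinv : (φ y)⁻¹ ≤ a₂ * (r / y) ^ α₂ / φ r := by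
        rw [inv_eq_one_div, div_le_div_iff₀ hφy hφ, one_mul]; exact hs
      calc F y = (y / r) ^ q * (y ^ (d - 1) * J y) := by simp only [hF]; ring
        _ ≤ (y / r) ^ q * (a / (y * φ y)) := by gcongr
        _ = (y / r) ^ q * (a / y) * (φ y)⁻¹ := by field_simp
        _ ≤ (y / r) ^ q * (a / y) * (a₂ * (r / y) ^ α₂ / φ r) := by gcongr
        _ = _ := by
          rw [Real.div_rpow hy0.le h0.le, Real.div_rpow h0.le hy0.le, Real.rpow_sub h0,
            Real.rpow_sub hy0 (q - α₂), Real.rpow_sub hy0, Real.rpow_one]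
          field_simp)
  have hset : Iio r ∩ Ioi 0 = Ioo 0 r := by ext y; simp [and_comm]
  rw [e]
  constructor
  · rw [IntegrableOn, integrable_indicator_iff measurableSet_Iio, IntegrableOn,
      Measure.restrict_restrict measurableSet_Iio, hset]
    exact i1
  · rw [integral_indicator measurableSet_Iio, Measure.restrict_restrict measurableSet_Iio, hset]
    refine b1.trans (le_of_eq ?_)
    rw [integral_const_mul, j2]
    have := Real.rpow_pos_of_pos h0 (q - α₂)
    have := sub_pos.2 hq
    field_simp

theorem exists_fractional_moment (H : HKAssumptions d φ J a₁ α₁ C₀ a b β κ κ₀ κ₁ κ₂ δ)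
    (hJ : LevyDensity d φ J K) (ha₂ : 0 < a₂) (hq : α₂ < q) (hq0 : 0 < q)
    (hUS : ∀ r R : ℝ, 0 < r → r ≤ R → R ≤ 1 → φ R / φ r ≤ a₂ * (R / r) ^ α₂) :
    ∃ K', 0 < K' ∧ ∀ r, 0 < r → r ≤ 1 →
      Integrable (fun z : Euc d => min 1 ((‖z‖ / r) ^ q) * J ‖z‖) ∧
      ∫ z : Euc d, min 1 ((‖z‖ / r) ^ q) * J ‖z‖ ≤ K' / φ r := by
  have : Nonempty (Fin d) := ⟨⟨0, H.hd⟩⟩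
  have ha := H.ha
  set V : ℝ := d * (volume : Measure (Euc d)).real (Metric.ball 0 1) with hV
  have hV0 : 0 ≤ V := by positivity
  have hqa := sub_pos.2 hq
  refine ⟨V * (a * a₂ / (q - α₂)) + K, add_pos_of_nonneg_of_pos (by positivity) hJ.pos_K,
    fun r h0 h1 => ?_⟩
  obtain ⟨i, hb⟩ := exists_inner_levy_bound H ha₂ hq hUS h0 h1
  set f : ℝ → ℝ := (Iio r).indicator (fun y => (y / r) ^ q * J y) with hf
  have i1 : Integrable fun z : Euc d => f ‖z‖ := by
    refine (integrable_fun_norm_addHaar (volume : Measure (Euc d))).2 ?_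
    simpa using i
  have b1 : ∫ z : Euc d, f ‖z‖ ≤ V * (a * a₂ / (q - α₂) / φ r) := by
    have := integral_fun_norm_addHaar (volume : Measure (Euc d)) f
    simp only [finrank_euclideanSpace, Fintype.card_fin, smul_eq_mul, nsmul_eq_mul] at this
    rw [this, ← mul_assoc, hV]
    gcongr
  have hsum := i1.add (hJ.integrable r h0 h1)
  have hle : ∀ᵐ z : Euc d, min 1 ((‖z‖ / r) ^ q) * J ‖z‖ ≤
      f ‖z‖ + min 1 (‖z‖ ^ 2 / r ^ 2) * J ‖z‖ := by
    filter_upwards [Measure.ae_ne volume (0 : Euc d)] with z hz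
    have hz0 := norm_pos_iff.2 hz
    have hJz := hJ.pos_J _ hz0
    by_cases h : ‖z‖ < r
    · have : f ‖z‖ = (‖z‖ / r) ^ q * J ‖z‖ := by simp [hf, h]
      rw [this]
      have : min 1 ((‖z‖ / r) ^ q) * J ‖z‖ ≤ (‖z‖ / r) ^ q * J ‖z‖ := by
        gcongr; exact min_le_right _ _
      have : 0 ≤ min 1 (‖z‖ ^ 2 / r ^ 2) * J ‖z‖ := by positivity
      linarith
    · have : f ‖z‖ = 0 := by simp [hf, h]
      rw [this, zero_add]
      push Not at h
      rw [min_eq_left, min_eq_left]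
      · rw [← div_pow]; exact one_le_pow₀ ((one_le_div h0).2 h)
      · exact Real.one_le_rpow ((one_le_div h0).2 h) hq0.le
  have hInt : Integrable (fun z : Euc d => min 1 ((‖z‖ / r) ^ q) * J ‖z‖) := by
    refine Integrable.mono' hsum ?_ ?_
    · have : Measurable fun z : Euc d => min 1 ((‖z‖ / r) ^ q) := by fun_prop
      exact (this.mul hJ.meas).aestronglyMeasurable
    · filter_upwards [hle, Measure.ae_ne volume (0 : Euc d)] with z hz hz0
      have hJz := hJ.pos_J _ (norm_pos_iff.2 hz0)
      rw [Real.norm_of_nonneg (by positivity)]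
      exact hz
  refine ⟨hInt, ?_⟩
  calc _ ≤ ∫ z : Euc d, (f ‖z‖ + min 1 (‖z‖ ^ 2 / r ^ 2) * J ‖z‖) :=
        integral_mono_ae hInt hsum hle
    _ = _ := integral_add i1 (hJ.integrable r h0 h1)
    _ ≤ V * (a * a₂ / (q - α₂) / φ r) + K / φ r := add_le_add b1 (hJ.bound r h0 h1)
    _ = _ := by ring

end FractionalMoment

section FrozenSemigroup

open NormedSpace

set_option linter.unusedSectionVars false

variable {d : ℕ} {φ J : ℝ → ℝ} {a₁ α₁ C₀ a b β κ₀ κ₁ κ₂ δ K a₂ α₂ T : ℝ}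
  {κ : Euc d → Euc d → ℝ} {Φinv : ℝ → ℝ} {p : ℝ → Euc d → Euc d → ℝ} {f : Euc d → ℝ}
  {η : ℝ → Euc d → ℝ} {Cη M : ℝ}

/-- The jump density frozen at `y` and truncated below `ε`. -/
noncomputable def frozenDensity (κ : Euc d → Euc d → ℝ) (J : ℝ → ℝ) (ε : ℝ) (y z : Euc d) : ℝ :=
  if ε < ‖z‖ then κ y z * J ‖z‖ else 0

variable [Nonempty (Fin d)]

theorem integrable_frozenDensity (hJ : LevyDensity d φ J K) (hκ : JumpCoeff d κ κ₀ κ₁ κ₂ δ)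
    {ε : ℝ} (hε : 0 < ε) (y : Euc d) : Integrable (frozenDensity κ J ε y) := by
  have h := integrableOn_jump hJ hκ hε (F := fun _ => 1) measurable_const (M := 1) (by simp) y
  rw [← integrable_indicator_iff (measurableSet_lt_norm ε)] at h
  refine h.congr (Eventually.of_forall fun z => ?_)
  by_cases hz : ε < ‖z‖ <;> simp [frozenDensity, hz]

theorem frozenDensity_nonneg (hJ : LevyDensity d φ J K) (hκ : JumpCoeff d κ κ₀ κ₁ κ₂ δ)
    {ε : ℝ} (hε : 0 < ε) (y z : Euc d) : 0 ≤ frozenDensity κ J ε y z := by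
  unfold frozenDensity
  split_ifs with h
  · exact mul_nonneg (hκ.nonneg _ _) (hJ.pos_J _ (hε.trans h)).le
  · exact le_rfl

theorem frozenDensity_neg (hκ : JumpCoeff d κ κ₀ κ₁ κ₂ δ) (ε : ℝ) (y z : Euc d) :
    frozenDensity κ J ε y (-z) = frozenDensity κ J ε y z := by
  simp [frozenDensity, ← hκ.sym]

theorem frozenDensity_le (hJ : LevyDensity d φ J K) (hκ : JumpCoeff d κ κ₀ κ₁ κ₂ δ) (ε : ℝ)
    (y : Euc d) {z : Euc d} (hz : z ≠ 0) : frozenDensity κ J ε y z ≤ κ₁ * J ‖z‖ := by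
  have := hJ.pos_J _ (norm_pos_iff.2 hz)
  unfold frozenDensity
  split_ifs with h
  · gcongr; exact hκ.up _ _
  · have := hκ.pos₁; positivity

theorem norm_genOp_le (hJ : LevyDensity d φ J K) {m : Euc d → ℝ} (hm : Integrable m)
    (hm0 : ∀ z, 0 ≤ m z) (hme : ∀ z, m (-z) = m z) (hκ₁ : 0 ≤ κ₁)
    (hmJ : ∀ z, z ≠ 0 → m z ≤ κ₁ * J ‖z‖) {χ : CZero d} {ℓ : ℝ} (hℓ : 0 < ℓ) (hℓ1 : ℓ ≤ 1)
    (hχ : SecondDiffBound χ M ℓ) : ‖genOp m hm χ‖ ≤ κ₁ * M * (K / φ ℓ) := by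
  have hM := hχ.nonneg hℓ
  have hK := hJ.pos_K
  have hφ := hJ.pos_φ ℓ hℓ hℓ1
  refine (CZero.norm_le (by positivity)).2 fun x => ?_
  rw [genOp_apply_eq_secondDiff hm hme]
  have hb : |∫ z, secondDiff χ x z * m z| ≤ κ₁ * M * (K / φ ℓ) := by
    rw [← Real.norm_eq_abs]
    refine (norm_integral_le_of_norm_le ((hJ.integrable ℓ hℓ hℓ1).const_mul (κ₁ * M)) ?_).trans ?_
    · filter_upwards [Measure.ae_ne volume (0 : Euc d)] with z hz
      have := hJ.pos_J _ (norm_pos_iff.2 hz)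
      rw [norm_mul, Real.norm_of_nonneg (hm0 z), Real.norm_eq_abs]
      calc _ ≤ M * min 1 (‖z‖ ^ 2 / ℓ ^ 2) * (κ₁ * J ‖z‖) := by
            gcongr
            · exact hm0 z
            · exact hχ x z
            · exact hmJ z hz
        _ = _ := by ring
    · rw [integral_const_mul]
      gcongr
      exact hJ.bound ℓ hℓ hℓ1
  rw [abs_mul, abs_of_pos (by norm_num : (0:ℝ) < 1 / 2)]
  linarith [abs_nonneg (∫ z, secondDiff χ x z * m z)]

theorem HeatSetup.mollifier_le_frozenDensity
    (S : HeatSetup d φ J a₁ α₁ C₀ a b β κ κ₀ κ₁ κ₂ δ Φinv p K a₂ α₂) (hη : IsMollifier η Cη)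
    {ε r : ℝ} (hε : 0 < ε) (hr1 : r ≤ 1) (hεr : 4 * ε < r) (y z : Euc d) :
    κ₀ / (a * Cη * φ r) * η r z ≤ frozenDensity κ J ε y z := by
  have hr : 0 < r := by linarith
  have hκ := S.hyp.jumpCoeff
  have hφ := phi_pos S.hyp hr hr1
  have ha := S.hyp.ha
  have hC := hη.one_le
  have hκ₀ := S.hyp.κ₀_pos
  by_cases hz : η r z = 0
  · rw [hz, mul_zero]; exact frozenDensity_nonneg S.levy hκ hε y z
  obtain ⟨h1, h2⟩ := hη.supp hr z hz
  have hz0 : 0 < ‖z‖ := by linarith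
  rw [frozenDensity, if_pos (by linarith)]
  calc κ₀ / (a * Cη * φ r) * η r z ≤ κ₀ / (a * Cη * φ r) * (Cη / r ^ d) := by
        gcongr; exact hη.le hr z
    _ = κ₀ * (a⁻¹ / (r ^ d * φ r)) := by field_simp
    _ ≤ κ₀ * J r := by gcongr; exact S.hyp.hJ1_low r hr hr1
    _ ≤ κ y z * J ‖z‖ := by
        have := S.hyp.J_pos r hr
        gcongr
        · exact hκ.nonneg y z
        · exact hκ.low y z
        · exact S.hyp.J_anti hz0 hr h2

/-- The cutoff as a function vanishing at infinity. -/
noncomputable def cutoffZero {ℓ : ℝ} (hℓ : 0 < ℓ) (y : Euc d) : CZero d :=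
  CZero.ofCompact (cutoff ℓ y) (continuous_cutoff ℓ y) (hasCompactSupport_cutoff hℓ y)

@[simp] theorem cutoffZero_apply {ℓ : ℝ} (hℓ : 0 < ℓ) (y x : Euc d) :
    cutoffZero hℓ y x = cutoff ℓ y x := rfl

theorem integral_add_cutoff_mul {ℓ : ℝ} (hℓ : 0 < ℓ) (y : Euc d) (A : ℝ) {f : CZero d}
    (hf : Integrable f) : Integrable (fun x => (A + (1 - cutoff ℓ y x)) * |f x|) ∧
      ∫ x, (A + (1 - cutoff ℓ y x)) * |f x| =
      A * (∫ x, |f x|) + ∫ x, (1 - cutoff ℓ y x) * |f x| := by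
  simp only [add_mul]
  have h := CZero.integrable_one_sub_mul (χ := cutoffZero hℓ y) (fun x => cutoff_nonneg ℓ y x)
    (fun x => cutoff_le_one ℓ y x) hf
  simp only [cutoffZero_apply] at h
  exact ⟨(hf.abs.const_mul A).add h, by
    rw [integral_add (hf.abs.const_mul A) h, integral_const_mul]⟩

theorem symMarkov_exp_frozen (hJ : LevyDensity d φ J K) (hκ : JumpCoeff d κ κ₀ κ₁ κ₂ δ)
    {ε : ℝ} (hε : 0 < ε) (y : Euc d) {s : ℝ} (hs : 0 ≤ s) :
    SymMarkov (exp (s • genOp (frozenDensity κ J ε y) (integrable_frozenDensity hJ hκ hε y))) :=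
  symMarkov_exp_genOp _ (frozenDensity_nonneg hJ hκ hε y) (frozenDensity_neg hκ ε y) hs

theorem norm_exp_frozen_cutoff_sub_le (hJ : LevyDensity d φ J K) (hκ : JumpCoeff d κ κ₀ κ₁ κ₂ δ)
    (hM : ∀ ℓ : ℝ, 0 < ℓ → ∀ y : Euc d, SecondDiffBound (cutoff ℓ y) M ℓ)
    {ε s ℓ : ℝ} (hε : 0 < ε) (hℓ : 0 < ℓ) (hℓ1 : ℓ ≤ 1) (hs : 0 ≤ s) (y : Euc d) :
    ‖exp (s • genOp (frozenDensity κ J ε y) (integrable_frozenDensity hJ hκ hε y))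
      (cutoffZero hℓ y) - cutoffZero hℓ y‖ ≤ s * (κ₁ * M * (K / φ ℓ)) := by
  refine (norm_exp_smul_sub_le (fun u hu _ => (symMarkov_exp_frozen hJ hκ hε y hu).contr)
    hs _).trans ?_
  gcongr
  exact norm_genOp_le hJ _ (frozenDensity_nonneg hJ hκ hε y) (frozenDensity_neg hκ ε y)
    hκ.pos₁.le (fun z hz => frozenDensity_le hJ hκ ε y hz) hℓ hℓ1 (hM ℓ hℓ y)

theorem exp_frozen_weighted (hJ : LevyDensity d φ J K) (hκ : JumpCoeff d κ κ₀ κ₁ κ₂ δ)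
    (hM : ∀ ℓ : ℝ, 0 < ℓ → ∀ y : Euc d, SecondDiffBound (cutoff ℓ y) M ℓ)
    {ε s ℓ A : ℝ} (hε : 0 < ε) (hℓ : 0 < ℓ) (hℓ1 : ℓ ≤ 1) (hs : 0 ≤ s) (hA : 0 ≤ A) (y : Euc d)
    {f : CZero d} (hf : Integrable f) (hfs : ∀ x, f x ≠ 0 → ‖x - y‖ ≤ ℓ / 2) :
    ∫ x, (A + (1 - cutoff ℓ y x)) *
      |exp (s • genOp (frozenDensity κ J ε y) (integrable_frozenDensity hJ hκ hε y)) f x| ≤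
      (A + s * (κ₁ * M * (K / φ ℓ))) * ∫ x, |f x| := by
  have hB := symMarkov_exp_frozen hJ hκ hε y hs
  rw [(integral_add_cutoff_mul hℓ y A (hB.sym f hf).1).2, add_mul]
  refine add_le_add (mul_le_mul_of_nonneg_left (hB.integral_abs_le hf) hA) ?_
  · have h := hB.weighted (χ := cutoffZero hℓ y) (hasCompactSupport_cutoff hℓ y)
      (fun x => cutoff_nonneg ℓ y x) (fun x => cutoff_le_one ℓ y x)
      (norm_exp_frozen_cutoff_sub_le hJ hκ hM hε hℓ hℓ1 hs y) hf
    refine h.trans (le_of_eq ?_)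
    rw [← integral_const_mul]
    congr 1
    ext x
    by_cases hx : f x = 0
    · simp [hx]
    · rw [cutoffZero_apply, cutoff_eq_one hℓ (hfs x hx)]; ring

theorem HeatSetup.exp_frozen_regularized
    (S : HeatSetup d φ J a₁ α₁ C₀ a b β κ κ₀ κ₁ κ₂ δ Φinv p K a₂ α₂) (hη : IsMollifier η Cη)
    (hM : ∀ ℓ : ℝ, 0 < ℓ → ∀ y : Euc d, SecondDiffBound (cutoff ℓ y) M ℓ)
    {ε r s ℓ A : ℝ} (hε : 0 < ε) (hr : 0 < r) (hεr : 4 * ε < r) (hℓ : 0 < ℓ) (hℓ1 : ℓ ≤ 1)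
    (hrℓ : r ≤ ℓ / 4) (hs : 0 ≤ s) (hA : 0 ≤ A) (y : Euc d) {f : CZero d} (hf : Integrable f)
    (hfs : ∀ x, f x ≠ 0 → ‖x - y‖ ≤ ℓ / 4) :
    ∫ x, (A + (1 - cutoff ℓ y x)) * |exp (s • genOp (frozenDensity κ J ε y)
        (integrable_frozenDensity S.levy S.hyp.jumpCoeff hε y)) f x| ≤
      (A + 2 * (s * (κ₁ * M * (K / φ ℓ)))) *
        (Real.exp (-(s * (κ₀ / (a * Cη * φ r)))) * (∫ x, |f x|) +
          ∫ x, |convOp (η r) (hη.integrable hr) f x|) := by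
  have hκ := S.hyp.jumpCoeff
  have hr1 : r ≤ 1 := by linarith
  have hφ := phi_pos S.hyp hr hr1
  have ha := S.hyp.ha
  have hC := hη.one_le
  have hκ₀ := S.hyp.κ₀_pos
  set lam := κ₀ / (a * Cη * φ r) with hlam
  have hlam0 : 0 ≤ lam := by positivity
  have hηi := hη.integrable hr
  have hni := integrable_frozenDensity S.levy hκ hε y
  set n' : Euc d → ℝ := fun z => frozenDensity κ J ε y z - lam * η r z with hn'
  have hle : ∀ z, lam * η r z ≤ frozenDensity κ J ε y z := fun z =>
    S.mollifier_le_frozenDensity hη hε hr1 hεr y z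
  have hn'i : Integrable n' := hni.sub (hηi.const_mul lam)
  have hn'0 : ∀ z, 0 ≤ n' z := fun z => sub_nonneg.2 (hle z)
  have hη0 : ∀ z, 0 ≤ lam * η r z := fun z => mul_nonneg hlam0 (hη.nonneg hr z)
  have hn'e : ∀ z, n' (-z) = n' z := fun z => by
    simp only [hn', frozenDensity_neg hκ, hη.even hr]
  have hgen : genOp (frozenDensity κ J ε y) hni = genOp n' hn'i + lam • genOp (η r) hηi := by
    rw [← genOp_const_mul, ← genOp_add]
    congr 1
    ext z
    simp [hn']
  have hup := fun z (hz : z ≠ 0) => frozenDensity_le S.levy hκ ε y hz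
  have h1 := norm_genOp_le S.levy hn'i hn'0 hn'e hκ.pos₁.le
    (fun z hz => (sub_le_self _ (hη0 z)).trans (hup z hz)) hℓ hℓ1
    (χ := cutoffZero hℓ y) (hM ℓ hℓ y)
  have h2 := norm_genOp_le S.levy (hηi.const_mul lam) hη0 (fun z => by rw [hη.even hr]) hκ.pos₁.le
    (fun z hz => (hle z).trans (hup z hz)) hℓ hℓ1 (χ := cutoffZero hℓ y) (hM ℓ hℓ y)
  rw [genOp_const_mul hηi, smul_apply, norm_smul, Real.norm_of_nonneg hlam0] at h2
  have hB := symMarkov_exp_frozen S.levy hκ hε y hs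
  rw [(integral_add_cutoff_mul hℓ y A (hB.sym f hf).1).2, add_mul]
  obtain ⟨c1, c2⟩ := exp_genOp_add_weighted hn'i hn'0 hn'e hηi (hη.nonneg hr) (hη.even hr)
    (hη.mass hr) hs hlam0 (χ := cutoffZero hℓ y) (hasCompactSupport_cutoff hℓ y)
    (fun x => cutoff_nonneg ℓ y x) (fun x => cutoff_le_one ℓ y x)
    (mul_le_mul_of_nonneg_left h1 hs) (by rw [mul_assoc]; exact mul_le_mul_of_nonneg_left h2 hs)
    hf (fun x hx => cutoff_eq_one hℓ (by linarith [hfs x hx]))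
    (fun x hx => cutoff_eq_one hℓ (by
      rw [convOp_apply] at hx
      obtain ⟨z, hz⟩ : ∃ z, f (x + z) * η r z ≠ 0 := by
        by_contra! h
        exact hx (by simp [h])
      have z1 := hfs _ (left_ne_zero_of_mul hz)
      have z2 := (hη.supp hr z (right_ne_zero_of_mul hz)).2
      have z3 := norm_sub_le (x + z - y) z
      rw [show x + z - y - z = x - y by abel] at z3
      linarith))
  rw [← hgen] at c1 c2
  exact add_le_add (mul_le_mul_of_nonneg_left c1 hA) c2

end FrozenSemigroup

section FrozenIncrements

open NormedSpace

set_option linter.unusedSectionVars false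

variable {d : ℕ} {φ J : ℝ → ℝ} {a₁ α₁ C₀ a b β κ₀ κ₁ κ₂ δ K a₂ α₂ T : ℝ}
  {κ : Euc d → Euc d → ℝ} {Φinv : ℝ → ℝ} {p : ℝ → Euc d → Euc d → ℝ} {f : Euc d → ℝ}
  {η : ℝ → Euc d → ℝ} {Cη M : ℝ} [Nonempty (Fin d)]

theorem exists_exp_neg_rpow_le {c ω : ℝ} (hc : 0 < c) (hω : 0 < ω) :
    ∃ C, 0 < C ∧ ∀ u, 0 < u → u ≤ 1 → Real.exp (-(c * u ^ (-ω))) ≤ C * u ^ 2 := by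
  obtain ⟨m, hm⟩ := exists_nat_ge (2 / ω)
  rw [div_le_iff₀ hω] at hm
  refine ⟨m.factorial / c ^ m, by positivity, fun u hu hu1 => ?_⟩
  have hX : 0 < c * u ^ (-ω) := mul_pos hc (Real.rpow_pos_of_pos hu _)
  have h := Real.pow_div_factorial_le_exp (c * u ^ (-ω)) hX.le m
  have e : (c * u ^ (-ω)) ^ m = c ^ m * u ^ (-(m * ω)) := by
    rw [mul_pow, ← Real.rpow_natCast (u ^ (-ω)), ← Real.rpow_mul hu.le]; ring_nf
  rw [e] at h
  rw [Real.exp_neg]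
  have h2 : (u ^ 2)⁻¹ ≤ u ^ (-(m * ω)) := by
    rw [← Real.rpow_natCast, ← Real.rpow_neg hu.le]
    exact Real.rpow_le_rpow_of_exponent_ge hu hu1 (by push_cast; linarith)
  rw [inv_le_comm₀ (Real.exp_pos _) (by positivity)]
  refine le_trans ?_ h
  rw [mul_inv, inv_div, div_mul_eq_mul_div]
  gcongr

/-- A mollifier centred at `y`, as a function vanishing at infinity. -/
noncomputable def bumpZero (hη : IsMollifier η Cη) {ρ : ℝ} (hρ : 0 < ρ) (y : Euc d) : CZero d :=
  CZero.ofCompact (fun x => η ρ (x - y)) ((hη.cont hρ).comp (continuous_id.sub continuous_const))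
    ((hη.compact hρ).comp_homeomorph (Homeomorph.subRight y))

@[simp] theorem bumpZero_apply (hη : IsMollifier η Cη) {ρ : ℝ} (hρ : 0 < ρ) (y x : Euc d) :
    bumpZero hη hρ y x = η ρ (x - y) := rfl

theorem integrable_bumpZero (hη : IsMollifier η Cη) {ρ : ℝ} (hρ : 0 < ρ) (y : Euc d) :
    Integrable (bumpZero hη hρ y) := (hη.integrable hρ).comp_sub_right y

theorem integral_abs_bumpZero (hη : IsMollifier η Cη) {ρ : ℝ} (hρ : 0 < ρ) (y : Euc d) :
    ∫ x, |bumpZero hη hρ y x| = 1 := by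
  simp only [bumpZero_apply, abs_of_nonneg (hη.nonneg hρ _)]
  rw [integral_sub_right_eq_self, hη.mass hρ]

theorem integral_bumpZero (hη : IsMollifier η Cη) {ρ : ℝ} (hρ : 0 < ρ) (y : Euc d) :
    ∫ x, bumpZero hη hρ y x = 1 := by
  simp only [bumpZero_apply]
  rw [integral_sub_right_eq_self, hη.mass hρ]

theorem diffOp_bumpZero_apply (hη : IsMollifier η Cη) {ρ : ℝ} (hρ : 0 < ρ) (y z x : Euc d) :
    diffOp z (bumpZero hη hρ y) x = secondDiff (η ρ) (x - y) z := by
  rw [diffOp_apply]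
  simp only [secondDiff, bumpZero_apply, add_sub_right_comm, sub_right_comm]

theorem integrable_diffOp_bumpZero (hη : IsMollifier η Cη) {ρ : ℝ} (hρ : 0 < ρ) (y z : Euc d) :
    Integrable (diffOp z (bumpZero hη hρ y)) := by
  have := (integral_abs_secondDiff_le (integrable_bumpZero hη hρ y) z).1
  simp only [← diffOp_apply] at this
  exact this

theorem integral_abs_diffOp_bumpZero_le (hη : IsMollifier η Cη) {ρ : ℝ} (hρ : 0 < ρ)
    (y z : Euc d) : ∫ x, |diffOp z (bumpZero hη hρ y) x| ≤ 4 ∧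
      ∫ x, |diffOp z (bumpZero hη hρ y) x| ≤ Cη * (‖z‖ ^ 2 / ρ ^ 2) := by
  constructor
  · have := (integral_abs_secondDiff_le (integrable_bumpZero hη hρ y) z).2
    rw [integral_abs_bumpZero, mul_one] at this
    simpa only [diffOp_apply] using this
  · simp only [diffOp_bumpZero_apply]
    rw [integral_sub_right_eq_self (fun x => |secondDiff (η ρ) x z|)]
    exact hη.diff hρ z

theorem norm_sub_le_of_diffOp_bumpZero_ne_zero (hη : IsMollifier η Cη) {ρ : ℝ} (hρ : 0 < ρ)
    {y z x : Euc d} (h : diffOp z (bumpZero hη hρ y) x ≠ 0) : ‖x - y‖ ≤ ρ + ‖z‖ := by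
  rw [diffOp_bumpZero_apply] at h
  by_contra! hx
  have key : ∀ w, ρ < ‖w‖ → η ρ w = 0 := fun w hw => by
    by_contra hne
    linarith [(hη.supp hρ w hne).2]
  refine h ?_
  have h1 : ρ < ‖x - y + z‖ := by
    have := norm_sub_le (x - y + z) z
    rw [add_sub_cancel_right] at this
    linarith
  have h2 : ρ < ‖x - y - z‖ := by
    have := norm_add_le (x - y - z) z
    rw [sub_add_cancel] at this
    linarith
  have h3 : ρ < ‖x - y‖ := by linarith [norm_nonneg z]
  simp [secondDiff, key _ h1, key _ h2, key _ h3]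

theorem integral_abs_convOp_diffOp_bumpZero_le (hη : IsMollifier η Cη) {ρ r : ℝ} (hρ : 0 < ρ)
    (hr : 0 < r) (y z : Euc d) :
    ∫ x, |convOp (η r) (hη.integrable hr) (diffOp z (bumpZero hη hρ y)) x| ≤
      Cη * (‖z‖ ^ 2 / r ^ 2) := by
  have hc : convOp (η r) (hη.integrable hr) (diffOp z (bumpZero hη hρ y)) =
      diffOp z (convOp (η r) (hη.integrable hr) (bumpZero hη hρ y)) :=
    DFunLike.congr_fun (commute_convOp_diffOp (hη.integrable hr) z).eq (bumpZero hη hρ y)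
  rw [hc, diffOp_convOp]
  refine (integral_abs_convOp_le _ (integrable_bumpZero hη hρ y)).2.trans ?_
  rw [integral_abs_bumpZero, mul_one]
  exact hη.diff hr z

theorem secondDiff_exp_frozen (hJ : LevyDensity d φ J K) (hκ : JumpCoeff d κ κ₀ κ₁ κ₂ δ)
    {ε : ℝ} (hε : 0 < ε) (y : Euc d) (s : ℝ) (f : CZero d) (x z : Euc d) :
    secondDiff (exp (s • genOp (frozenDensity κ J ε y) (integrable_frozenDensity hJ hκ hε y)) f)
      x z = exp (s • genOp (frozenDensity κ J ε y) (integrable_frozenDensity hJ hκ hε y))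
        (diffOp z f) x := by
  rw [← diffOp_apply]
  have hc : Commute (exp (s • genOp (frozenDensity κ J ε y)
      (integrable_frozenDensity hJ hκ hε y))) (diffOp z) :=
    ((commute_genOp_diffOp _ z).smul_left s).exp_left
  exact (DFunLike.congr_fun (DFunLike.congr_fun hc.eq f) x).symm

theorem HeatSetup.exists_weighted_increment_le
    (S : HeatSetup d φ J a₁ α₁ C₀ a b β κ κ₀ κ₁ κ₂ δ Φinv p K a₂ α₂) (hη : IsMollifier η Cη) :
    ∃ C, 0 < C ∧ ∀ s, 0 < s → s ≤ 1 → √s ≤ φ 1 → ∀ ρ (hρ : 0 < ρ), ρ ≤ phiInvGen φ (√s) / 8 →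
      ∀ ε (hε : 0 < ε), ∀ y z : Euc d, 32 * ε < ‖z‖ →
      ∫ x, (phiInvGen φ (√s) ^ δ + (1 - cutoff (phiInvGen φ (√s)) y x)) *
        |exp (s • genOp (frozenDensity κ J ε y)
          (integrable_frozenDensity S.levy S.hyp.jumpCoeff hε y))
            (diffOp z (bumpZero hη hρ y)) x| ≤
        C * (phiInvGen φ (√s) ^ δ + √s) * min 1 ((‖z‖ / phiInvGen φ s) ^ (1 + α₂ / 2)) +
          512 * min 1 (‖z‖ ^ 2 / phiInvGen φ (√s) ^ 2) := by
  obtain ⟨M, hM0, hM⟩ := exists_cutoff_secondDiffBound d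
  have H := S.hyp
  have hκ := H.jumpCoeff
  have ha := H.ha
  have hC := hη.one_le
  have hκ₀ := H.κ₀_pos
  have hκ₁ := H.κ₁_pos
  have hK := S.levy.pos_K
  have ha₁ := H.a₁_pos
  have hα₁ := H.α₁_pos
  have hα₂ := S.α₂_lt
  have hα₂0 := S.α₂_pos
  set θ := (2 - α₂) / 4 with hθ
  have hθ0 : 0 < θ := by rw [hθ]; linarith
  obtain ⟨E, hE, hexp⟩ := exists_exp_neg_rpow_le (c := κ₀ * a₁ / (a * Cη)) (ω := θ * α₁)
    (by positivity) (by positivity)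
  refine ⟨(1 + 2 * (κ₁ * M * K)) * (4 * E + 64 * Cη + 256), by positivity,
    fun s hs hs1 hsφ ρ hρ hρℓ ε hε y z hz => ?_⟩
  have hsq : 0 < √s := Real.sqrt_pos.2 hs
  have hsle : s ≤ √s := by
    have h1 : √s ≤ 1 := Real.sqrt_le_one.2 hs1
    nlinarith [Real.mul_self_sqrt hs.le]
  obtain ⟨hψ0, hψ1, hψ⟩ := phiInvGen_spec H hs
  obtain ⟨hℓ0, hℓ1, hℓ⟩ := phiInvGen_spec H hsq
  rw [min_eq_left (hsle.trans hsφ)] at hψ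
  rw [min_eq_left hsφ] at hℓ
  have hψℓ : phiInvGen φ s ≤ phiInvGen φ (√s) := phiInvGen_mono H hs hsle
  set ψ := phiInvGen φ s with hψdef
  set ℓ := phiInvGen φ (√s) with hℓdef
  have hz0 : 0 < ‖z‖ := by linarith
  have hδ := Real.rpow_pos_of_pos hℓ0 δ
  have hfi := integrable_diffOp_bumpZero hη hρ y z
  obtain ⟨hf4, -⟩ := integral_abs_diffOp_bumpZero_le hη hρ y z
  have hsupp : ∀ x, diffOp z (bumpZero hη hρ y) x ≠ 0 → ‖x - y‖ ≤ ρ + ‖z‖ :=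
    fun x hx => norm_sub_le_of_diffOp_bumpZero_ne_zero hη hρ hx
  set f := diffOp z (bumpZero hη hρ y) with hf
  have hτ : s * (κ₁ * M * (K / φ ℓ)) = κ₁ * M * K * √s := by
    rw [hℓ]
    nth_rewrite 1 [← Real.mul_self_sqrt hs.le]
    field_simp
  set u := ‖z‖ / ψ with hu
  have hu0 : 0 < u := by positivity
  have hP : 0 ≤ κ₁ * M * K := by positivity
  have hw1 : ℓ ^ δ + 2 * (κ₁ * M * K * √s) ≤ (1 + 2 * (κ₁ * M * K)) * (ℓ ^ δ + √s) := by
    nlinarith [mul_nonneg hP hδ.le]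
  have hq0 : 0 ≤ 1 + α₂ / 2 := by linarith
  have hmin0 : 0 ≤ min 1 (u ^ (1 + α₂ / 2)) := by positivity
  have hmin0' : 0 ≤ min 1 (‖z‖ ^ 2 / ℓ ^ 2) := by positivity
  rcases le_or_gt ‖z‖ (ψ / 8) with h1 | h1
  · have hu1 : u ≤ 1 / 8 := by rw [hu, div_le_iff₀ hψ0]; linarith
    set r := ψ * u ^ θ / 8 with hr
    have huθ := Real.rpow_pos_of_pos hu0 θ
    have hr0 : 0 < r := by positivity
    have huθ1 : u ^ θ ≤ 1 := Real.rpow_le_one hu0.le (by linarith) hθ0.le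
    have hrψ : r ≤ ψ / 8 := by rw [hr]; gcongr; exact mul_le_of_le_one_right hψ0.le huθ1
    have hrz : ‖z‖ / 8 ≤ r := by
      have : u ≤ u ^ θ := by
        nth_rewrite 1 [← Real.rpow_one u]
        exact Real.rpow_le_rpow_of_exponent_ge hu0 (by linarith) (by rw [hθ]; linarith)
      rw [hr]
      gcongr
      calc ‖z‖ = ψ * u := by rw [hu]; field_simp
        _ ≤ _ := by gcongr
    have hmain := S.exp_frozen_regularized hη hM hε hr0 (by linarith) hℓ0 hℓ1 (by linarith) hs.le
      hδ.le y hfi (fun x hx => by linarith [hsupp x hx])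
    rw [hτ] at hmain
    have hconv := integral_abs_convOp_diffOp_bumpZero_le hη hρ hr0 y z
    have hzr : ‖z‖ ^ 2 / r ^ 2 = 64 * u ^ (1 + α₂ / 2) := by
      have e1 : (u ^ θ) ^ 2 * u ^ (1 + α₂ / 2) = u ^ 2 := by
        rw [← Real.rpow_natCast, ← Real.rpow_natCast, ← Real.rpow_mul hu0.le, ← Real.rpow_add hu0]
        congr 1
        rw [hθ]; push_cast; ring
      rw [div_eq_iff (by positivity), hr]
      calc ‖z‖ ^ 2 = ψ ^ 2 * u ^ 2 := by rw [hu]; field_simp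
        _ = ψ ^ 2 * ((u ^ θ) ^ 2 * u ^ (1 + α₂ / 2)) := by rw [e1]
        _ = _ := by ring
    rw [hzr] at hconv
    have hlam : κ₀ * a₁ / (a * Cη) * u ^ (-(θ * α₁)) ≤ s * (κ₀ / (a * Cη * φ r)) := by
      have hφr := phi_pos H hr0 (by linarith)
      have hsc := phi_lower_scaling H hr0 (by linarith : r ≤ ψ) hψ1
      rw [hψ] at hsc
      have h8 : u ^ (-(θ * α₁)) ≤ (ψ / r) ^ α₁ := by
        rw [← neg_mul, Real.rpow_mul hu0.le]
        refine Real.rpow_le_rpow (by positivity) ?_ hα₁.le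
        rw [Real.rpow_neg hu0.le, le_div_iff₀ hr0, hr]
        field_simp
        norm_num
      calc _ ≤ κ₀ * a₁ / (a * Cη) * (ψ / r) ^ α₁ := by gcongr
        _ = κ₀ / (a * Cη * φ r) * (a₁ * (ψ / r) ^ α₁ * φ r) := by field_simp
        _ ≤ κ₀ / (a * Cη * φ r) * s := by gcongr
        _ = _ := by ring
    have hexp' : Real.exp (-(s * (κ₀ / (a * Cη * φ r)))) ≤ E * u ^ (1 + α₂ / 2) := by
      calc _ ≤ Real.exp (-(κ₀ * a₁ / (a * Cη) * u ^ (-(θ * α₁)))) := by gcongr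
        _ ≤ E * u ^ 2 := hexp u hu0 (by linarith)
        _ ≤ _ := by
          gcongr
          rw [← Real.rpow_natCast]
          exact Real.rpow_le_rpow_of_exponent_ge hu0 (by linarith) (by push_cast; linarith)
    have huq1 : u ^ (1 + α₂ / 2) ≤ 1 := Real.rpow_le_one hu0.le (by linarith) hq0
    have huq0 := Real.rpow_pos_of_pos hu0 (1 + α₂ / 2)
    rw [min_eq_right huq1]
    have hX : Real.exp (-(s * (κ₀ / (a * Cη * φ r)))) * (∫ x, |f x|) +
          ∫ x, |convOp (η r) (hη.integrable hr0) f x| ≤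
        (4 * E + 64 * Cη + 256) * u ^ (1 + α₂ / 2) := by
      have : Real.exp (-(s * (κ₀ / (a * Cη * φ r)))) * (∫ x, |f x|) ≤
          E * u ^ (1 + α₂ / 2) * 4 := by gcongr
      linarith
    calc _ ≤ _ := hmain
      _ ≤ (1 + 2 * (κ₁ * M * K)) * (ℓ ^ δ + √s) * ((4 * E + 64 * Cη + 256) * u ^ (1 + α₂ / 2)) := by
          refine mul_le_mul hw1 hX ?_ (by positivity)
          have : 0 ≤ ∫ x, |f x| := integral_nonneg fun x => abs_nonneg _
          have : 0 ≤ ∫ x, |convOp (η r) (hη.integrable hr0) f x| :=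
            integral_nonneg fun x => abs_nonneg _
          positivity
      _ = (1 + 2 * (κ₁ * M * K)) * (4 * E + 64 * Cη + 256) * (ℓ ^ δ + √s) *
          u ^ (1 + α₂ / 2) := by ring
      _ ≤ _ := le_add_of_nonneg_right (by positivity)
  rcases le_or_gt ‖z‖ (ℓ / 8) with h2 | h2
  · have hmain := exp_frozen_weighted S.levy hκ hM hε hℓ0 hℓ1 hs.le hδ.le y hfi
      (fun x hx => by linarith [hsupp x hx])
    rw [hτ] at hmain
    have hlow : 1 / 64 ≤ min 1 (u ^ (1 + α₂ / 2)) := by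
      refine le_min (by norm_num) ?_
      have hu8 : 1 / 8 ≤ u := by rw [hu, le_div_iff₀ hψ0]; linarith
      calc (1:ℝ) / 64 = (1 / 8 : ℝ) ^ (2:ℝ) := by norm_num
        _ ≤ (1 / 8 : ℝ) ^ (1 + α₂ / 2) :=
          Real.rpow_le_rpow_of_exponent_ge (by norm_num) (by norm_num) (by linarith)
        _ ≤ _ := Real.rpow_le_rpow (by norm_num) hu8 hq0
    calc _ ≤ _ := hmain
      _ ≤ (1 + 2 * (κ₁ * M * K)) * (ℓ ^ δ + √s) * 4 := by
          refine mul_le_mul (le_trans ?_ hw1) hf4 (integral_nonneg fun x => abs_nonneg _)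
            (by positivity)
          have : 0 ≤ κ₁ * M * K * √s := by positivity
          linarith
      _ = (1 + 2 * (κ₁ * M * K)) * 256 * (ℓ ^ δ + √s) * (1 / 64) := by ring
      _ ≤ (1 + 2 * (κ₁ * M * K)) * (4 * E + 64 * Cη + 256) * (ℓ ^ δ + √s) *
          min 1 (u ^ (1 + α₂ / 2)) := by
          gcongr
          have : 0 < 4 * E + 64 * Cη := by positivity
          linarith
      _ ≤ _ := le_add_of_nonneg_right (by positivity)
  · have hB := symMarkov_exp_frozen S.levy hκ hε y hs.le
    have hlow : 1 / 64 ≤ min 1 (‖z‖ ^ 2 / ℓ ^ 2) := by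
      refine le_min (by norm_num) ?_
      rw [le_div_iff₀ (by positivity)]
      nlinarith
    have hδ1 : ℓ ^ δ ≤ 1 := Real.rpow_le_one hℓ0.le hℓ1 H.δ_pos.le
    set V := exp (s • genOp (frozenDensity κ J ε y) (integrable_frozenDensity S.levy hκ hε y)) f
    have hVi : Integrable V := (hB.sym f hfi).1
    calc _ ≤ ∫ x, 2 * |V x| := by
          refine integral_mono (integral_add_cutoff_mul hℓ0 y _ hVi).1 (hVi.abs.const_mul 2)
            fun x => ?_
          have := cutoff_nonneg ℓ y x
          have := cutoff_le_one ℓ y x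
          simp only
          gcongr
          linarith
      _ ≤ 2 * 4 := by
          rw [integral_const_mul]
          gcongr
          exact (hB.integral_abs_le hfi).trans hf4
      _ = 512 * (1 / 64) := by norm_num
      _ ≤ 512 * min 1 (‖z‖ ^ 2 / ℓ ^ 2) := by gcongr
      _ ≤ _ := le_add_of_nonneg_left (by positivity)

end FrozenIncrements

section FreezingError

open NormedSpace

set_option linter.unusedSectionVars false

variable {d : ℕ} {φ J : ℝ → ℝ} {a₁ α₁ C₀ a b β κ₀ κ₁ κ₂ δ K a₂ α₂ T : ℝ}
  {κ : Euc d → Euc d → ℝ} {Φinv : ℝ → ℝ} {p : ℝ → Euc d → Euc d → ℝ} {f : Euc d → ℝ}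
  {η : ℝ → Euc d → ℝ} {Cη M : ℝ} [Nonempty (Fin d)]

theorem exists_rpow_le_of_pos {e c : ℝ} (he : 0 < e) (hc : 0 < c) :
    ∃ z, 0 < z ∧ z ≤ 1 ∧ z ^ e ≤ c := by
  refine ⟨min 1 (c ^ e⁻¹), by positivity, min_le_left _ _, ?_⟩
  calc (min 1 (c ^ e⁻¹)) ^ e ≤ (c ^ e⁻¹) ^ e :=
        Real.rpow_le_rpow (by positivity) (min_le_right _ _) he.le
    _ = c := Real.rpow_inv_rpow hc.le he.ne'

theorem exists_secondDiffBound_bumpZero (hη : IsMollifier η Cη) {ρ : ℝ} (hρ : 0 < ρ) :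
    ∃ N, 0 < N ∧ ∀ y, SecondDiffBound (bumpZero hη hρ y) N 1 := by
  obtain ⟨N, hN, -, h⟩ := exists_abs_secondDiff_le (hη.smooth hρ) (hη.compact hρ)
  refine ⟨N, hN, fun y x z => ?_⟩
  rw [← diffOp_apply, diffOp_bumpZero_apply]
  exact h _ _

theorem secondDiffBound_exp_frozen (hJ : LevyDensity d φ J K) (hκ : JumpCoeff d κ κ₀ κ₁ κ₂ δ)
    {ε : ℝ} (hε : 0 < ε) (y : Euc d) {s : ℝ} (hs : 0 ≤ s) {f : CZero d} {N : ℝ}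
    (hf : SecondDiffBound f N 1) : SecondDiffBound
      (exp (s • genOp (frozenDensity κ J ε y) (integrable_frozenDensity hJ hκ hε y)) f) N 1 := by
  intro x z
  have hN := hf.nonneg one_pos
  rw [secondDiff_exp_frozen hJ hκ hε]
  refine (CZero.abs_apply_le _ x).trans (((symMarkov_exp_frozen hJ hκ hε y hs).contr _).trans ?_)
  refine (CZero.norm_le (by positivity)).2 fun w => ?_
  rw [diffOp_apply]
  exact hf w z

theorem genOp_sub_jumpOp_eq (hJ : LevyDensity d φ J K) (hκ : JumpCoeff d κ κ₀ κ₁ κ₂ δ)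
    {n : Euc d → ℝ} (hn : Integrable n) (he : ∀ z, n (-z) = n z) {v : CZero d} {N : ℝ}
    (hv : SecondDiffBound v N 1) (x : Euc d) :
    genOp n hn v x - jumpOp κ J v x =
      (1 / 2) * ∫ z, (n z - κ x z * J ‖z‖) * secondDiff v x z := by
  have hm := v.continuous.measurable
  have i1 : Integrable fun z => secondDiff v x z * n z := by
    refine hn.bdd_mul (c := N) (measurable_secondDiff hm x).aestronglyMeasurable
      (Eventually.of_forall fun z => ?_)
    rw [Real.norm_eq_abs]
    exact (hv x z).trans (mul_le_of_le_one_right (hv.nonneg one_pos) (min_le_left _ _))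
  have i2 := integrable_secondDiff_mul hJ hκ hm one_pos le_rfl hv x
  rw [genOp_apply_eq_secondDiff hn he, jumpOp, ← mul_sub, ← integral_sub i1 i2]
  congr 2
  ext z
  ring

theorem HeatSetup.exists_scale_rpow_le
    (S : HeatSetup d φ J a₁ α₁ C₀ a b β κ κ₀ κ₁ κ₂ δ Φinv p K a₂ α₂) :
    ∃ C γ : ℝ, 0 < C ∧ 0 < γ ∧ ∀ s, 0 < s → s ≤ 1 → √s ≤ φ 1 →
      phiInvGen φ (√s) ^ δ + √s ≤ C * s ^ γ := by
  have H := S.hyp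
  have hφ1 := phi_pos H one_pos le_rfl
  have ha₂ := S.a₂_pos
  have hα₂ := S.α₂_pos
  have hδ := H.δ_pos
  refine ⟨(a₂ / φ 1) ^ (δ / α₂) + 1, min (δ / α₂ * (1 / 2)) (1 / 2), by positivity, by positivity,
    fun s hs hs1 hsφ => ?_⟩
  obtain ⟨hℓ0, hℓ1, hℓ⟩ := phiInvGen_spec H (Real.sqrt_pos.2 hs)
  rw [min_eq_left hsφ] at hℓ
  set ℓ := phiInvGen φ (√s)
  have hsc := phi_upper_scaling H S.scal hℓ0 hℓ1 le_rfl
  rw [hℓ, Real.div_rpow zero_le_one hℓ0.le, Real.one_rpow] at hsc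
  have hℓα := Real.rpow_pos_of_pos hℓ0 α₂
  have h1 : ℓ ^ α₂ ≤ a₂ / φ 1 * √s := by
    rw [div_mul_eq_mul_div, le_div_iff₀ hφ1]
    calc ℓ ^ α₂ * φ 1 ≤ ℓ ^ α₂ * (a₂ * (1 / ℓ ^ α₂) * √s) := by gcongr
      _ = _ := by field_simp
  have h2 : ℓ ^ δ ≤ (a₂ / φ 1) ^ (δ / α₂) * s ^ (δ / α₂ * (1 / 2)) := by
    calc ℓ ^ δ = (ℓ ^ α₂) ^ (δ / α₂) := by
          rw [← Real.rpow_mul hℓ0.le]; congr 1; field_simp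
      _ ≤ (a₂ / φ 1 * √s) ^ (δ / α₂) := Real.rpow_le_rpow hℓα.le h1 (by positivity)
      _ = _ := by
          rw [Real.mul_rpow (by positivity) (Real.sqrt_nonneg s), Real.sqrt_eq_rpow,
            ← Real.rpow_mul hs.le]
          ring_nf
  have h3 : s ^ (δ / α₂ * (1 / 2)) ≤ s ^ min (δ / α₂ * (1 / 2)) (1 / 2) :=
    Real.rpow_le_rpow_of_exponent_ge hs hs1 (min_le_left _ _)
  have h4 : √s ≤ s ^ min (δ / α₂ * (1 / 2)) (1 / 2) := by
    rw [Real.sqrt_eq_rpow]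
    exact Real.rpow_le_rpow_of_exponent_ge hs hs1 (min_le_right _ _)
  have h5 := Real.rpow_pos_of_pos (div_pos ha₂ hφ1) (δ / α₂)
  nlinarith

theorem JumpCoeff.abs_sub_le_weight (hκ : JumpCoeff d κ κ₀ κ₁ κ₂ δ) {ℓ : ℝ} (hℓ : 0 < ℓ)
    (x y z : Euc d) :
    |κ y z - κ x z| ≤ (κ₁ + κ₂) * (ℓ ^ δ + (1 - cutoff ℓ y x)) := by
  have h1 := hκ.pos₁
  have h2 := hκ.pos₂
  have hℓδ := Real.rpow_pos_of_pos hℓ δ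
  have hc := cutoff_le_one ℓ y x
  rcases le_total ‖x - y‖ ℓ with h | h
  · calc |κ y z - κ x z| ≤ κ₂ * ‖y - x‖ ^ δ := hκ.holder _ _ _
      _ ≤ κ₂ * ℓ ^ δ := by
          rw [norm_sub_rev]; gcongr; exact hκ.pos_δ.le
      _ ≤ _ := by nlinarith
  · rw [cutoff_eq_zero hℓ h]
    have a1 := hκ.nonneg y z
    have a2 := hκ.nonneg x z
    have a3 := hκ.up y z
    have a4 := hκ.up x z
    refine abs_le.2 ⟨?_, ?_⟩ <;> nlinarith

theorem HeatSetup.integral_abs_error_le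
    (S : HeatSetup d φ J a₁ α₁ C₀ a b β κ κ₀ κ₁ κ₂ δ Φinv p K a₂ α₂) (hη : IsMollifier η Cη)
    {K' C : ℝ} (hK' : ∀ r, 0 < r → r ≤ 1 →
      Integrable (fun z : Euc d => min 1 ((‖z‖ / r) ^ (1 + α₂ / 2)) * J ‖z‖) ∧
      ∫ z : Euc d, min 1 ((‖z‖ / r) ^ (1 + α₂ / 2)) * J ‖z‖ ≤ K' / φ r)
    {s ρ z₀ ε ℓ ψ A : ℝ} (hs : 0 ≤ s) (hρ : 0 < ρ) (hz₀ : 0 < z₀) (hz₀1 : z₀ ≤ 1) (hε : 0 < ε)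
    (hεz : 32 * ε < z₀) (hℓ : 0 < ℓ) (hℓ1 : ℓ ≤ 1) (hψ : 0 < ψ) (hψ1 : ψ ≤ 1) (hC : 0 ≤ C)
    (hA : 0 ≤ A) (y : Euc d)
    (hinc : ∀ z : Euc d, 32 * ε < ‖z‖ → ∫ x, (ℓ ^ δ + (1 - cutoff ℓ y x)) *
        |exp (s • genOp (frozenDensity κ J ε y)
          (integrable_frozenDensity S.levy S.hyp.jumpCoeff hε y))
            (diffOp z (bumpZero hη hρ y)) x| ≤
        C * A * min 1 ((‖z‖ / ψ) ^ (1 + α₂ / 2)) + 512 * min 1 (‖z‖ ^ 2 / ℓ ^ 2)) :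
    Integrable (fun x => ∫ z, (frozenDensity κ J ε y z - κ x z * J ‖z‖) *
        exp (s • genOp (frozenDensity κ J ε y)
          (integrable_frozenDensity S.levy S.hyp.jumpCoeff hε y))
            (diffOp z (bumpZero hη hρ y)) x) ∧
      ∫ x, |∫ z, (frozenDensity κ J ε y z - κ x z * J ‖z‖) *
        exp (s • genOp (frozenDensity κ J ε y)
          (integrable_frozenDensity S.levy S.hyp.jumpCoeff hε y))
            (diffOp z (bumpZero hη hρ y)) x| ≤
        (κ₁ + κ₂) * (C * A * (K' / φ ψ) + 512 * (K / φ ℓ)) +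
          κ₁ * Cη / ρ ^ 2 * (z₀ ^ 2 * (K / φ z₀)) := by
  have hκ := S.hyp.jumpCoeff
  have hκ₁ := hκ.pos₁
  have hκ₂ := hκ.pos₂
  have hCη := hη.one_le
  have hB := symMarkov_exp_frozen S.levy hκ hε y hs
  set P := exp (s • genOp (frozenDensity κ J ε y) (integrable_frozenDensity S.levy hκ hε y))
    with hP
  set g := bumpZero hη hρ y with hg
  have hVi : ∀ z, Integrable (P (diffOp z g)) := fun z =>
    (hB.sym _ (integrable_diffOp_bumpZero hη hρ y z)).1
  have e : ∀ x z, P (diffOp z g) x = secondDiff (P g) x z := fun x z =>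
    (secondDiff_exp_frozen S.levy hκ hε y s g x z).symm
  have hcont : Continuous fun q : Euc d × Euc d => P (diffOp q.2 g) q.1 := by
    simp only [e, secondDiff]
    have := (P g).continuous
    fun_prop
  have hκm : ∀ z, Measurable fun x => κ x z := fun z =>
    (hκ.continuous_left z).measurable
  set F : Euc d × Euc d → ℝ := fun q =>
    (frozenDensity κ J ε y q.2 - κ q.1 q.2 * J ‖q.2‖) * P (diffOp q.2 g) q.1 with hF
  have hFm : AEStronglyMeasurable F (volume.prod volume) := by
    refine AEStronglyMeasurable.mul (AEStronglyMeasurable.sub ?_ ?_) hcont.aestronglyMeasurable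
    · exact (integrable_frozenDensity S.levy hκ hε y).1.comp_snd
    · exact (hκ.meas.mul (S.levy.meas.comp measurable_snd)).aestronglyMeasurable
  have hcoef : ∀ x z, z ≠ 0 → |frozenDensity κ J ε y z - κ x z * J ‖z‖| ≤ κ₁ * J ‖z‖ := by
    intro x z hz
    have hJz := S.levy.pos_J _ (norm_pos_iff.2 hz)
    have a1 := frozenDensity_nonneg S.levy hκ hε y z
    have a2 := frozenDensity_le S.levy hκ ε y hz
    have a3 : κ x z * J ‖z‖ ≤ κ₁ * J ‖z‖ := by gcongr; exact hκ.up x z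
    have a4 : 0 ≤ κ x z * J ‖z‖ := mul_nonneg (hκ.nonneg x z) hJz.le
    exact abs_le.2 ⟨by linarith, by linarith⟩
  set B : Euc d → ℝ := fun z => (κ₁ + κ₂) * (C * A * (min 1 ((‖z‖ / ψ) ^ (1 + α₂ / 2)) * J ‖z‖) +
      512 * (min 1 (‖z‖ ^ 2 / ℓ ^ 2) * J ‖z‖)) +
    κ₁ * Cη / ρ ^ 2 * (z₀ ^ 2 * (min 1 (‖z‖ ^ 2 / z₀ ^ 2) * J ‖z‖)) with hBdef
  have i1 := (hK' ψ hψ hψ1).1.const_mul (C * A)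
  have i2 := (S.levy.integrable ℓ hℓ hℓ1).const_mul 512
  have i3 := (S.levy.integrable z₀ hz₀ hz₀1).const_mul (z₀ ^ 2)
  have hBi : Integrable B := ((i1.add i2).const_mul (κ₁ + κ₂)).add (i3.const_mul _)
  have hBle : ∫ z, B z ≤ (κ₁ + κ₂) * (C * A * (K' / φ ψ) + 512 * (K / φ ℓ)) +
          κ₁ * Cη / ρ ^ 2 * (z₀ ^ 2 * (K / φ z₀)) := by
    have e1 := integral_add ((i1.add i2).const_mul (κ₁ + κ₂)) (i3.const_mul (κ₁ * Cη / ρ ^ 2))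
    simp only [Pi.add_apply] at e1
    rw [hBdef, e1, integral_const_mul, integral_add i1 i2, integral_const_mul, integral_const_mul,
      integral_const_mul, integral_const_mul]
    have := (hK' ψ hψ hψ1).2
    have := S.levy.bound ℓ hℓ hℓ1
    have := S.levy.bound z₀ hz₀ hz₀1
    gcongr
  have hne : ∀ᵐ z : Euc d, z ≠ 0 := Measure.ae_ne volume 0
  have hFi : ∀ᵐ z : Euc d, Integrable (fun x => F (x, z)) := by
    filter_upwards [hne] with z hz
    refine (hVi z).bdd_mul (c := κ₁ * J ‖z‖) ?_ (Eventually.of_forall fun x => by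
      rw [Real.norm_eq_abs]; exact hcoef x z hz)
    have hm : Measurable fun x => frozenDensity κ J ε y z - κ x z * J ‖z‖ :=
      measurable_const.sub ((hκm z).mul_const _)
    exact hm.aestronglyMeasurable
  have hFle : ∀ᵐ z : Euc d, ∫ x, |F (x, z)| ≤ B z := by
    filter_upwards [hne, hFi] with z hz hFz
    have hz0 := norm_pos_iff.2 hz
    have hJz := S.levy.pos_J _ hz0
    have m1 : 0 ≤ min 1 ((‖z‖ / ψ) ^ (1 + α₂ / 2)) := by positivity
    rcases lt_or_ge ‖z‖ z₀ with h | h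
    · calc ∫ x, |F (x, z)| ≤ ∫ x, κ₁ * J ‖z‖ * |P (diffOp z g) x| := by
            refine integral_mono hFz.abs ((hVi z).abs.const_mul _) fun x => ?_
            simp only [hF, abs_mul]
            gcongr
            exact hcoef x z hz
        _ ≤ κ₁ * J ‖z‖ * (Cη * (‖z‖ ^ 2 / ρ ^ 2)) := by
            rw [integral_const_mul]
            gcongr
            exact (hB.integral_abs_le (integrable_diffOp_bumpZero hη hρ y z)).trans
              (integral_abs_diffOp_bumpZero_le hη hρ y z).2
        _ = κ₁ * Cη / ρ ^ 2 * (z₀ ^ 2 * (min 1 (‖z‖ ^ 2 / z₀ ^ 2) * J ‖z‖)) := by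
            rw [min_eq_right]
            · field_simp
            · rw [div_le_one (by positivity)]; gcongr
        _ ≤ B z := le_add_of_nonneg_left (by positivity)
    · have hεz' : ε < ‖z‖ := by linarith
      calc ∫ x, |F (x, z)| ≤ ∫ x, (κ₁ + κ₂) * J ‖z‖ * ((ℓ ^ δ + (1 - cutoff ℓ y x)) *
            |P (diffOp z g) x|) := by
            refine integral_mono hFz.abs
              ((integral_add_cutoff_mul hℓ y _ (hVi z)).1.const_mul _) fun x => ?_
            simp only [hF, abs_mul, frozenDensity, if_pos hεz', ← sub_mul, abs_of_pos hJz]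
            calc _ ≤ (κ₁ + κ₂) * (ℓ ^ δ + (1 - cutoff ℓ y x)) * J ‖z‖ * |P (diffOp z g) x| := by
                  gcongr; exact hκ.abs_sub_le_weight hℓ x y z
              _ = _ := by ring
        _ ≤ (κ₁ + κ₂) * J ‖z‖ * (C * A * min 1 ((‖z‖ / ψ) ^ (1 + α₂ / 2)) +
            512 * min 1 (‖z‖ ^ 2 / ℓ ^ 2)) := by
            rw [integral_const_mul]
            gcongr
            exact hinc z (by linarith)
        _ = (κ₁ + κ₂) * (C * A * (min 1 ((‖z‖ / ψ) ^ (1 + α₂ / 2)) * J ‖z‖) +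
            512 * (min 1 (‖z‖ ^ 2 / ℓ ^ 2) * J ‖z‖)) := by ring
        _ ≤ B z := le_add_of_nonneg_right (by positivity)
  obtain ⟨-, c1, c2⟩ := integrable_integral_and_le hFm hFi hBi hFle
  exact ⟨c1, c2.trans hBle⟩

theorem HeatSetup.exists_error_bound
    (S : HeatSetup d φ J a₁ α₁ C₀ a b β κ κ₀ κ₁ κ₂ δ Φinv p K a₂ α₂) (hη : IsMollifier η Cη) :
    ∃ C γ s₁ : ℝ, 0 < C ∧ 0 < γ ∧ 0 < s₁ ∧ s₁ ≤ 1 ∧ √s₁ ≤ φ 1 ∧ ∀ σ, 0 < σ → ∀ ρ (hρ : 0 < ρ),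
      ρ ≤ phiInvGen φ (√σ) / 8 → ∀ ϵ, 0 < ϵ → ∃ ε, ∃ hε : 0 < ε, ∀ y s, σ ≤ s → s ≤ s₁ →
        ∀ v, v = exp (s • genOp (frozenDensity κ J ε y)
          (integrable_frozenDensity S.levy S.hyp.jumpCoeff hε y)) (bumpZero hη hρ y) →
        Integrable (fun x => genOp (frozenDensity κ J ε y)
          (integrable_frozenDensity S.levy S.hyp.jumpCoeff hε y) v x - jumpOp κ J v x) ∧
        ∫ x, |genOp (frozenDensity κ J ε y)
          (integrable_frozenDensity S.levy S.hyp.jumpCoeff hε y) v x - jumpOp κ J v x| ≤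
          C * s ^ (γ - 1) + ϵ := by
  have H := S.hyp
  have hκ := H.jumpCoeff
  have hκ₁ := hκ.pos₁
  have hκ₂ := hκ.pos₂
  have hCη := hη.one_le
  have hα₂ := S.α₂_lt
  have hα₂0 := S.α₂_pos
  have ha₂ := S.a₂_pos
  have hK := S.levy.pos_K
  have hφ1 := phi_pos H one_pos le_rfl
  obtain ⟨C₁, hC₁, hinc⟩ := S.exists_weighted_increment_le hη
  obtain ⟨K', hK'0, hK'⟩ := exists_fractional_moment H S.levy ha₂ (q := 1 + α₂ / 2) (by linarith)
    (by linarith) S.scal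
  obtain ⟨C₂, γ, hC₂, hγ, hscale⟩ := S.exists_scale_rpow_le
  refine ⟨(κ₁ + κ₂) * (C₁ * K' + 512 * K) * C₂, γ, min 1 (φ 1) ^ 2, by positivity, hγ,
    by positivity, ?_, ?_, ?_⟩
  · exact pow_le_one₀ (by positivity) (min_le_left _ _)
  · rw [Real.sqrt_sq (by positivity)]; exact min_le_right _ _
  intro σ hσ ρ hρ hρσ ϵ hϵ
  obtain ⟨z₀, hz₀, hz₀1, hz₀e⟩ := exists_rpow_le_of_pos (e := 2 - α₂)
    (c := ϵ * φ 1 * ρ ^ 2 / (κ₁ * Cη * K * a₂)) (by linarith) (by positivity)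
  refine ⟨z₀ / 64, by positivity, fun y s hσs hs₁ v hv => ?_⟩
  have hs : 0 < s := hσ.trans_le hσs
  have hsφ : √s ≤ φ 1 := by
    calc √s ≤ √(min 1 (φ 1) ^ 2) := Real.sqrt_le_sqrt hs₁
      _ ≤ φ 1 := by rw [Real.sqrt_sq (by positivity)]; exact min_le_right _ _
  have hs1 : s ≤ 1 := hs₁.trans (pow_le_one₀ (by positivity) (min_le_left _ _))
  have hsq := Real.sqrt_pos.2 hs
  have hsle : s ≤ √s := by
    have h1 : √s ≤ 1 := Real.sqrt_le_one.2 hs1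
    nlinarith [Real.mul_self_sqrt hs.le]
  obtain ⟨hψ0, hψ1, hψ⟩ := phiInvGen_spec H hs
  obtain ⟨hℓ0, hℓ1, hℓ⟩ := phiInvGen_spec H hsq
  rw [min_eq_left (hsle.trans hsφ)] at hψ
  rw [min_eq_left hsφ] at hℓ
  have hρs : ρ ≤ phiInvGen φ (√s) / 8 := by
    have := phiInvGen_mono H (Real.sqrt_pos.2 hσ) (Real.sqrt_le_sqrt hσs)
    linarith
  have hℓδ := Real.rpow_pos_of_pos hℓ0 δ
  obtain ⟨c1, c2⟩ := S.integral_abs_error_le hη hK' hs.le hρ hz₀ hz₀1 (by positivity : 0 < z₀ / 64)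
    (by linarith) hℓ0 hℓ1 hψ0 hψ1 hC₁.le (by positivity : 0 ≤ phiInvGen φ (√s) ^ δ + √s) y
    (hinc s hs hs1 hsφ ρ hρ hρs _ (by positivity) y)
  obtain ⟨N, -, hN⟩ := exists_secondDiffBound_bumpZero hη hρ
  have hvN := secondDiffBound_exp_frozen S.levy hκ (by positivity : 0 < z₀ / 64) y hs.le (hN y)
  rw [← hv] at hvN
  have herr := genOp_sub_jumpOp_eq S.levy hκ (integrable_frozenDensity S.levy hκ
    (by positivity : 0 < z₀ / 64) y) (frozenDensity_neg hκ _ y) hvN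
  simp only [herr]
  have hsd : ∀ x z, exp (s • genOp (frozenDensity κ J (z₀ / 64) y) (integrable_frozenDensity
      S.levy hκ (by positivity : 0 < z₀ / 64) y)) (diffOp z (bumpZero hη hρ y)) x =
      secondDiff v x z := fun x z => by
    rw [hv, secondDiff_exp_frozen S.levy hκ (by positivity : 0 < z₀ / 64)]
  simp only [hsd] at c1 c2
  refine ⟨c1.const_mul _, ?_⟩
  simp only [abs_mul, abs_of_pos (by norm_num : (0:ℝ) < 1 / 2)]
  rw [integral_const_mul]
  have hsc := hscale s hs hs1 hsφ
  have hmain : (κ₁ + κ₂) * (C₁ * (phiInvGen φ (√s) ^ δ + √s) * (K' / φ (phiInvGen φ s)) +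
      512 * (K / φ (phiInvGen φ (√s)))) ≤
      (κ₁ + κ₂) * (C₁ * K' + 512 * K) * C₂ * s ^ (γ - 1) := by
    rw [hψ, hℓ, Real.rpow_sub hs, Real.rpow_one]
    have e1 : K / √s = K * √s / s := by
      nth_rewrite 3 [← Real.mul_self_sqrt hs.le]
      field_simp
    have e2 : √s ≤ C₂ * s ^ γ := by linarith
    rw [e1]
    calc _ ≤ (κ₁ + κ₂) * (C₁ * (C₂ * s ^ γ) * (K' / s) + 512 * (K * (C₂ * s ^ γ) / s)) := by
          gcongr
      _ = _ := by ring
  have hsmall : κ₁ * Cη / ρ ^ 2 * (z₀ ^ 2 * (K / φ z₀)) ≤ ϵ := by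
    have hφz := phi_pos H hz₀ hz₀1
    have hus := phi_upper_scaling H S.scal hz₀ hz₀1 le_rfl
    rw [Real.div_rpow zero_le_one hz₀.le, Real.one_rpow] at hus
    have hzα := Real.rpow_pos_of_pos hz₀ α₂
    have h1 : z₀ ^ 2 / φ z₀ ≤ a₂ / φ 1 * z₀ ^ (2 - α₂) := by
      rw [Real.rpow_sub hz₀, show (2:ℝ) = ((2:ℕ):ℝ) by norm_num, Real.rpow_natCast,
        div_le_iff₀ hφz]
      calc z₀ ^ 2 = z₀ ^ 2 / φ 1 * φ 1 := by field_simp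
        _ ≤ z₀ ^ 2 / φ 1 * (a₂ * (1 / z₀ ^ α₂) * φ z₀) := by gcongr
        _ = _ := by ring
    calc _ = κ₁ * Cη * K / ρ ^ 2 * (z₀ ^ 2 / φ z₀) := by ring
      _ ≤ κ₁ * Cη * K / ρ ^ 2 * (a₂ / φ 1 * (ϵ * φ 1 * ρ ^ 2 / (κ₁ * Cη * K * a₂))) := by
          gcongr
          exact h1.trans (by gcongr)
      _ = ϵ := by field_simp
  have h0 : 0 ≤ (κ₁ + κ₂) * (C₁ * K' + 512 * K) * C₂ * s ^ (γ - 1) := by positivity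
  linarith

end FreezingError

section Duhamel

set_option linter.unusedSectionVars false

variable {d : ℕ} {φ J : ℝ → ℝ} {a₁ α₁ C₀ a b β κ₀ κ₁ κ₂ δ K a₂ α₂ : ℝ}
  {κ : Euc d → Euc d → ℝ} {Φinv : ℝ → ℝ} {p : ℝ → Euc d → Euc d → ℝ}
  [Nonempty (Fin d)] {V V' : ℝ → CZero d} {χ : CZero d} {σ e N C : ℝ} {h : ℝ → ℝ}

theorem HeatSetup.heatOp_sub
    (S : HeatSetup d φ J a₁ α₁ C₀ a b β κ κ₀ κ₁ κ₂ δ Φinv p K a₂ α₂) {t : ℝ} (ht : 0 < t)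
    (f g : CZero d) (x : Euc d) :
    heatOp p t f x - heatOp p t g x = heatOp p t (f - g : CZero d) x := by
  have hf := (S.admissible f.continuous f.zero).integrable S.ker ht x
  have hg := (S.admissible g.continuous g.zero).integrable S.ker ht x
  simp only [heatOp, CZero.sub_apply, mul_sub]
  exact (integral_sub hf hg).symm

theorem HeatSetup.abs_heatOp_le_norm
    (S : HeatSetup d φ J a₁ α₁ C₀ a b β κ κ₀ κ₁ κ₂ δ Φinv p K a₂ α₂) {t : ℝ} (ht : 0 < t)
    (f : CZero d) (x : Euc d) : |heatOp p t f x| ≤ ‖f‖ :=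
  S.abs_heatOp_le ht f.continuous f.zero f.abs_apply_le x

theorem HeatSetup.abs_evol_sub_le
    (S : HeatSetup d φ J a₁ α₁ C₀ a b β κ κ₀ κ₁ κ₂ δ Φinv p K a₂ α₂) (t : ℝ)
    (f g : CZero d) (x : Euc d) : |evol p f t x - evol p g t x| ≤ ‖f - g‖ := by
  rcases le_or_gt t 0 with ht | ht
  · simpa [evol, ht] using (f - g).abs_apply_le x
  · rw [evol_of_pos ht, evol_of_pos ht, S.heatOp_sub ht]
    exact S.abs_heatOp_le_norm ht _ x

theorem HeatSetup.continuous_evol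
    (S : HeatSetup d φ J a₁ α₁ C₀ a b β κ κ₀ κ₁ κ₂ δ Φinv p K a₂ α₂) (f : CZero d) (t : ℝ) :
    Continuous (evol p f t) := by
  rcases le_or_gt t 0 with ht | ht
  · simpa [evol, ht] using f.continuous
  · rw [evol_of_pos ht]
    exact (S.admissible f.continuous f.zero).continuous_heatOp S.ker ht

theorem HeatSetup.continuousOn_integral_evol
    (S : HeatSetup d φ J a₁ α₁ C₀ a b β κ κ₀ κ₁ κ₂ δ Φinv p K a₂ α₂)
    (hχs : HasCompactSupport χ) (hV : ∀ s ∈ Icc σ e, HasDerivAt V (V' s) s) :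
    ContinuousOn (fun s => ∫ x, χ x * evol p (V s) (e - s) x) (Icc σ e) := by
  have hχi : Integrable χ := χ.continuous.integrable_of_hasCompactSupport hχs
  have hInt : ∀ f : Euc d → ℝ, Continuous f → Integrable fun x => χ x * f x := fun f hf =>
    (χ.continuous.mul hf).integrable_of_hasCompactSupport hχs.mul_right
  intro s hs
  rw [ContinuousWithinAt, Metric.tendsto_nhds]
  intro ω hω
  set I := ∫ x, |χ x| with hI
  have hI0 : 0 ≤ I := integral_nonneg fun x => abs_nonneg _
  obtain ⟨η, hη, hηI⟩ : ∃ η : ℝ, 0 < η ∧ (η + η) * I < ω := by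
    refine ⟨ω / (4 * (I + 1)), by positivity, ?_⟩
    rw [← add_div, div_mul_eq_mul_div, div_lt_iff₀ (by positivity)]
    nlinarith
  have hsol := ((S.admissible (V s).continuous (V s).zero).isHeatSol S.hyp S.inv S.ker S.levy
    (e - σ)).time (e - s) ⟨by linarith [hs.2], by linarith [hs.1]⟩ η hη
  have hmap : Tendsto (fun s' => e - s') (nhdsWithin s (Icc σ e))
      (nhdsWithin (e - s) (Icc 0 (e - σ))) := by
    refine tendsto_nhdsWithin_iff.2 ⟨?_, ?_⟩
    · exact ((continuous_const.sub continuous_id).tendsto s).mono_left nhdsWithin_le_nhds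
    · filter_upwards [self_mem_nhdsWithin] with s' hs'
      exact ⟨by linarith [hs'.2], by linarith [hs'.1]⟩
  have hcV : ∀ᶠ s' in nhdsWithin s (Icc σ e), ‖V s' - V s‖ < η := by
    have := (hV s hs).continuousAt.eventually (Metric.ball_mem_nhds (V s) hη)
    filter_upwards [mem_nhdsWithin_of_mem_nhds this] with s' hs'
    rwa [← dist_eq_norm]
  filter_upwards [hmap.eventually hsol, hcV] with s' h1 h2
  rw [Real.dist_eq, ← integral_sub (hInt _ (S.continuous_evol _ _)) (hInt _ (S.continuous_evol _ _))]
  rw [hI, ← integral_const_mul] at hηI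
  rw [← Real.norm_eq_abs]
  refine lt_of_le_of_lt (norm_integral_le_of_norm_le (hχi.abs.const_mul (η + η))
    (Eventually.of_forall fun x => ?_)) hηI
  rw [← mul_sub, Real.norm_eq_abs, abs_mul, mul_comm]
  gcongr
  have h3 := S.abs_evol_sub_le (e - s') (V s') (V s) x
  have h4 := abs_sub_le (evol p (V s') (e - s') x) (evol p (V s) (e - s') x) (evol p (V s) (e - s) x)
  linarith [h1 x]

theorem HeatSetup.exists_integral_evol_sub_le
    (S : HeatSetup d φ J a₁ α₁ C₀ a b β κ κ₀ κ₁ κ₂ δ Φinv p K a₂ α₂)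
    (hχs : HasCompactSupport χ) (hχ0 : ∀ x, 0 ≤ χ x) (hχ1 : ∀ x, χ x ≤ 1)
    {s : ℝ} (hs : s ∈ Ico σ e) (hV : HasDerivAt V (V' s) s) (hN : SecondDiffBound (V s) N 1)
    {h : ℝ} (hi : Integrable fun x => V' s x - jumpOp κ J (V s) x)
    (hle : ∫ x, |V' s x - jumpOp κ J (V s) x| ≤ h) (hC0 : 0 ≤ C)
    (hC : ∀ t, 0 < t → t ≤ e - σ → ∀ f : Euc d → ℝ, Integrable f →
      Integrable (heatOp p t f) ∧ ∫ x, |heatOp p t f x| ≤ C * ∫ x, |f x|)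
    {ω : ℝ} (hω : 0 < ω) : ∀ᶠ s' in nhdsWithin s (Ioi s),
      (∫ x, χ x * evol p (V s') (e - s') x) - ∫ x, χ x * evol p (V s) (e - s) x ≤
        (C * h + ω) * (s' - s) := by
  have hκ := S.hyp.jumpCoeff
  have hχi : Integrable χ := χ.continuous.integrable_of_hasCompactSupport hχs
  have hInt : ∀ f : Euc d → ℝ, Continuous f → Integrable fun x => χ x * f x := fun f hf =>
    (χ.continuous.mul hf).integrable_of_hasCompactSupport hχs.mul_right
  set I := ∫ x, χ x with hI
  have hI0 : 0 ≤ I := integral_nonneg hχ0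
  obtain ⟨η, hη, hηI⟩ : ∃ η : ℝ, 0 < η ∧ (η + η) * I ≤ ω := by
    refine ⟨ω / (4 * (I + 1)), by positivity, ?_⟩
    rw [← add_div, div_mul_eq_mul_div, div_le_iff₀ (by positivity)]
    nlinarith
  set w : CZero d := V' s - CZero.mk (jumpOp κ J (V s))
    (continuous_jumpOp S.levy hκ (V s).continuous one_pos le_rfl hN)
    (tendsto_jumpOp_cocompact S.levy hκ (V s).continuous (V s).zero one_pos le_rfl hN) with hw
  have hwx : ∀ x, w x = V' s x - jumpOp κ J (V s) x := fun x => rfl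
  obtain ⟨τ₀, hτ₀, hgen⟩ := S.exists_abs_heatOp_sub_le (V s).continuous (V s).zero one_pos le_rfl hN
    hη
  have hVd := (hasDerivAt_iff_isLittleO.1 hV).def hη
  have e1 : ∀ᶠ s' in nhdsWithin s (Ioi s), s' ∈ Ioo s (min e (s + τ₀)) :=
    Ioo_mem_nhdsGT (lt_min hs.2 (by linarith))
  filter_upwards [e1, mem_nhdsWithin_of_mem_nhds hVd] with s' hs' hd
  have hτ : 0 < s' - s := sub_pos.2 hs'.1
  have hse : s' < e := hs'.2.trans_le (min_le_left _ _)
  have hsτ : s' - s ≤ τ₀ := by linarith [hs'.2.trans_le (min_le_right e (s + τ₀))]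
  have ht' : 0 < e - s' := sub_pos.2 hse
  rw [Real.norm_of_nonneg hτ.le] at hd
  have hadm := S.admissible (V s).continuous (V s).zero
  set P : CZero d := CZero.mk (heatOp p (s' - s) (V s)) (hadm.continuous_heatOp S.ker hτ)
    (hadm.tendsto_heatOp S.hyp S.ker hτ) with hP
  have hsemi : heatOp p (e - s) (V s) = heatOp p (e - s') P := by
    rw [show e - s = (s' - s) + (e - s') by ring]
    exact S.heatOp_add hτ ht' (V s).continuous (V s).zero
  have hrest : ‖V s' - P - (s' - s) • w‖ ≤ (η + η) * (s' - s) := by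
    refine (CZero.norm_le (by positivity)).2 fun x => ?_
    have a1 := hgen (s' - s) ⟨hτ, hsτ⟩ x
    have a2 := ((V s' - V s - (s' - s) • V' s).abs_apply_le x).trans hd
    simp only [CZero.sub_apply, CZero.smul_apply, hwx, hP, CZero.mk_apply] at a2 ⊢
    rw [abs_le] at *
    constructor <;> linarith [a1.1, a1.2, a2.1, a2.2]
  have hwi : Integrable w := hi
  obtain ⟨hPw, hPw'⟩ := hC (e - s') ht' (by linarith [hs.1]) w hwi
  rw [evol_of_pos ht', evol_of_pos (sub_pos.2 hs.2), hsemi,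
    ← integral_sub (hInt _ ((S.admissible (V s').continuous (V s').zero).continuous_heatOp S.ker ht'))
      (hInt _ ((S.admissible P.continuous P.zero).continuous_heatOp S.ker ht'))]
  have hpt : ∀ x, χ x * heatOp p (e - s') (V s') x - χ x * heatOp p (e - s') P x ≤
      (s' - s) * |heatOp p (e - s') w x| + (η + η) * (s' - s) * χ x := by
    intro x
    have b1 := (abs_le.1 (S.abs_heatOp_le_norm ht' (V s' - P - (s' - s) • w) x)).2
    have b2 : heatOp p (e - s') ((s' - s) • w : CZero d) x = (s' - s) * heatOp p (e - s') w x := by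
      simp only [heatOp, CZero.smul_apply]
      rw [← integral_const_mul]
      congr 1; ext; ring
    rw [← S.heatOp_sub ht', b2, ← S.heatOp_sub ht'] at b1
    have b3 : χ x * ((s' - s) * heatOp p (e - s') w x) ≤ 1 * ((s' - s) * |heatOp p (e - s') w x|) := by
      refine mul_le_mul_of_nonneg (hχ1 x) ?_ (hχ0 x) (by positivity)
      exact mul_le_mul_of_nonneg_left (le_abs_self _) hτ.le
    have b4 := mul_le_mul_of_nonneg_left (b1.trans hrest) (hχ0 x)
    linarith
  refine (integral_mono ((hInt _ ((S.admissible (V s').continuous (V s').zero).continuous_heatOp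
    S.ker ht')).sub (hInt _ ((S.admissible P.continuous P.zero).continuous_heatOp S.ker ht')))
    ((hPw.abs.const_mul _).add (hχi.const_mul _)) hpt).trans ?_
  have e2 := integral_add (hPw.abs.const_mul (s' - s)) (hχi.const_mul ((η + η) * (s' - s)))
  simp only [Pi.add_apply] at e2 ⊢
  rw [e2, integral_const_mul, integral_const_mul]
  have c1 : ∫ x, |heatOp p (e - s') w x| ≤ C * h :=
    hPw'.trans (mul_le_mul_of_nonneg_left hle hC0)
  calc (s' - s) * (∫ x, |heatOp p (e - s') w x|) + (η + η) * (s' - s) * I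
      ≤ (s' - s) * (C * h) + (s' - s) * ω := by
        refine add_le_add (mul_le_mul_of_nonneg_left c1 hτ.le) ?_
        calc (η + η) * (s' - s) * I = (s' - s) * ((η + η) * I) := by ring
          _ ≤ _ := mul_le_mul_of_nonneg_left hηI hτ.le
    _ = _ := by ring

/-- Perturbation estimate comparing a curve `V` with the heat semigroup run from `V σ`. -/
theorem HeatSetup.integral_sub_heatOp_le
    (S : HeatSetup d φ J a₁ α₁ C₀ a b β κ κ₀ κ₁ κ₂ δ Φinv p K a₂ α₂)
    (hχs : HasCompactSupport χ) (hχ0 : ∀ x, 0 ≤ χ x) (hχ1 : ∀ x, χ x ≤ 1) (hσe : σ < e)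
    (hV : ∀ s ∈ Icc σ e, HasDerivAt V (V' s) s)
    (hN : ∀ s ∈ Icc σ e, SecondDiffBound (V s) N 1)
    (hi : ∀ s ∈ Icc σ e, (Integrable fun x => V' s x - jumpOp κ J (V s) x) ∧
      ∫ x, |V' s x - jumpOp κ J (V s) x| ≤ h s) (hC0 : 0 ≤ C)
    (hC : ∀ t, 0 < t → t ≤ e - σ → ∀ f : Euc d → ℝ, Integrable f →
      Integrable (heatOp p t f) ∧ ∫ x, |heatOp p t f x| ≤ C * ∫ x, |f x|)
    {B B' : ℝ → ℝ} (hB : ∀ s ∈ Icc σ e, HasDerivAt B (B' s) s)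
    (hB' : ∀ s ∈ Icc σ e, C * h s < B' s) :
    (∫ x, χ x * V e x) - ∫ x, χ x * heatOp p (e - σ) (V σ) x ≤ B e - B σ := by
  set G : ℝ → ℝ := fun s => ∫ x, χ x * evol p (V s) (e - s) x with hG
  have hGe : G e = ∫ x, χ x * V e x := by simp [hG, evol_zero]
  have hGσ : G σ = ∫ x, χ x * heatOp p (e - σ) (V σ) x := by
    simp only [hG, evol_of_pos (sub_pos.2 hσe)]
  have hBc : ContinuousOn B (Icc σ e) := fun s hs => (hB s hs).continuousAt.continuousWithinAt
  have key := image_le_of_liminf_slope_right_lt_deriv_boundary' (f := G) (f' := fun s => C * h s)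
    (B := fun s => G σ + (B s - B σ)) (B' := B') (S.continuousOn_integral_evol hχs hV)
    (fun s hs r hr => ?_) (by simp) (continuousOn_const.add (hBc.sub continuousOn_const))
    (fun s hs => (((hB s (Ico_subset_Icc_self hs)).sub_const _).const_add _).hasDerivWithinAt)
    (fun s hs _ => hB' s (Ico_subset_Icc_self hs)) (right_mem_Icc.2 hσe.le)
  · rw [← hGe, ← hGσ]; linarith
  · have hs' := Ico_subset_Icc_self hs
    have h1 := S.exists_integral_evol_sub_le hχs hχ0 hχ1 hs (hV s hs') (hN s hs') (hi s hs').1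
      (hi s hs').2 hC0 hC (half_pos (sub_pos.2 hr))
    refine Eventually.frequently ?_
    filter_upwards [h1, self_mem_nhdsWithin] with z hz hzs
    have hzs' : 0 < z - s := sub_pos.2 hzs
    rw [slope_def_field, div_lt_iff₀ hzs']
    refine lt_of_le_of_lt hz (mul_lt_mul_of_pos_right ?_ hzs')
    linarith

end Duhamel

section MassLowerBound

open NormedSpace

set_option linter.unusedSectionVars false

variable {d : ℕ} {φ J : ℝ → ℝ} {a₁ α₁ C₀ a b β κ₀ κ₁ κ₂ δ K a₂ α₂ : ℝ}
  {κ : Euc d → Euc d → ℝ} {Φinv : ℝ → ℝ} {p : ℝ → Euc d → Euc d → ℝ}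
  [Nonempty (Fin d)]

theorem hasDerivAt_exp_smul_apply (A : CZero d →L[ℝ] CZero d) (g : CZero d) (s : ℝ) :
    HasDerivAt (fun u : ℝ => exp (u • A) g) (A (exp (s • A) g)) s := by
  have h := (hasDerivAt_exp_smul_const' A s).clm_apply (hasDerivAt_const s g)
  simpa using h

/-- Starting from an almost point mass at `y`, the heat flow keeps a quarter of the mass within
a fixed multiple of the intrinsic length scale. -/
theorem HeatSetup.exists_mass_lower_bound
    (S : HeatSetup d φ J a₁ α₁ C₀ a b β κ κ₀ κ₁ κ₂ δ Φinv p K a₂ α₂) :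
    ∃ t₀ M : ℝ, 0 < t₀ ∧ t₀ ≤ 1 ∧ t₀ ≤ φ 1 ∧ 1 ≤ M ∧ ∀ t, 0 < t → t ≤ t₀ →
      (M + 6) * phiInvGen φ t ≤ 1 ∧ ∀ y : Euc d, ∀ ω r : ℝ, 0 < ω → 0 < r → r ≤ 1 →
        ∃ f : CZero d, (∀ x, 0 ≤ f x) ∧ Integrable f ∧ ∫ x, f x ≤ 1 ∧
          ∫ x, (1 - cutoff r y x) * f x ≤ ω ∧ ∀ t', t / 2 ≤ t' → t' ≤ t →
            1 / 4 ≤ ∫ x, cutoff (M * phiInvGen φ t) y x * heatOp p t' f x := by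
  have H := S.hyp
  have hκ := H.jumpCoeff
  have hκ₁ := hκ.pos₁
  have hK := S.levy.pos_K
  have ha₁ := H.a₁_pos
  have hα₁ := H.α₁_pos
  obtain ⟨η, Cη, hη⟩ := exists_isMollifier d
  obtain ⟨Mc, hMc, hcut⟩ := exists_cutoff_secondDiffBound d
  obtain ⟨Cc, γ, s₁, hCc, hγ, hs₁, hs₁1, -, herr⟩ := S.exists_error_bound hη
  obtain ⟨CL, hCL, hL1⟩ := S.exists_L1_bound 1 le_rfl
  set M : ℝ := max 1 ((8 * (κ₁ * Mc * K) / a₁) ^ α₁⁻¹) with hMdef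
  have hM1 : 1 ≤ M := le_max_left _ _
  have hM0 : 0 < M := one_pos.trans_le hM1
  have hMα : 8 * (κ₁ * Mc * K) ≤ a₁ * M ^ α₁ := by
    have : ((8 * (κ₁ * Mc * K) / a₁) ^ α₁⁻¹) ^ α₁ ≤ M ^ α₁ :=
      Real.rpow_le_rpow (by positivity) (le_max_right _ _) hα₁.le
    rw [Real.rpow_inv_rpow (by positivity) hα₁.ne', div_le_iff₀ ha₁] at this
    linarith
  obtain ⟨z, hz0, hz1, hzγ⟩ := exists_rpow_le_of_pos (e := γ) (c := γ / (4 * CL * Cc)) hγ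
    (by positivity)
  have hR0 : 0 < (M + 6)⁻¹ := by positivity
  have hR1 : (M + 6)⁻¹ ≤ 1 := inv_le_one_of_one_le₀ (by linarith)
  have hφR := phi_pos H hR0 hR1
  set t₀ := min (min (z / 2) (s₁ / 2)) (φ (M + 6)⁻¹) with ht₀def
  have ht₀ : 0 < t₀ := by positivity
  have ht₀z : t₀ ≤ z / 2 := (min_le_left _ _).trans (min_le_left _ _)
  have ht₀s : t₀ ≤ s₁ / 2 := (min_le_left _ _).trans (min_le_right _ _)
  have ht₀R : t₀ ≤ φ (M + 6)⁻¹ := min_le_right _ _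
  have ht₀φ : t₀ ≤ φ 1 := ht₀R.trans (phi_le_phi H hR0.le hR1 le_rfl)
  refine ⟨t₀, M, ht₀, by linarith, ht₀φ, hM1, fun t ht htt => ?_⟩
  obtain ⟨hψ0, hψ1, hψ⟩ := phiInvGen_spec H ht
  rw [min_eq_left (htt.trans ht₀φ)] at hψ
  have hψR := phiInvGen_le_of_le H ht hR0 hR1 (htt.trans ht₀R)
  have hM6 : (M + 6) * phiInvGen φ t ≤ 1 := by
    calc (M + 6) * phiInvGen φ t ≤ (M + 6) * (M + 6)⁻¹ := by gcongr
      _ = 1 := mul_inv_cancel₀ (by positivity)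
  refine ⟨hM6, fun y ω r hω hr hr1 => ?_⟩
  set ψ := phiInvGen φ t with hψdef
  have hℓ0 : 0 < M * ψ := by positivity
  have hℓ1 : M * ψ ≤ 1 := by nlinarith
  have hφℓ : a₁ * M ^ α₁ * t ≤ φ (M * ψ) := by
    have := phi_lower_scaling H hψ0 (by nlinarith : ψ ≤ M * ψ) hℓ1
    rwa [mul_div_cancel_right₀ _ hψ0.ne', hψ] at this
  have hφr := phi_pos H hr hr1
  set σ := min t (ω * φ r / (κ₁ * Mc * K)) with hσdef
  have hσ : 0 < σ := by positivity
  have hσt : σ ≤ t := min_le_left _ _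
  obtain ⟨hs0, -, -⟩ := phiInvGen_spec H (Real.sqrt_pos.2 hσ)
  set ρ := min (phiInvGen φ (√σ) / 8) (min (r / 2) (M * ψ / 2)) with hρdef
  have hρ : 0 < ρ := by positivity
  obtain ⟨ε, hε, herr⟩ := herr σ hσ ρ hρ (min_le_left _ _) (1 / (4 * (CL + 1))) (by positivity)
  set A := genOp (frozenDensity κ J ε y) (integrable_frozenDensity S.levy hκ hε y) with hA
  set g := bumpZero hη hρ y with hg
  have hgi : Integrable g := integrable_bumpZero hη hρ y
  have hg0 : ∀ x, 0 ≤ g x := fun x => hη.nonneg hρ _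
  have hgs : ∀ x, g x ≠ 0 → ‖x - y‖ ≤ ρ := fun x hx => (hη.supp hρ _ hx).2
  have hmk := symMarkov_exp_frozen S.levy hκ hε y hσ.le
  have hf0 : ∀ x, 0 ≤ exp (σ • A) g x := hmk.pos g hg0
  have hfi : Integrable (exp (σ • A) g) := (hmk.sym g hgi).1
  obtain ⟨N, -, hN⟩ := exists_secondDiffBound_bumpZero hη hρ
  refine ⟨exp (σ • A) g, hf0, hfi, ?_, ?_, fun t' ht't ht' => ?_⟩
  · have := hmk.integral_abs_le hgi
    rw [integral_abs_bumpZero, ← hA] at this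
    simpa only [abs_of_nonneg (hf0 _)] using this
  · have := exp_frozen_weighted S.levy hκ hcut hε hr hr1 hσ.le le_rfl y hgi fun x hx =>
      (hgs x hx).trans ((min_le_right _ _).trans (min_le_left _ _))
    rw [integral_abs_bumpZero, ← hA] at this
    simp only [zero_add, abs_of_nonneg (hf0 _)] at this
    refine this.trans ?_
    calc σ * (κ₁ * Mc * (K / φ r)) * 1
        ≤ ω * φ r / (κ₁ * Mc * K) * (κ₁ * Mc * (K / φ r)) * 1 := by
          gcongr
          exact min_le_right _ _
      _ = ω := by field_simp
  have ht'0 : 0 < t' := by linarith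
  set e := t' + σ with he
  have hσe : σ < e := by linarith
  have he2 : e ≤ 2 * t₀ := by linarith
  have hB : ∀ s ∈ Icc σ e, HasDerivAt (fun s : ℝ => CL * (Cc * (s ^ γ / γ) +
      1 / (4 * (CL + 1)) * s) + 1 / (4 * (CL + 1)) * s)
      (CL * (Cc * s ^ (γ - 1) + 1 / (4 * (CL + 1))) + 1 / (4 * (CL + 1))) s := by
    intro s hs
    have h1 := (Real.hasDerivAt_rpow_const (x := s) (p := γ)
      (Or.inl (hσ.trans_le hs.1).ne')).div_const γ
    have h2 := (hasDerivAt_id' s).const_mul (1 / (4 * (CL + 1)))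
    refine ((((h1.const_mul Cc).add h2).const_mul CL).add h2).congr_deriv ?_
    field_simp
  have hdu := S.integral_sub_heatOp_le (χ := cutoffZero hℓ0 y) (V := fun s => exp (s • A) g)
    (V' := fun s => A (exp (s • A) g)) (N := N) (C := CL)
    (h := fun s => Cc * s ^ (γ - 1) + 1 / (4 * (CL + 1))) (hasCompactSupport_cutoff hℓ0 y)
    (cutoff_nonneg _ y) (cutoff_le_one _ y) hσe (fun s _ => hasDerivAt_exp_smul_apply A g s)
    (fun s hs => secondDiffBound_exp_frozen S.levy hκ hε y (hσ.le.trans hs.1) (hN y))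
    (fun s hs => herr y s hs.1 (by linarith [hs.2]) _ rfl) hCL.le
    (fun u hu hu' => hL1 u hu (by linarith)) hB
    (fun s _ => lt_add_of_pos_right _ (by positivity))
  simp only [cutoffZero_apply, he, add_sub_cancel_right] at hdu
  rw [← he] at hdu
  have hsym := ((symMarkov_exp_frozen S.levy hκ hε y (hσ.le.trans hσe.le)).sym g hgi).2
    (cutoffZero hℓ0 y)
  simp only [cutoffZero_apply] at hsym
  have hcl := norm_exp_frozen_cutoff_sub_le S.levy hκ hcut hε hℓ0 hℓ1 (hσ.le.trans hσe.le) y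
  have hquarter : e * (κ₁ * Mc * (K / φ (M * ψ))) ≤ 1 / 4 := by
    have hp0 : 0 < φ (M * ψ) := phi_pos H hℓ0 hℓ1
    have : e * (κ₁ * Mc * (K / φ (M * ψ))) = e * (κ₁ * Mc * K) / φ (M * ψ) := by ring
    rw [this, div_le_iff₀ hp0]
    calc e * (κ₁ * Mc * K) ≤ (2 * t) * (κ₁ * Mc * K) := by
          gcongr
          linarith
      _ = 1 / 4 * (8 * (κ₁ * Mc * K) * t) := by ring
      _ ≤ 1 / 4 * (a₁ * M ^ α₁ * t) := by gcongr
      _ ≤ 1 / 4 * φ (M * ψ) := by gcongr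
  have hmass : 3 / 4 ≤ ∫ x, cutoff (M * ψ) y x * exp (e • A) g x := by
    rw [hsym]
    have hle : ∀ x, 3 / 4 * g x ≤ exp (e • A) (cutoffZero hℓ0 y) x * g x := by
      intro x
      by_cases hx : g x = 0
      · simp [hx]
      · refine mul_le_mul_of_nonneg_right ?_ (hg0 x)
        have h1 := (CZero.abs_apply_le _ x).trans (hcl.trans hquarter)
        simp only [CZero.sub_apply, cutoffZero_apply] at h1
        rw [cutoff_eq_one hℓ0 ((hgs x hx).trans ((min_le_right _ _).trans (min_le_right _ _)))] at h1
        linarith [(abs_le.1 h1).1]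
    have := integral_mono (hgi.const_mul (3 / 4)) (CZero.integrable_mul _ hgi) hle
    rwa [integral_const_mul, integral_bumpZero, mul_one] at this
  have hBe : CL * (Cc * (e ^ γ / γ) + 1 / (4 * (CL + 1)) * e) + 1 / (4 * (CL + 1)) * e -
      (CL * (Cc * (σ ^ γ / γ) + 1 / (4 * (CL + 1)) * σ) + 1 / (4 * (CL + 1)) * σ) ≤ 1 / 2 := by
    have hez : e ^ γ ≤ γ / (4 * CL * Cc) :=
      (Real.rpow_le_rpow (by linarith) (by linarith) hγ.le).trans hzγ
    have h1 : CL * (Cc * (e ^ γ / γ)) ≤ 1 / 4 := by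
      calc CL * (Cc * (e ^ γ / γ)) ≤ CL * (Cc * (γ / (4 * CL * Cc) / γ)) := by gcongr
        _ = 1 / 4 := by field_simp
    have h2 : 0 ≤ CL * (Cc * (σ ^ γ / γ)) := by positivity
    have h3 : CL * (1 / (4 * (CL + 1)) * e) + 1 / (4 * (CL + 1)) * e = e / 4 := by
      field_simp
    have h4 : 0 ≤ CL * (1 / (4 * (CL + 1)) * σ) + 1 / (4 * (CL + 1)) * σ := by positivity
    have h5 : e ≤ 1 := by linarith
    linarith
  linarith

end MassLowerBound

section Growth

set_option linter.unusedSectionVars false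

variable {d : ℕ} {φ J : ℝ → ℝ} {κ₀ κ₁ κ₂ δ K T M : ℝ} {κ : Euc d → Euc d → ℝ}
  {u : ℝ → Euc d → ℝ} [Nonempty (Fin d)] {f ξ : Euc d → ℝ}

theorem tendsto_setIntegral_lt_norm {g : Euc d → ℝ} (hg : Integrable g) :
    Tendsto (fun ε : ℝ => ∫ z in {z : Euc d | ε < ‖z‖}, g z) (nhdsWithin 0 (Ioi 0))
      (nhds (∫ z, g z)) := by
  simp only [← integral_indicator (measurableSet_lt_norm _)]
  refine tendsto_integral_filter_of_dominated_convergence (fun z => ‖g z‖) ?_ ?_ hg.norm ?_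
  · exact Eventually.of_forall fun ε => hg.aestronglyMeasurable.indicator (measurableSet_lt_norm ε)
  · exact Eventually.of_forall fun ε => Eventually.of_forall fun z =>
      norm_indicator_le_norm_self _ _
  · have : ∀ᵐ z : Euc d, z ≠ 0 := by simp [ae_iff]
    filter_upwards [this] with z hz
    refine tendsto_const_nhds.congr' ?_
    filter_upwards [nhdsWithin_le_nhds (gt_mem_nhds (norm_pos_iff.2 hz))] with ε hε
    exact (indicator_of_mem (s := {z : Euc d | ε < ‖z‖}) hε _).symm

/-- At a minimum point the jump operator dominates the contribution of the jumps weighted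
by `ξ`. -/
theorem le_lim_Leps_of_min (hJ : LevyDensity d φ J K) (hκ : JumpCoeff d κ κ₀ κ₁ κ₂ δ)
    (hf : Continuous f) (hfb : ∃ N, ∀ y, |f y| ≤ N) {x : Euc d} (hmin : ∀ y, f x ≤ f y)
    (hξc : Continuous ξ) (hξs : HasCompactSupport ξ) (hξ0 : ∀ w, 0 ≤ ξ w) (hξ1 : ∀ w, ξ w ≤ 1)
    {j : ℝ} (hj0 : 0 < j) (hj : ∀ w, w ≠ x → ξ w ≠ 0 → j ≤ J ‖w - x‖) {L : ℝ}
    (hL : Tendsto (fun ε => Leps d κ J ε f x) (nhdsWithin 0 (Ioi 0)) (nhds L)) :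
    κ₀ * j * ∫ w, ξ w * (f w - f x) ≤ L := by
  obtain ⟨N, hN⟩ := hfb
  have hκ₀ := hκ.pos₀
  have hgi : Integrable fun w => ξ w * (f w - f x) :=
    (hξc.mul (hf.sub continuous_const)).integrable_of_hasCompactSupport hξs.mul_right
  have hshift := hgi.comp_add_left x
  have hlim := (tendsto_setIntegral_lt_norm hshift).const_mul (κ₀ * j)
  rw [integral_add_left_eq_self (fun w => ξ w * (f w - f x)) x] at hlim
  refine le_of_tendsto_of_tendsto hlim hL (eventually_nhdsWithin_of_forall fun ε hε => ?_)
  simp only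
  rw [← integral_const_mul]
  refine setIntegral_mono_on (hshift.integrableOn.const_mul _)
    (integrableOn_Leps hJ hκ hε hf.measurable hN) (measurableSet_lt_norm ε) fun z hz => ?_
  have hz0 : 0 < ‖z‖ := lt_trans hε hz
  have hJz := hJ.pos_J _ hz0
  have hd : 0 ≤ f (x + z) - f x := sub_nonneg.2 (hmin _)
  have hle : κ₀ * (j * ξ (x + z)) ≤ κ x z * J ‖z‖ := by
    refine mul_le_mul (hκ.low x z) ?_ (mul_nonneg hj0.le (hξ0 _)) (hκ.nonneg x z)
    by_cases h : ξ (x + z) = 0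
    · rw [h, mul_zero]; exact hJz.le
    · have h1 := hj (x + z) (by simpa using norm_pos_iff.1 hz0) h
      rw [add_sub_cancel_left] at h1
      nlinarith [hξ1 (x + z), hξ0 (x + z)]
  calc κ₀ * j * (ξ (x + z) * (f (x + z) - f x)) = (f (x + z) - f x) * (κ₀ * (j * ξ (x + z))) := by
        ring
    _ ≤ _ := mul_le_mul_of_nonneg_left hle hd

/-- A nonnegative solution carrying mass in the region where `ξ` lives grows linearly at points
from which that region is reached by single jumps of intensity at least `j`. -/
theorem IsHeatSol.growth (hJ : LevyDensity d φ J K) (hκ : JumpCoeff d κ κ₀ κ₁ κ₂ δ)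
    (hu : IsHeatSol κ J T u) (hT : 0 < T) (hu0 : ∀ t ∈ Icc 0 T, ∀ x, 0 ≤ u t x)
    (hM0 : 0 < M) (hM : ∀ ℓ : ℝ, 0 < ℓ → ∀ y : Euc d, SecondDiffBound (cutoff ℓ y) M ℓ)
    {x₀ : Euc d} {r : ℝ} (hr : 0 < r) (hr1 : r ≤ 1)
    (hξc : Continuous ξ) (hξs : HasCompactSupport ξ) (hξ0 : ∀ w, 0 ≤ ξ w) (hξ1 : ∀ w, ξ w ≤ 1)
    {j μ : ℝ} (hj0 : 0 < j) (hμ : 0 < μ)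
    (hj : ∀ x w, ‖x - x₀‖ < r → w ≠ x → ξ w ≠ 0 → j ≤ J ‖w - x‖)
    (hm : ∀ t ∈ Ioc 0 T, μ ≤ ∫ w, ξ w * u t w) :
    κ₀ * j * μ / (2 * (1 + T * (κ₁ * M * (K / φ r) + κ₀ * j * ∫ w, ξ w))) * T ≤ u T x₀ := by
  have hκ₀ := hκ.pos₀
  have hκ₁ := hκ.pos₁
  have hK := hJ.pos_K
  have hφr := hJ.pos_φ r hr hr1
  have hI : 0 ≤ ∫ w, ξ w := integral_nonneg hξ0
  set C := κ₁ * M * (K / φ r) with hC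
  have hC0 : 0 ≤ C := by positivity
  set q := κ₀ * j * μ / (2 * (1 + T * (C + κ₀ * j * ∫ w, ξ w))) with hq
  have hq0 : 0 < q := by positivity
  have hqe : q * (1 + T * (C + κ₀ * j * ∫ w, ξ w)) = κ₀ * j * μ / 2 := by
    rw [hq]; field_simp
  set χ := cutoff r x₀ with hχ
  have hχc : Continuous χ := continuous_cutoff _ _
  have hχ0 : ∀ x, 0 ≤ χ x := cutoff_nonneg _ _
  have hχ1 : ∀ x, χ x ≤ 1 := cutoff_le_one _ _
  have hχb : ∀ x, |χ x| ≤ 1 := fun x => by rw [abs_of_nonneg (hχ0 x)]; exact hχ1 x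
  have hξi : Integrable ξ := hξc.integrable_of_hasCompactSupport hξs
  suffices h : ∀ t ∈ Icc 0 T, ∀ x, 0 ≤ u t x - q * t * χ x by
    have h1 := h T (right_mem_Icc.2 hT.le) x₀
    rw [hχ, cutoff_eq_one hr (by rw [sub_self, norm_zero]; positivity)] at h1
    linarith
  refine nonneg_of_deriv_pos_at_min (fun t ht => ?_) (fun t ht η hη => ?_) (fun t ht η hη => ?_)
    (fun x => by simpa using hu0 0 (left_mem_Icc.2 hT.le) x) (fun t ht x hneg hmin => ?_)
  · exact (hu.cont t ht).sub (continuous_const.mul hχc)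
  · have hχz : Tendsto χ (cocompact (Euc d)) (nhds 0) :=
      (hasCompactSupport_cutoff hr x₀).is_zero_at_infty
    have h := (hu.zero t ht).sub (hχz.const_mul (q * t))
    simp only [mul_zero, sub_zero] at h
    exact h.eventually (lt_mem_nhds (neg_lt_zero.2 hη))
  · have hid : ∀ᶠ s in nhdsWithin t (Icc 0 T), |s - t| < η / (2 * q) := by
      have := (continuousAt_id (x := t)).tendsto.mono_left (nhdsWithin_le_nhds (s := Icc 0 T))
      have := Metric.tendsto_nhds.1 this (η / (2 * q)) (by positivity)
      simpa [Real.dist_eq] using this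
    filter_upwards [hid, hu.time t ht (η / 2) (by positivity)] with s h1 h2 x
    have e : u s x - q * s * χ x - (u t x - q * t * χ x) =
        (u s x - u t x) - q * (s - t) * χ x := by ring
    have h3 : |q * (s - t) * χ x| ≤ q * (η / (2 * q)) * 1 := by
      rw [abs_mul, abs_mul, abs_of_pos hq0]
      gcongr
      exact hχb x
    have h4 : q * (η / (2 * q)) * 1 = η / 2 := by field_simp
    rw [e]
    linarith [abs_sub (u s x - u t x) (q * (s - t) * χ x), h2 x]
  · have ht' := Ioc_subset_Icc_self ht
    obtain ⟨L, h1, h2⟩ := hu.eqn t ht x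
    have hD : HasDerivAt (fun s => u s x - q * s * χ x) (L - q * χ x) t := by
      have := h1.fun_sub (((hasDerivAt_id' t).const_mul q).mul_const (χ x))
      simpa using this
    refine ⟨_, ?_, hD⟩
    have hqt : 0 < q * t := mul_pos hq0 ht.1
    have hχx : ‖x - x₀‖ < r := by
      by_contra! h
      have h0 : χ x = 0 := cutoff_eq_zero hr h
      rw [h0] at hneg
      linarith [hu0 t ht' x]
    have hχlim := tendsto_Leps hJ hκ hχc.measurable ⟨1, hχb⟩ hr hr1 (hM r hr x₀) x
    have hlim : Tendsto (fun ε => Leps d κ J ε (fun y => u t y - q * t * χ y) x)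
        (nhdsWithin 0 (Ioi 0)) (nhds (L + -(q * t) * jumpOp κ J χ x)) := by
      refine (h2.add (hχlim.const_mul (-(q * t)))).congr' ?_
      filter_upwards [self_mem_nhdsWithin] with ε hε
      rw [← Leps_add_mul hJ hκ hε (hu.cont t ht').measurable (hu.bdd ht') hχc.measurable
        ⟨1, hχb⟩]
      congr 1
      ext y
      ring
    have hwc : Continuous fun y => u t y - q * t * χ y :=
      (hu.cont t ht').sub (continuous_const.mul hχc)
    have hwb : ∃ N, ∀ y, |u t y - q * t * χ y| ≤ N := by
      obtain ⟨N, hN⟩ := hu.bdd ht'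
      refine ⟨N + q * t * 1, fun y => (abs_sub _ _).trans (add_le_add (hN y) ?_)⟩
      rw [abs_mul, abs_of_pos hqt]
      gcongr
      exact hχb y
    have hkey := le_lim_Leps_of_min hJ hκ hwc hwb hmin hξc hξs hξ0 hξ1 hj0
      (fun w hw => hj x w hχx hw) hlim
    have hui : Integrable fun w => ξ w * u t w :=
      (hξc.mul (hu.cont t ht')).integrable_of_hasCompactSupport hξs.mul_right
    have hwi : Integrable fun w => ξ w * ((u t w - q * t * χ w) - (u t x - q * t * χ x)) :=
      (hξc.mul (hwc.sub continuous_const)).integrable_of_hasCompactSupport hξs.mul_right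
    have hmass : μ - q * t * ∫ w, ξ w ≤
        ∫ w, ξ w * ((u t w - q * t * χ w) - (u t x - q * t * χ x)) := by
      have h3 := integral_mono (hui.sub (hξi.const_mul (q * t))) hwi fun w => by
        simp only [Pi.sub_apply]
        have h5 : q * t * χ w ≤ q * t * 1 := mul_le_mul_of_nonneg_left (hχ1 w) hqt.le
        have := mul_le_mul_of_nonneg_left
          (by linarith : u t w - q * t ≤ (u t w - q * t * χ w) - (u t x - q * t * χ x)) (hξ0 w)
        linarith
      have h4 := integral_sub hui (hξi.const_mul (q * t))
      simp only [Pi.sub_apply] at h3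
      rw [h4, integral_const_mul] at h3
      linarith [hm t ht]
    have hjump := (abs_le.1 (jumpOp_bound hJ hκ hχc.measurable ⟨1, hχb⟩ hr hr1 (hM r hr x₀) x)).1
    have k1 := mul_le_mul_of_nonneg_left hmass (by positivity : 0 ≤ κ₀ * j)
    have k2 := mul_le_mul_of_nonneg_left hjump hqt.le
    have k3 : q * χ x ≤ q := mul_le_of_le_one_right hq0.le (hχ1 x)
    have k4 : q * t * (C + κ₀ * j * ∫ w, ξ w) ≤ q * T * (C + κ₀ * j * ∫ w, ξ w) := by
      have := ht.2
      gcongr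
    have k5 : 0 < κ₀ * j * μ := by positivity
    rw [← hC] at k2
    linarith

end Growth

section NearDiagonal

set_option linter.unusedSectionVars false

variable {d : ℕ} {φ J : ℝ → ℝ} {a₁ α₁ C₀ a b β κ₀ κ₁ κ₂ δ K a₂ α₂ T M : ℝ}
  {κ : Euc d → Euc d → ℝ} {Φinv : ℝ → ℝ} {p : ℝ → Euc d → Euc d → ℝ}
  {u : ℝ → Euc d → ℝ} {ξ : Euc d → ℝ} [Nonempty (Fin d)]

/-- The volume of the unit ball. -/
noncomputable def unitVol (d : ℕ) : ℝ := volume.real (Metric.ball (0 : Euc d) 1)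

theorem unitVol_pos (d : ℕ) : 0 < unitVol d :=
  ENNReal.toReal_pos (Metric.measure_ball_pos volume _ one_pos).ne' measure_ball_lt_top.ne

theorem volume_real_closedBall (y : Euc d) {r : ℝ} (hr : 0 ≤ r) :
    volume.real (Metric.closedBall y r) = unitVol d * r ^ d := by
  rw [Measure.addHaar_real_closedBall volume y hr, finrank_euclideanSpace_fin, mul_comm]
  rfl

theorem integrable_cutoff {ℓ : ℝ} (hℓ : 0 < ℓ) (y : Euc d) : Integrable (cutoff ℓ y) :=
  (continuous_cutoff _ _).integrable_of_hasCompactSupport (hasCompactSupport_cutoff hℓ y)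

theorem integral_cutoff_le {ℓ : ℝ} (hℓ : 0 < ℓ) (y : Euc d) :
    ∫ x, cutoff ℓ y x ≤ unitVol d * ℓ ^ d := by
  rw [← volume_real_closedBall y hℓ.le, ← integral_indicator_one Metric.isClosed_closedBall.measurableSet]
  refine integral_mono (integrable_cutoff hℓ y) ?_ fun x => ?_
  · exact (integrable_indicator_iff Metric.isClosed_closedBall.measurableSet).2
      (integrableOn_const measure_closedBall_lt_top.ne)
  · by_cases h : x ∈ Metric.closedBall y ℓ
    · rw [indicator_of_mem h]; exact cutoff_le_one _ _ _
    · rw [indicator_of_notMem h, cutoff_eq_zero hℓ]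
      rw [mem_closedBall_iff_norm] at h
      exact (not_le.1 h).le

theorem le_integral_cutoff {ℓ : ℝ} (hℓ : 0 < ℓ) (y : Euc d) :
    unitVol d * (ℓ / 2) ^ d ≤ ∫ x, cutoff ℓ y x := by
  rw [← volume_real_closedBall y (half_pos hℓ).le,
    ← integral_indicator_one Metric.isClosed_closedBall.measurableSet]
  refine integral_mono ?_ (integrable_cutoff hℓ y) fun x => ?_
  · exact (integrable_indicator_iff Metric.isClosed_closedBall.measurableSet).2
      (integrableOn_const measure_closedBall_lt_top.ne)
  · by_cases h : x ∈ Metric.closedBall y (ℓ / 2)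
    · rw [indicator_of_mem h, cutoff_eq_one hℓ (mem_closedBall_iff_norm.1 h)]; rfl
    · rw [indicator_of_notMem h]; exact cutoff_nonneg _ _ _

/-- Linear growth with the constant written in scale invariant terms. -/
theorem IsHeatSol.growth_of_le (hJ : LevyDensity d φ J K) (hκ : JumpCoeff d κ κ₀ κ₁ κ₂ δ)
    (hu : IsHeatSol κ J T u) (hT : 0 < T) (hu0 : ∀ t ∈ Icc 0 T, ∀ x, 0 ≤ u t x)
    (hM0 : 0 < M) (hM : ∀ ℓ : ℝ, 0 < ℓ → ∀ y : Euc d, SecondDiffBound (cutoff ℓ y) M ℓ)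
    {x₀ y : Euc d} {r ℓ : ℝ} (hr : 0 < r) (hr1 : r ≤ 1) (hℓ : 0 < ℓ)
    {j μ A B : ℝ} (hj0 : 0 < j) (hμ : 0 < μ)
    (hj : ∀ x w, ‖x - x₀‖ < r → w ≠ x → ‖w - y‖ < ℓ → j ≤ J ‖w - x‖)
    (hm : ∀ t ∈ Ioc 0 T, μ ≤ ∫ w, cutoff ℓ y w * u t w)
    (hA : T ≤ A * φ r) (hB : T * j * ℓ ^ d ≤ B) :
    κ₀ / (2 * (1 + κ₁ * M * K * A + κ₀ * unitVol d * B)) * (j * μ * T) ≤ u T x₀ := by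
  have hκ₀ := hκ.pos₀
  have hκ₁ := hκ.pos₁
  have hK := hJ.pos_K
  have hφr := hJ.pos_φ r hr hr1
  have hV := unitVol_pos d
  have hA0 : 0 < A := pos_of_mul_pos_left (hT.trans_le hA) hφr.le
  have hB0 : 0 < B := lt_of_lt_of_le (by positivity) hB
  have hI0 : 0 ≤ ∫ w, cutoff ℓ y w := integral_nonneg (cutoff_nonneg _ _)
  refine le_trans ?_ (hu.growth hJ hκ hT hu0 hM0 hM hr hr1 (continuous_cutoff ℓ y)
    (hasCompactSupport_cutoff hℓ y) (cutoff_nonneg _ _) (cutoff_le_one _ _) hj0 hμ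
    (fun x w hx hw hξ => hj x w hx hw (lt_of_not_ge fun h => hξ (cutoff_eq_zero hℓ h))) hm)
  have h1 : T * (κ₁ * M * (K / φ r)) ≤ κ₁ * M * K * A := by
    rw [show T * (κ₁ * M * (K / φ r)) = κ₁ * M * K * (T / φ r) by ring]
    have : T / φ r ≤ A := (div_le_iff₀ hφr).2 hA
    gcongr
  have h2 : T * (κ₀ * j * ∫ w, cutoff ℓ y w) ≤ κ₀ * unitVol d * B := by
    have h3 := mul_le_mul_of_nonneg_left (integral_cutoff_le hℓ y)
      (by positivity : 0 ≤ T * (κ₀ * j))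
    have h4 := mul_le_mul_of_nonneg_left hB (by positivity : 0 ≤ κ₀ * unitVol d)
    linarith
  have h3 : 1 + T * (κ₁ * M * (K / φ r) + κ₀ * j * ∫ w, cutoff ℓ y w) ≤
      1 + κ₁ * M * K * A + κ₀ * unitVol d * B := by linarith
  calc κ₀ / (2 * (1 + κ₁ * M * K * A + κ₀ * unitVol d * B)) * (j * μ * T)
      = κ₀ * j * μ / (2 * (1 + κ₁ * M * K * A + κ₀ * unitVol d * B)) * T := by ring
    _ ≤ _ := by
      refine mul_le_mul_of_nonneg_right ?_ hT.le
      exact div_le_div_of_nonneg_left (by positivity) (by positivity) (by linarith)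

/-- On-diagonal lower bound for small times. -/
theorem HeatSetup.exists_near_diagonal_small_time
    (S : HeatSetup d φ J a₁ α₁ C₀ a b β κ κ₀ κ₁ κ₂ δ Φinv p K a₂ α₂) :
    ∃ t₀ c : ℝ, 0 < t₀ ∧ 0 < c ∧ ∀ t, 0 < t → t ≤ t₀ → ∀ x y : Euc d,
      ‖x - y‖ ≤ phiInvGen φ t → c / phiInvGen φ t ^ d ≤ p t x y := by
  have H := S.hyp
  have hκ := H.jumpCoeff
  have hκ₀ := hκ.pos₀
  have hκ₁ := hκ.pos₁
  have hK := S.levy.pos_K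
  have ha : 0 < a := one_pos.trans_le H.ha
  have ha₂ := S.a₂_pos
  have hV := unitVol_pos d
  obtain ⟨t₀, M, ht₀, ht₀1, ht₀φ, hM1, hmass⟩ := S.exists_mass_lower_bound
  obtain ⟨Mc, hMc, hcut⟩ := exists_cutoff_secondDiffBound d
  obtain ⟨cu, hcu, hup⟩ := S.exists_kernel_le 1 le_rfl
  have hM0 : 0 < M := one_pos.trans_le hM1
  set q := κ₀ / (2 * (1 + κ₁ * Mc * K * 1 + κ₀ * unitVol d * a)) with hq
  have hq0 : 0 < q := by positivity
  set c := q * (a⁻¹ / ((M + 6) ^ d * (a₂ * (M + 6) ^ α₂)) / 8) with hc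
  have hc0 : 0 < c := by positivity
  refine ⟨t₀, c / 2, ht₀, by positivity, fun t ht htt x y hxy => ?_⟩
  obtain ⟨hψM, hm⟩ := hmass t ht htt
  obtain ⟨hψ0, hψ1, hψφ⟩ := phiInvGen_spec H ht
  rw [min_eq_left (htt.trans ht₀φ)] at hψφ
  set ψ := phiInvGen φ t with hψ
  set R := (M + 6) * ψ with hR
  have hR0 : 0 < R := by positivity
  have hψR : ψ ≤ R := by rw [hR]; nlinarith
  have hφR := phi_pos H hR0 hψM
  have htR : t ≤ φ R := hψφ ▸ phi_le_phi H hψ0.le hψR hψM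
  have hRt : φ R ≤ a₂ * (M + 6) ^ α₂ * t := by
    have := phi_upper_scaling H S.scal hψ0 hψR hψM
    rwa [hψφ, hR, mul_div_cancel_right₀ _ hψ0.ne'] at this
  have hflow : ∀ ω r : ℝ, 0 < ω → 0 < r → r ≤ 1 → ∃ f : CZero d, (∀ x, 0 ≤ f x) ∧ Integrable f ∧
      ∫ x, f x ≤ 1 ∧ ∫ x, (1 - cutoff r y x) * f x ≤ ω ∧ c / ψ ^ d ≤ heatOp p t f x := by
    intro ω r hω hr hr1
    obtain ⟨f, hf0, hfi, hf1, hfω, hfm⟩ := hm y ω r hω hr hr1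
    refine ⟨f, hf0, hfi, hf1, hfω, ?_⟩
    have hsol := (S.admissible f.continuous f.zero).isHeatSol_shift H S.inv S.ker S.levy
      (half_pos ht) (t / 2)
    have hg := hsol.growth_of_le (x₀ := x) (y := y) (r := ψ) (ℓ := M * ψ) (j := J R) (μ := 1 / 4)
      (A := 1) (B := a) S.levy hκ (half_pos ht)
      (fun s hs z => S.heatOp_nonneg (by linarith [hs.1]) hf0 z)
      hMc hcut hψ0 hψ1 (by positivity) (H.J_pos R hR0) (by norm_num)
      (fun z w hz hwz hw => H.J_anti (norm_pos_iff.2 (sub_ne_zero.2 hwz)) hR0 ?_)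
      (fun s hs => hfm _ (by linarith [hs.1]) (by linarith [hs.2])) (by rw [hψφ]; linarith) ?_
    · rw [← hq, add_halves] at hg
      refine le_trans ?_ hg
      rw [hc, mul_div_assoc]
      refine mul_le_mul_of_nonneg_left ?_ hq0.le
      have h1 : a⁻¹ / (R ^ d * (a₂ * (M + 6) ^ α₂ * t)) ≤ J R :=
        le_trans (by gcongr) (H.hJ1_low R hR0 hψM)
      calc a⁻¹ / ((M + 6) ^ d * (a₂ * (M + 6) ^ α₂)) / 8 / ψ ^ d
          = a⁻¹ / (R ^ d * (a₂ * (M + 6) ^ α₂ * t)) * (1 / 4) * (t / 2) := by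
            rw [hR, mul_pow]; field_simp; norm_num
        _ ≤ _ := by gcongr
    · have e : w - z = (w - y) - (x - y) - (z - x) := by abel
      have h2 : ‖w - z‖ ≤ ‖w - y‖ + ‖x - y‖ + ‖z - x‖ := by
        rw [e]; exact (norm_sub_le _ _).trans (add_le_add_left (norm_sub_le _ _) _)
      rw [hR]
      nlinarith
    · have h3 : J R ≤ a / (R ^ d * t) := (H.hJ1_up R hR0 hψM).trans (by gcongr)
      calc t / 2 * J R * (M * ψ) ^ d ≤ t / 2 * (a / (R ^ d * t)) * R ^ d := by
            gcongr
            rw [hR]; gcongr; linarith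
        _ = a / 2 := by field_simp
        _ ≤ a := by linarith
  by_contra! hlt
  set m := c / 2 / ψ ^ d with hmdef
  have hm0 : 0 < m := by positivity
  set N := cu / ψ ^ d with hN
  have hN0 : 0 < N := by positivity
  have hkc := continuous_kernel_right S.ker ht x
  obtain ⟨r, hr, hball⟩ := Metric.isOpen_iff.1 (isOpen_lt hkc continuous_const) y hlt
  obtain ⟨f, hf0, hfi, hf1, hfω, hfl⟩ := hflow (m / (2 * N)) (min r 1) (by positivity)
    (by positivity) (min_le_right _ _)
  have hadm := S.admissible f.continuous f.zero
  have hcf : Integrable fun z => (1 - cutoff (min r 1) y z) * f z := by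
    refine Integrable.mono' hfi ((continuous_const.sub (continuous_cutoff _ _)).mul
      f.continuous).aestronglyMeasurable (Eventually.of_forall fun z => ?_)
    have h1 := cutoff_nonneg (min r 1) y z
    have h2 := cutoff_le_one (min r 1) y z
    rw [Real.norm_of_nonneg (mul_nonneg (by linarith) (hf0 z))]
    nlinarith [hf0 z]
  have hle : heatOp p t f x ≤ m * (∫ z, f z) + N * ∫ z, (1 - cutoff (min r 1) y z) * f z := by
    rw [← integral_const_mul, ← integral_const_mul,
      ← integral_add (hfi.const_mul m) (hcf.const_mul N)]
    refine integral_mono (hadm.integrable S.ker ht x) ((hfi.const_mul m).add (hcf.const_mul N))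
      fun z => ?_
    simp only
    have h1 := cutoff_nonneg (min r 1) y z
    have h2 := cutoff_le_one (min r 1) y z
    have hf := hf0 z
    by_cases hz : ‖z - y‖ < min r 1
    · have h3 : p t x z < m := hball (mem_ball_iff_norm.2 (hz.trans_le (min_le_left _ _)))
      have h4 : 0 ≤ N * ((1 - cutoff (min r 1) y z) * f z) :=
        mul_nonneg hN0.le (mul_nonneg (by linarith) hf)
      linarith [mul_le_mul_of_nonneg_right h3.le hf]
    · rw [cutoff_eq_zero (by positivity) (not_lt.1 hz)]
      have h3 := (hup t ht (htt.trans ht₀1) x z).1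
      linarith [mul_le_mul_of_nonneg_right h3 hf, mul_nonneg hm0.le hf]
  have h5 : m * ∫ z, f z ≤ m * 1 := mul_le_mul_of_nonneg_left hf1 hm0.le
  have h6 := mul_le_mul_of_nonneg_left hfω hN0.le
  have h7 : N * (m / (2 * N)) = m / 2 := by field_simp
  have h8 : c / ψ ^ d = 2 * m := by rw [hmdef]; ring
  linarith

end NearDiagonal

section LowerBound

set_option linter.unusedSectionVars false

variable {d : ℕ} {φ J : ℝ → ℝ} {a₁ α₁ C₀ a b β κ₀ κ₁ κ₂ δ K a₂ α₂ T : ℝ}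
  {κ : Euc d → Euc d → ℝ} {Φinv : ℝ → ℝ} {p : ℝ → Euc d → Euc d → ℝ}
  [Nonempty (Fin d)]

theorem HeatSetup.chapman_kolmogorov_le
    (S : HeatSetup d φ J a₁ α₁ C₀ a b β κ κ₀ κ₁ κ₂ δ Φinv p K a₂ α₂) {s t c c' ρ : ℝ}
    (hs : 0 < s) (ht : 0 < t) (hc : 0 ≤ c) (hρ : 0 < ρ)
    (h : ∀ x y : Euc d, ‖x - y‖ ≤ ρ → c ≤ p s x y)
    (h' : ∀ x y : Euc d, ‖x - y‖ ≤ ρ → c' ≤ p t x y) {x y : Euc d} (hxy : ‖x - y‖ ≤ ρ) :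
    c' * c * (unitVol d * (ρ / 2) ^ d) ≤ p (s + t) x y := by
  rw [← S.heatOp_kernel hs ht x y, heatOp, ← volume_real_closedBall (midpoint ℝ x y)
    (half_pos hρ).le]
  have hadm := S.admissible (continuous_kernel_left S.ker hs y)
    (S.kernel_tendsto_left hs y)
  have hInt : Integrable fun z => p t x z * p s z y := hadm.integrable S.ker ht x
  have hdist : ∀ z ∈ Metric.closedBall (midpoint ℝ x y) (ρ / 2), ‖x - z‖ ≤ ρ ∧ ‖z - y‖ ≤ ρ := by
    intro z hz
    have h1 := dist_left_midpoint (𝕜 := ℝ) x y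
    have h2 := dist_midpoint_right (𝕜 := ℝ) x y
    rw [Metric.mem_closedBall] at hz
    rw [← dist_eq_norm] at hxy
    rw [Real.norm_ofNat] at h1 h2
    rw [← dist_eq_norm, ← dist_eq_norm]
    have h3 := dist_triangle_right x z (midpoint ℝ x y)
    have h4 := dist_triangle z (midpoint ℝ x y) y
    constructor <;> linarith
  calc c' * c * volume.real (Metric.closedBall (midpoint ℝ x y) (ρ / 2))
      ≤ ∫ z in Metric.closedBall (midpoint ℝ x y) (ρ / 2), p t x z * p s z y :=
        setIntegral_ge_of_const_le_real Metric.isClosed_closedBall.measurableSet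
          measure_closedBall_lt_top.ne
          (fun z hz => mul_le_mul (h' _ _ (hdist z hz).1) (h _ _ (hdist z hz).2) hc
            (S.kernel_nonneg ht _ _)) hInt.integrableOn
    _ ≤ _ := setIntegral_le_integral hInt (Eventually.of_forall fun z =>
        mul_nonneg (S.kernel_nonneg ht _ _) (S.kernel_nonneg hs _ _))

/-- On-diagonal lower bound. -/
theorem HeatSetup.exists_near_diagonal
    (S : HeatSetup d φ J a₁ α₁ C₀ a b β κ κ₀ κ₁ κ₂ δ Φinv p K a₂ α₂) (T : ℝ) :
    ∃ ε c : ℝ, 0 < ε ∧ ε ≤ 1 ∧ 0 < c ∧ ∀ t, 0 < t → t ≤ T → ∀ x y : Euc d,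
      ‖x - y‖ ≤ ε * phiInvGen φ t → c / phiInvGen φ t ^ d ≤ p t x y := by
  obtain ⟨t₀, c, ht₀, hc, hsmall⟩ := S.exists_near_diagonal_small_time
  have hτ := half_pos ht₀
  obtain ⟨hρ, hρ1, -⟩ := phiInvGen_spec S.hyp hτ
  have hV := unitVol_pos d
  set ρ := phiInvGen φ (t₀ / 2) with hρdef
  have hbase : ∀ t, t₀ / 2 ≤ t → t ≤ t₀ → ∀ x y : Euc d, ‖x - y‖ ≤ ρ → c ≤ p t x y := by
    intro t h1 h2 x y hxy
    have ht : 0 < t := hτ.trans_le h1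
    obtain ⟨q0, q1, -⟩ := phiInvGen_spec S.hyp ht
    refine le_trans ?_ (hsmall t ht h2 x y (hxy.trans (phiInvGen_mono S.hyp hτ h1)))
    rw [le_div_iff₀ (by positivity)]
    exact mul_le_of_le_one_right hc.le (pow_le_one₀ q0.le q1)
  have hind : ∀ n : ℕ, ∃ c', 0 < c' ∧ ∀ t, t₀ / 2 ≤ t → t ≤ t₀ + n * (t₀ / 2) → ∀ x y : Euc d,
      ‖x - y‖ ≤ ρ → c' ≤ p t x y := by
    intro n
    induction n with
    | zero => exact ⟨c, hc, fun t h1 h2 => hbase t h1 (by simpa using h2)⟩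
    | succ n ih =>
      obtain ⟨c', hc', ih⟩ := ih
      refine ⟨min c (c * c' * (unitVol d * (ρ / 2) ^ d)), by positivity, fun t h1 h2 x y hxy => ?_⟩
      rcases le_total t t₀ with h | h
      · exact (min_le_left _ _).trans (hbase t h1 h x y hxy)
      · refine (min_le_right _ _).trans ?_
        push_cast at h2
        have := S.chapman_kolmogorov_le (s := t - t₀ / 2) (t := t₀ / 2) (by linarith) hτ hc'.le
          hρ (ih _ (by linarith) (by linarith)) (hbase _ le_rfl (by linarith)) hxy
        rwa [sub_add_cancel] at this
  obtain ⟨n, hn⟩ := exists_nat_ge (T / (t₀ / 2))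
  rw [div_le_iff₀ hτ] at hn
  obtain ⟨c', hc', hlarge⟩ := hind n
  refine ⟨ρ, min c (c' * ρ ^ d), hρ, hρ1, by positivity, fun t ht htT x y hxy => ?_⟩
  obtain ⟨q0, q1, -⟩ := phiInvGen_spec S.hyp ht
  rcases le_total t t₀ with h | h
  · refine le_trans ?_ (hsmall t ht h x y (hxy.trans (mul_le_of_le_one_left q0.le hρ1)))
    gcongr
    exact min_le_left _ _
  · refine le_trans ?_ (hlarge t (by linarith) (by linarith) x y
      (hxy.trans (mul_le_of_le_one_right hρ.le q1)))
    rw [div_le_iff₀ (by positivity)]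
    refine (min_le_right _ _).trans ?_
    have := phiInvGen_mono S.hyp hτ (by linarith : t₀ / 2 ≤ t)
    gcongr

theorem exists_phiInvGen_le_half (H : HKAssumptions d φ J a₁ α₁ C₀ a b β κ κ₀ κ₁ κ₂ δ) :
    ∃ C : ℝ, 0 < C ∧ ∀ t, 0 < t → phiInvGen φ t ≤ C * phiInvGen φ (t / 2) := by
  have ha₁ := H.a₁_pos
  have hα₁ := H.α₁_pos
  refine ⟨(2 / a₁) ^ α₁⁻¹, by positivity, fun t ht => ?_⟩
  have ht2 := half_pos ht
  obtain ⟨p0, p1, p2⟩ := phiInvGen_spec H ht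
  obtain ⟨q0, q1, q2⟩ := phiInvGen_spec H ht2
  have hφ1 := phi_pos H one_pos le_rfl
  have h := phi_lower_scaling H q0 (phiInvGen_mono H ht2 (by linarith : t / 2 ≤ t)) p1
  have hle : φ (phiInvGen φ t) ≤ 2 * φ (phiInvGen φ (t / 2)) := by
    rw [p2, q2, mul_min_of_nonneg _ _ zero_le_two]
    exact min_le_min (by linarith) (by linarith)
  have hφ := phi_pos H q0 q1
  have h1 : a₁ * (phiInvGen φ t / phiInvGen φ (t / 2)) ^ α₁ ≤ 2 :=
    le_of_mul_le_mul_right (h.trans hle) hφ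
  rw [← div_le_iff₀ q0, Real.le_rpow_inv_iff_of_pos (by positivity) (by positivity) hα₁,
    le_div_iff₀ ha₁, mul_comm]
  exact h1

/-- Off-diagonal lower bound in terms of the jump intensity. -/
theorem HeatSetup.exists_off_diagonal
    (S : HeatSetup d φ J a₁ α₁ C₀ a b β κ κ₀ κ₁ κ₂ δ Φinv p K a₂ α₂) (T : ℝ) (hT : 0 < T)
    {ε c : ℝ} (hε : 0 < ε) (hε1 : ε ≤ 1) (hc : 0 < c)
    (hnear : ∀ t, 0 < t → t ≤ T → ∀ x y : Euc d,
      ‖x - y‖ ≤ ε * phiInvGen φ t → c / phiInvGen φ t ^ d ≤ p t x y) :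
    ∃ c' : ℝ, 0 < c' ∧ ∀ t, 0 < t → t ≤ T → ∀ x y : Euc d,
      ε * phiInvGen φ t < ‖x - y‖ → c' * (t * J ‖x - y‖) ≤ p t x y := by
  have H := S.hyp
  have hκ := H.jumpCoeff
  have hκ₀ := hκ.pos₀
  have hκ₁ := hκ.pos₁
  have hK := S.levy.pos_K
  have ha : 0 < a := one_pos.trans_le H.ha
  have ha₂ := S.a₂_pos
  have hV := unitVol_pos d
  have hφ1 := phi_pos H one_pos le_rfl
  obtain ⟨Mc, hMc, hcut⟩ := exists_cutoff_secondDiffBound d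
  obtain ⟨C, hC, hhalf⟩ := exists_phiInvGen_le_half H
  set A := max 1 (T / φ 1) * (a₂ * (5 / ε) ^ α₂) with hA
  have hA0 : 0 < A := by positivity
  set q := κ₀ / (2 * (1 + κ₁ * Mc * K * A + κ₀ * unitVol d * (a * A))) with hq
  have hq0 : 0 < q := by positivity
  refine ⟨q * (c * (unitVol d * (ε / (10 * C)) ^ d) / 2), by positivity, fun t ht htT x y hxy => ?_⟩
  have ht2 := half_pos ht
  obtain ⟨p0, p1, -⟩ := phiInvGen_spec H ht
  obtain ⟨q0, q1, q2⟩ := phiInvGen_spec H ht2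
  have hψC := hhalf t ht
  have hψle := phiInvGen_mono H ht2 (by linarith : t / 2 ≤ t)
  set ψ := phiInvGen φ t with hψ
  set ψ' := phiInvGen φ (t / 2) with hψ'
  set D := ‖x - y‖ with hD
  set r := ε / 5 * ψ' with hr
  have hr0 : 0 < r := by positivity
  have h5r : 5 * r = ε * ψ' := by rw [hr]; ring
  have h5r1 : 5 * r ≤ 1 := h5r ▸ mul_le_one₀ hε1 q0.le q1
  have hr1 : r ≤ 1 := by linarith
  have h5D : 5 * r < D := lt_of_le_of_lt (by rw [h5r]; gcongr) hxy
  have hD0 : 0 < D := by linarith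
  have hφr := phi_pos H hr0 hr1
  have hTA : t / 2 ≤ A * φ r := by
    have hrψ : r ≤ ψ' := by linarith [h5r, mul_le_of_le_one_left q0.le hε1]
    have h1 := phi_upper_scaling H S.scal hr0 hrψ q1
    rw [show ψ' / r = 5 / ε by rw [hr]; field_simp] at h1
    have h2 : t / 2 ≤ max 1 (T / φ 1) * φ ψ' := by
      rw [q2]
      rcases min_cases (t / 2) (φ 1) with ⟨e, -⟩ | ⟨e, -⟩ <;> rw [e]
      · exact le_mul_of_one_le_left ht2.le (le_max_left _ _)
      · calc t / 2 ≤ T := by linarith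
          _ = T / φ 1 * φ 1 := by field_simp
          _ ≤ _ := by gcongr; exact le_max_right _ _
    calc t / 2 ≤ max 1 (T / φ 1) * (a₂ * (5 / ε) ^ α₂ * φ r) := h2.trans (by gcongr)
      _ = A * φ r := by rw [hA]; ring
  have hJD : J D ≤ a / (r ^ d * φ r) :=
    (H.J_anti hr0 hD0 (by linarith)).trans (H.hJ1_up r hr0 hr1)
  set z := y + (3 * r / D) • (x - y) with hz
  have hzy : ‖z - y‖ = 3 * r := by
    rw [hz, add_sub_cancel_left, norm_smul, Real.norm_of_nonneg (by positivity), ← hD]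
    field_simp
  have hxz : ‖x - z‖ = D - 3 * r := by
    have e : x - z = (1 - 3 * r / D) • (x - y) := by
      rw [hz, sub_smul, one_smul]; abel
    have h1 : 3 * r / D ≤ 1 := (div_le_one hD0).2 (by linarith)
    rw [e, norm_smul, Real.norm_of_nonneg (by linarith), ← hD]
    field_simp
  have ht4 : 0 < t / 4 := by positivity
  have hadm := S.admissible (continuous_kernel_left S.ker ht4 y) (S.kernel_tendsto_left ht4 y)
  have hsol := hadm.isHeatSol_shift H S.inv S.ker S.levy ht4 (t / 2)
  have hue : ∀ s, 0 ≤ s → ∀ w, heatOp p (t / 4 + s) (fun v => p (t / 4) v y) w =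
      p (t / 2 + s) w y := fun s hs w => by
    rw [S.heatOp_kernel ht4 (by linarith) w y]; congr 1; ring
  have hg := hsol.growth_of_le (x₀ := x) (y := z) (r := r) (ℓ := r) (j := J D)
    (μ := c / ψ ^ d * (unitVol d * (r / 2) ^ d))
    (A := A) (B := a * A) S.levy hκ ht2
    (fun s hs w => (hue s hs.1 w).symm ▸ S.kernel_nonneg (by linarith [hs.1]) _ _)
    hMc hcut hr0 hr1 hr0 (H.J_pos D hD0) (by positivity)
    (fun v w hv hwv hw => H.J_anti (norm_pos_iff.2 (sub_ne_zero.2 hwv)) hD0 ?_)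
    (fun s hs => ?_) hTA ?_
  · refine le_trans ?_ (hg.trans_eq ((hue _ ht2.le x).trans (by rw [add_halves])))
    rw [← hq, mul_assoc]
    refine mul_le_mul_of_nonneg_left ?_ hq0.le
    have h1 : ε / (10 * C) ≤ r / 2 / ψ := by
      rw [hr, div_le_div_iff₀ (by positivity) p0]
      calc ε * ψ ≤ ε * (C * ψ') := by gcongr
        _ = _ := by ring
    have hJ0 := H.J_pos D hD0
    calc c * (unitVol d * (ε / (10 * C)) ^ d) / 2 * (t * J D)
        ≤ c * (unitVol d * (r / 2 / ψ) ^ d) / 2 * (t * J D) := by gcongr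
      _ = _ := by rw [div_pow (r / 2)]; ring
  · have e : w - v = (w - z) - (x - z) - (v - x) := by abel
    have h2 : ‖w - v‖ ≤ ‖w - z‖ + ‖x - z‖ + ‖v - x‖ := by
      rw [e]; exact (norm_sub_le _ _).trans (add_le_add_left (norm_sub_le _ _) _)
    linarith
  · refine (mul_le_mul_of_nonneg_left (le_integral_cutoff hr0 z) (by positivity)).trans ?_
    rw [← integral_const_mul]
    refine integral_mono ((integrable_cutoff hr0 z).const_mul _) (((continuous_cutoff _ _).mul
      (hsol.cont s (Ioc_subset_Icc_self hs))).integrable_of_hasCompactSupport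
      (hasCompactSupport_cutoff hr0 z).mul_right) fun w => ?_
    simp only
    rw [hue s hs.1.le w, mul_comm]
    by_cases hw : ‖w - z‖ < r
    · refine mul_le_mul_of_nonneg_left ?_ (cutoff_nonneg _ _ _)
      have hs0 : 0 < t / 2 + s := by linarith [hs.1]
      have hst : t / 2 + s ≤ t := by linarith [hs.2]
      obtain ⟨s0, -, -⟩ := phiInvGen_spec H hs0
      have hwy : ‖w - y‖ ≤ ε * phiInvGen φ (t / 2 + s) := by
        have h1 := norm_sub_le_norm_sub_add_norm_sub w z y
        have h2 := mul_le_mul_of_nonneg_left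
          (phiInvGen_mono H ht2 (by linarith [hs.1] : t / 2 ≤ t / 2 + s)) hε.le
        linarith
      refine le_trans ?_ (hnear _ hs0 (hst.trans htT) w y hwy)
      have := phiInvGen_mono H hs0 hst
      gcongr
    · rw [cutoff_eq_zero hr0 (not_lt.1 hw), zero_mul, zero_mul]
  · have h3 : t / 2 * J D * r ^ d ≤ A * φ r * (a / (r ^ d * φ r)) * r ^ d := by
      have hJ0 := H.J_pos D hD0
      gcongr
    refine h3.trans_eq ?_
    field_simp

end LowerBound

theorem heat_kernel_two_sided_estimates
    (d : ℕ) (φ J : ℝ → ℝ) (a₁ α₁ C₀ a b β : ℝ)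
    (κ : EuclideanSpace ℝ (Fin d) → EuclideanSpace ℝ (Fin d) → ℝ)
    (κ₀ κ₁ κ₂ δ : ℝ)
    (H : HKAssumptions d φ J a₁ α₁ C₀ a b β κ κ₀ κ₁ κ₂ δ)
    (Φinv : ℝ → ℝ) (HΦ : PhiInvSpec φ Φinv)
    -- extra lower bound on J:
    (a₁' b₁ β₁ : ℝ) (ha₁' : 0 < a₁') (hb₁ : 0 < b₁) (hβ₁ : 0 < β₁)
    (hJlow : ∀ r : ℝ, 1 < r → a₁' * Real.exp (-b₁ * r ^ β₁) ≤ J r)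
    -- upper weak scaling condition on φ:
    (a₂ α₂ : ℝ) (ha₂ : 0 < a₂) (hα₂ : 0 < α₂) (hα₂' : α₂ < 2)
    (hUS : ∀ r R : ℝ, 0 < r → r ≤ R → R ≤ 1 → φ R / φ r ≤ a₂ * (R / r) ^ α₂)
    (p : ℝ → EuclideanSpace ℝ (Fin d) → EuclideanSpace ℝ (Fin d) → ℝ)
    (hp : GoodHeatKernel d φ J b β Φinv κ p) :
    ∀ T : ℝ, 1 ≤ T → ∃ c₁ : ℝ, 1 ≤ c₁ ∧ ∀ t : ℝ, 0 < t → t ≤ T →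
      ∀ x y : EuclideanSpace ℝ (Fin d),
      (‖x - y‖ ≤ 1 →
        c₁⁻¹ * (if x = y then 1 / phiInvGen φ t ^ d
                else min (1 / phiInvGen φ t ^ d) (t / (‖x - y‖ ^ d * φ ‖x - y‖)))
          ≤ p t x y
        ∧ p t x y ≤
          c₁ * (if x = y then 1 / phiInvGen φ t ^ d
                else min (1 / phiInvGen φ t ^ d) (t / (‖x - y‖ ^ d * φ ‖x - y‖))))
      ∧ (1 < ‖x - y‖ →
        c₁⁻¹ * t * Real.exp (-b₁ * ‖x - y‖ ^ β₁) ≤ p t x y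
        ∧ p t x y ≤ c₁ * t * theta d φ b β ‖x - y‖) := by
  intro T hT
  have : Nonempty (Fin d) := ⟨⟨0, H.hd⟩⟩
  obtain ⟨K, hK⟩ := exists_levyDensity H hα₂' hUS
  have S : HeatSetup d φ J a₁ α₁ C₀ a b β κ κ₀ κ₁ κ₂ δ Φinv p K a₂ α₂ :=
    ⟨H, HΦ, hp, hK, ha₂, hα₂, hα₂', hUS⟩
  have ha : 0 < a := one_pos.trans_le H.ha
  obtain ⟨cu, hcu, hup⟩ := S.exists_kernel_le T hT
  obtain ⟨ε, c, hε, hε1, hc, hnear⟩ := S.exists_near_diagonal T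
  obtain ⟨c', hc', hfar⟩ := S.exists_off_diagonal T (one_pos.trans_le hT) hε hε1 hc hnear
  set m := min c (min (c' * a⁻¹) (c' * a₁')) with hm
  have hm0 : 0 < m := by positivity
  set c₁ := max cu m⁻¹ with hc₁
  have hc₁1 : 1 ≤ c₁ := hcu.trans (le_max_left _ _)
  have hc₁m : c₁⁻¹ ≤ m := inv_le_of_inv_le₀ hm0 (le_max_right _ _)
  have hmc : m ≤ c := min_le_left _ _
  have hma : m ≤ c' * a⁻¹ := (min_le_right _ _).trans (min_le_left _ _)
  have hma' : m ≤ c' * a₁' := (min_le_right _ _).trans (min_le_right _ _)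
  refine ⟨c₁, hc₁1, fun t ht htT x y => ?_⟩
  obtain ⟨hψ0, hψ1, -⟩ := phiInvGen_spec H ht
  obtain ⟨hu1, hu2, hu3⟩ := hup t ht htT x y
  have hcu1 : cu ≤ c₁ := le_max_left _ _
  refine ⟨fun hxy1 => ?_, fun hxy1 => ⟨?_, ?_⟩⟩
  · have hu1' : p t x y ≤ c₁ * (1 / phiInvGen φ t ^ d) :=
      hu1.trans (by rw [mul_one_div]; gcongr)
    by_cases hxy : x = y
    · rw [if_pos hxy]
      refine ⟨le_trans ?_ (hnear t ht htT x y (by rw [hxy, sub_self, norm_zero]; positivity)), hu1'⟩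
      rw [mul_one_div]
      gcongr
      exact hc₁m.trans hmc
    · rw [if_neg hxy]
      have hn : 0 < ‖x - y‖ := norm_pos_iff.2 (sub_ne_zero.2 hxy)
      have hφ := phi_pos H hn hxy1
      refine ⟨?_, ?_⟩
      · rcases le_or_gt ‖x - y‖ (ε * phiInvGen φ t) with h | h
        · refine le_trans ?_ (hnear t ht htT x y h)
          calc _ ≤ m * (1 / phiInvGen φ t ^ d) := by
                gcongr; exact min_le_left _ _
            _ ≤ c * (1 / phiInvGen φ t ^ d) := by gcongr
            _ = _ := mul_one_div _ _
        · refine le_trans ?_ (hfar t ht htT x y h)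
          calc _ ≤ m * (t / (‖x - y‖ ^ d * φ ‖x - y‖)) := by
                gcongr; exact min_le_right _ _
            _ ≤ c' * a⁻¹ * (t / (‖x - y‖ ^ d * φ ‖x - y‖)) := by gcongr
            _ = c' * (t * (a⁻¹ / (‖x - y‖ ^ d * φ ‖x - y‖))) := by ring
            _ ≤ _ := by gcongr; exact H.hJ1_low _ hn hxy1
      · rw [mul_min_of_nonneg _ _ (by positivity)]
        refine le_min hu1' ((hu2 hxy hxy1).trans ?_)
        rw [mul_div_assoc]
        gcongr
  · refine le_trans ?_ (hfar t ht htT x y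
      (lt_of_le_of_lt (mul_le_one₀ hε1 hψ0.le hψ1) hxy1))
    calc _ ≤ c' * a₁' * t * Real.exp (-b₁ * ‖x - y‖ ^ β₁) := by
          gcongr; exact hc₁m.trans hma'
      _ = c' * (t * (a₁' * Real.exp (-b₁ * ‖x - y‖ ^ β₁))) := by ring
      _ ≤ _ := by gcongr; exact hJlow _ hxy1
  · refine (hu3 hxy1).trans ?_
    have hθ : 0 ≤ theta d φ b β ‖x - y‖ := by
      rw [theta, if_neg (not_le.2 hxy1)]
      split_ifs <;> positivity
    gcongr
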